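/- arXiv:math/0703372 — 9 statements merged into one kernel-verified Lean document; each statement's English description precedes it below -/
import Mathlib

section
/- Let S be a finite set of points in the complex affine plane ℂ² (with the standard Hermitian inner product) that is not collinear over ℂ. Then there exist two distinct points p, q ∈ S such that the line through p and q (the affine span over ℂ of {p, q}) contains at least 2 and at most 5 points of S. -/
/-- Two complex numbers whose arguments differ by at most `π / 3` are at most as far from each other
as the farther one is from the origin. -/
theorem Complex.norm_sub_le_max_of_abs_arg_sub_le {a b : ℂ}
    (h : |a.arg - b.arg| ≤ Real.pi / 3) : ‖a - b‖ ≤ max ‖a‖ ‖b‖ := by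
  have hcos : 1 / 2 ≤ Real.cos (a.arg - b.arg) := by
    rw [← Real.cos_abs, ← Real.cos_pi_div_three]
    exact Real.cos_le_cos_of_nonneg_of_le_pi (abs_nonneg _) (by linarith [Real.pi_pos]) h
  have hsq : ‖a - b‖ ^ 2 = ‖a‖ ^ 2 + ‖b‖ ^ 2 - 2 * (‖a‖ * ‖b‖ * Real.cos (a.arg - b.arg)) := by
    have hre : ‖a‖ * ‖b‖ * Real.cos (a.arg - b.arg) = a.re * b.re + a.im * b.im := by
      rw [Real.cos_sub, ← Complex.norm_mul_cos_arg a, ← Complex.norm_mul_cos_arg b,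
        ← Complex.norm_mul_sin_arg a, ← Complex.norm_mul_sin_arg b]
      ring
    rw [hre]
    simp only [Complex.sq_norm, Complex.normSq_apply, Complex.sub_re, Complex.sub_im]
    ring
  have hprod : ‖a‖ * ‖b‖ ≤ 2 * (‖a‖ * ‖b‖ * Real.cos (a.arg - b.arg)) := by
    nlinarith [mul_nonneg (norm_nonneg a) (norm_nonneg b)]
  refine le_of_sq_le_sq ?_ (le_max_of_le_left (norm_nonneg a))
  rcases le_total ‖a‖ ‖b‖ with hab | hab
  · rw [max_eq_right hab]
    nlinarith [norm_nonneg a]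
  · rw [max_eq_left hab]
    nlinarith [norm_nonneg b]

/-- Among any six complex numbers there are two that are at most as far from each other as the
farther one is from the origin. -/
theorem Complex.exists_ne_norm_sub_le_norm {s : Finset ℂ} (hs : 5 < s.card) :
    ∃ a ∈ s, ∃ b ∈ s, a ≠ b ∧ ‖a - b‖ ≤ ‖b‖ := by
  suffices h : ∃ a ∈ s, ∃ b ∈ s, a ≠ b ∧ ‖a - b‖ ≤ max ‖a‖ ‖b‖ by
    obtain ⟨a, ha, b, hb, hab, h⟩ := h
    rcases le_max_iff.1 h with h | h
    · exact ⟨b, hb, a, ha, hab.symm, norm_sub_rev a b ▸ h⟩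
    · exact ⟨a, ha, b, hb, hab, h⟩
  obtain ⟨c, hc⟩ : s.Nonempty := Finset.card_pos.1 (by omega)
  rcases eq_or_ne c 0 with rfl | hc0
  · obtain ⟨b, hb, hb0⟩ := Finset.exists_mem_ne (by omega : 1 < s.card) 0
    exact ⟨0, hc, b, hb, hb0.symm, by simp⟩
  have hdiv {a b : ℂ} (h : |(a / c).arg - (b / c).arg| ≤ Real.pi / 3) :
      ‖a - b‖ ≤ max ‖a‖ ‖b‖ := by
    have := norm_sub_le_max_of_abs_arg_sub_le h
    rwa [← sub_div, norm_div, norm_div, norm_div, max_div_div_right (norm_nonneg c),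
      div_le_div_iff_of_pos_right (norm_pos_iff.2 hc0)] at this
  by_cases hnear : ∃ a ∈ s, a ≠ c ∧ |(a / c).arg| ≤ Real.pi / 3
  · obtain ⟨a, ha, hac, h⟩ := hnear
    exact ⟨a, ha, c, hc, hac, hdiv (by simpa [hc0] using h)⟩
  push Not at hnear
  let sector : ℂ → ℕ := fun z ↦
    if 2 * Real.pi / 3 < (z / c).arg then 0
    else if 0 < (z / c).arg then 1
    else if -(2 * Real.pi / 3) < (z / c).arg then 2
    else 3
  obtain ⟨a, ha, b, hb, hab, h⟩ :=
    Finset.exists_ne_map_eq_of_card_lt_of_maps_to (s := s.erase c) (t := Finset.range 4)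
      (f := sector) (by rw [Finset.card_erase_of_mem hc, Finset.card_range]; omega)
      (fun z _ ↦ by simp only [sector]; split_ifs <;> simp)
  rw [Finset.mem_erase] at ha hb
  refine ⟨a, ha.2, b, hb.2, hab, hdiv ?_⟩
  have ha' := lt_abs.1 (hnear a ha.2 ha.1)
  have hb' := lt_abs.1 (hnear b hb.2 hb.1)
  have := Complex.arg_le_pi (a / c)
  have := Complex.arg_le_pi (b / c)
  have := Complex.neg_pi_lt_arg (a / c)
  have := Complex.neg_pi_lt_arg (b / c)
  have := Real.pi_pos
  simp only [sector] at h
  rw [abs_le]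
  split_ifs at h <;> rcases ha' with ha' | ha' <;> rcases hb' with hb' | hb' <;>
    first
    | omega
    | constructor <;> linarith

section InnerProductSpace

variable {V : Type*} [NormedAddCommGroup V] [InnerProductSpace ℂ V]

/-- If `w` is orthogonal to `u` and `‖α - β‖ ≤ ‖β‖`, then the distance from `α • u` to some point
`β • u + t • (w - β • u)` of the line through `w` and `β • u` is less than `‖w‖`. -/
theorem exists_norm_sub_smul_lt {u w : V} (hw : w ≠ 0) (huw : inner ℂ u w = 0) {α β : ℂ}
    (h : ‖α - β‖ ≤ ‖β‖) :
    ∃ t : ℂ, ‖(α - β) • u - t • (w - β • u)‖ < ‖w‖ := by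
  have hW : 0 < ‖w‖ ^ 2 := by positivity
  set N : ℝ := ‖w‖ ^ 2 + ‖β‖ ^ 2 * ‖u‖ ^ 2 with hN
  have hNpos : 0 < N := by positivity
  have hN0 : (N : ℂ) ≠ 0 := by exact_mod_cast hNpos.ne'
  have hββ : β * starRingEnd ℂ β = (‖β‖ : ℂ) ^ 2 := Complex.mul_conj' β
  refine ⟨-((α - β) * starRingEnd ℂ β * (‖u‖ : ℂ) ^ 2 / N),
    lt_of_pow_lt_pow_left₀ 2 (norm_nonneg w) ?_⟩
  have hvec : (α - β) • u - (-((α - β) * starRingEnd ℂ β * (‖u‖ : ℂ) ^ 2 / N)) • (w - β • u) =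
      ((α - β) / N) • (((‖w‖ : ℂ) ^ 2) • u + (starRingEnd ℂ β * (‖u‖ : ℂ) ^ 2) • w) := by
    match_scalars
    · field_simp
      rw [hN]
      push_cast
      linear_combination -(α - β) * (‖u‖ : ℂ) ^ 2 * hββ
    · field_simp
  have horth : inner ℂ (((‖w‖ : ℂ) ^ 2) • u) ((starRingEnd ℂ β * (‖u‖ : ℂ) ^ 2) • w) = 0 := by
    rw [inner_smul_left, inner_smul_right, huw, mul_zero, mul_zero]
  have hpyth := norm_add_sq_eq_norm_sq_add_norm_sq_of_inner_eq_zero _ _ horth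
  have hnorm : ‖((‖w‖ : ℂ) ^ 2) • u + (starRingEnd ℂ β * (‖u‖ : ℂ) ^ 2) • w‖ ^ 2 =
      ‖u‖ ^ 2 * ‖w‖ ^ 2 * N := by
    rw [sq, hpyth]
    simp only [norm_smul, norm_mul, norm_pow, Complex.norm_real, norm_norm, RCLike.norm_conj, hN]
    ring
  rw [hvec, norm_smul, mul_pow, hnorm, norm_div, Complex.norm_real, Real.norm_of_nonneg hNpos.le,
    div_pow, div_mul_eq_mul_div, div_lt_iff₀ (by positivity)]
  have hlt : ‖α - β‖ ^ 2 * ‖u‖ ^ 2 < N := by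
    have : ‖α - β‖ ^ 2 * ‖u‖ ^ 2 ≤ ‖β‖ ^ 2 * ‖u‖ ^ 2 := by gcongr
    linarith
  calc ‖α - β‖ ^ 2 * (‖u‖ ^ 2 * ‖w‖ ^ 2 * N) = (‖α - β‖ ^ 2 * ‖u‖ ^ 2) * (‖w‖ ^ 2 * N) := by ring
    _ < N * (‖w‖ ^ 2 * N) := by gcongr
    _ = ‖w‖ ^ 2 * N ^ 2 := by ring

/-- Given six points on a complex line and a point `p` off it, one of the six is closer to the line
joining `p` to another of the six than `p` is to the given line. -/
theorem exists_infDist_affineSpan_pair_lt {p q r : V} (hp : p ∉ affineSpan ℂ {q, r})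
    {T : Set V} (hT : T ⊆ affineSpan ℂ {q, r}) (hcard : 5 < T.ncard) :
    ∃ a ∈ T, ∃ b ∈ T, a ≠ b ∧
      Metric.infDist a (affineSpan ℂ {p, b}) < Metric.infDist p (affineSpan ℂ {q, r}) := by
  have hTfin : T.Finite := Set.finite_of_ncard_pos (by omega)
  have : Nonempty (affineSpan ℂ {q, r}) := ⟨⟨q, left_mem_affineSpan_pair ℂ q r⟩⟩
  set f : V := ↑(EuclideanGeometry.orthogonalProjection (affineSpan ℂ {q, r}) p)
  have hfmem : f ∈ affineSpan ℂ {q, r} := EuclideanGeometry.orthogonalProjection_mem p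
  have hdist : ‖p - f‖ = Metric.infDist p (affineSpan ℂ {q, r}) := by
    rw [← EuclideanGeometry.dist_orthogonalProjection_eq_infDist, ← dist_eq_norm]
  have hw : p - f ≠ 0 := fun h ↦ hp (sub_eq_zero.1 h ▸ hfmem)
  have hdir : (affineSpan ℂ {q, r}).direction = ℂ ∙ (r - q) := by
    rw [direction_affineSpan, vectorSpan_pair_rev, vsub_eq_sub]
  have huw : inner ℂ (r - q) (p - f) = 0 := by
    have := EuclideanGeometry.vsub_orthogonalProjection_mem_direction_orthogonal
      (affineSpan ℂ {q, r}) p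
    exact (Submodule.mem_orthogonal _ _).1 this _
      (hdir ▸ Submodule.mem_span_singleton_self (r - q))
  have hcoord : ∀ x ∈ T, ∃ z : ℂ, x = f + z • (r - q) := fun x hx ↦ by
    have hmem := AffineSubspace.vsub_mem_direction (hT hx) hfmem
    rw [hdir, Submodule.mem_span_singleton] at hmem
    obtain ⟨z, hz⟩ := hmem
    exact ⟨z, by rw [hz, vsub_eq_sub, add_sub_cancel]⟩
  choose! coord hcoord using hcoord
  have hinj : Set.InjOn coord T := fun x hx y hy h ↦ by rw [hcoord x hx, hcoord y hy, h]
  have hcard' : 5 < (hTfin.image coord).toFinset.card := by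
    rwa [← Set.ncard_eq_toFinset_card _ (hTfin.image coord), hinj.ncard_image]
  obtain ⟨α, hα, β, hβ, hne, hle⟩ := Complex.exists_ne_norm_sub_le_norm hcard'
  rw [Set.Finite.mem_toFinset] at hα hβ
  obtain ⟨a, ha, rfl⟩ := hα
  obtain ⟨b, hb, rfl⟩ := hβ
  refine ⟨a, ha, b, hb, fun h ↦ hne (h ▸ rfl), ?_⟩
  obtain ⟨t, ht⟩ := exists_norm_sub_smul_lt hw huw hle
  rw [← hdist]
  have hvec : a - AffineMap.lineMap b p t =
      (coord a - coord b) • (r - q) - t • (p - f - coord b • (r - q)) := by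
    rw [AffineMap.lineMap_apply_module']
    nth_rewrite 1 [hcoord a ha]
    nth_rewrite 1 2 [hcoord b hb]
    module
  refine (Metric.infDist_le_dist_of_mem
    (AffineMap.lineMap_rev_mem_affineSpan_pair t p b)).trans_lt ?_
  rwa [dist_eq_norm, hvec]

end InnerProductSpace

theorem sylvester_gallai_complex_plane
    (S : Set (EuclideanSpace ℂ (Fin 2))) (hfin : S.Finite)
    (hS : ¬ Collinear ℂ S) :
    ∃ p ∈ S, ∃ q ∈ S, p ≠ q ∧
      2 ≤ (S ∩ (affineSpan ℂ {p, q} : Set (EuclideanSpace ℂ (Fin 2)))).ncard ∧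
      (S ∩ (affineSpan ℂ {p, q} : Set (EuclideanSpace ℂ (Fin 2)))).ncard ≤ 5 := by
  let triples : Set (EuclideanSpace ℂ (Fin 2) × EuclideanSpace ℂ (Fin 2) ×
      EuclideanSpace ℂ (Fin 2)) :=
    {x ∈ S ×ˢ S ×ˢ S | x.2.1 ≠ x.2.2 ∧ x.1 ∉ affineSpan ℂ {x.2.1, x.2.2}}
  have hne : triples.Nonempty := by
    obtain ⟨q, hq, r, hr, hqr⟩ : S.Nontrivial := by
      by_contra h
      obtain rfl | ⟨x, rfl⟩ := (Set.not_nontrivial_iff.1 h).eq_empty_or_singleton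
      · exact hS (collinear_empty ℂ _)
      · exact hS (collinear_singleton ℂ x)
    by_contra hempty
    refine hS ((collinear_iff_of_mem hq).2 ⟨r -ᵥ q, fun p hp ↦ ?_⟩)
    have hpqr : p ∈ affineSpan ℂ {q, r} := by
      by_contra hpqr
      exact hempty ⟨(p, q, r), ⟨hp, hq, hr⟩, hqr, hpqr⟩
    have hmem := AffineSubspace.vsub_mem_direction hpqr (left_mem_affineSpan_pair ℂ q r)
    rw [direction_affineSpan, mem_vectorSpan_pair_rev] at hmem
    obtain ⟨t, ht⟩ := hmem
    exact ⟨t, by rw [ht, vsub_vadd]⟩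
  obtain ⟨⟨p, q, r⟩, ⟨⟨hp, hq, hr⟩, hqr, hpqr⟩, hmin⟩ :=
    Set.exists_min_image triples (fun x ↦ Metric.infDist x.1 (affineSpan ℂ {x.2.1, x.2.2}))
      ((hfin.prod (hfin.prod hfin)).subset (Set.sep_subset _ _)) hne
  dsimp only at hp hq hr hqr hpqr
  refine ⟨q, hq, r, hr, hqr, ?_, ?_⟩
  · refine (Set.ncard_pair hqr).symm.le.trans
      (Set.ncard_le_ncard (Set.pair_subset ?_ ?_) (hfin.inter_of_left _))
    · exact ⟨hq, left_mem_affineSpan_pair ℂ q r⟩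
    · exact ⟨hr, right_mem_affineSpan_pair ℂ q r⟩
  · by_contra! hcard
    obtain ⟨a, ha, b, hb, hab, hlt⟩ :=
      exists_infDist_affineSpan_pair_lt hpqr Set.inter_subset_right hcard
    refine hlt.not_ge (hmin (a, p, b) ⟨⟨ha.1, hp, hb.1⟩, ?_, ?_⟩)
    · exact fun hpb : p = b ↦ hpqr (hpb ▸ hb.2)
    · intro hapb
      have hcol := collinear_insert_of_mem_affineSpan_pair hapb
      exact hpqr (affineSpan_pair_le_of_mem_of_mem ha.2 hb.2
        (hcol.mem_affineSpan_of_mem_of_ne (by simp) (by simp) (by simp) hab))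
end

section
/- Let S be a finite set of points in the quaternionic affine plane ℍ² that is not collinear over ℍ. Then there exist two distinct points p, q ∈ S such that the line through p and q (the affine span over ℍ of {p, q}) contains at least 2 and at most 24 points of S. -/
open scoped Quaternion

/-- The space `ℍ³` with its Euclidean norm, as a left `ℍ`-module. -/
abbrev QVec : Type := PiLp 2 (fun _ : Fin 3 => Quaternion ℝ)
/-- Quaternionic `3 × 3` matrices with the real Frobenius inner product. -/
abbrev QMat : Type := PiLp 2 (fun _ : Fin 3 × Fin 3 => Quaternion ℝ)

theorem finrank_qVec : Module.finrank ℍ[ℝ] QVec = 3 := by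
  rw [(WithLp.linearEquiv 2 ℍ[ℝ] (Fin 3 → ℍ[ℝ])).finrank_eq]
  simp

theorem QVec.norm_sq (v : QVec) : ‖v‖ ^ 2 = ‖v 0‖ ^ 2 + ‖v 1‖ ^ 2 + ‖v 2‖ ^ 2 := by
  rw [PiLp.norm_sq_eq_of_L2]
  simp [Fin.sum_univ_three]

/-- The rank-one matrix `x yᵀ`. -/
noncomputable def outer (x y : Fin 3 → ℍ[ℝ]) : QMat := WithLp.toLp 2 fun k => x k.1 * y k.2

/-- The identity matrix. -/
noncomputable def idMat : QMat := WithLp.toLp 2 fun k => if k.1 = k.2 then 1 else 0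

theorem norm_idMat_sq : ‖idMat‖ ^ 2 = 3 := by
  rw [PiLp.norm_sq_eq_of_L2]
  simp [idMat, Fintype.sum_prod_type, Fin.sum_univ_three]
  norm_num

theorem norm_outer_sq (x y : QVec) : ‖outer (fun a => star (x a)) y‖ ^ 2 = (‖x‖ * ‖y‖) ^ 2 := by
  rw [mul_pow, QVec.norm_sq, QVec.norm_sq, PiLp.norm_sq_eq_of_L2]
  simp [outer, Fintype.sum_prod_type, Fin.sum_univ_three]
  ring

theorem inner_outer_idMat (x : QVec) :
    inner ℝ (outer (fun a => star (x a)) x) idMat = ‖x‖ ^ 2 := by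
  rw [QVec.norm_sq, PiLp.inner_apply]
  simp [outer, idMat, Fintype.sum_prod_type, Fin.sum_univ_three, Quaternion.inner_def,
    ← Quaternion.normSq_eq_norm_mul_self, Quaternion.normSq_def', pow_two]

theorem Quaternion.re_finsetSum {ι : Type*} (s : Finset ι) (f : ι → ℍ[ℝ]) :
    (∑ i ∈ s, f i).re = ∑ i ∈ s, (f i).re :=
  map_sum (QuaternionAlgebra.reₗ (-1 : ℝ) 0 (-1)) f s

theorem inner_outer_outer (x w : QVec) :
    inner ℝ (outer (fun a => star (x a)) x) (outer w (fun a => star (w a)))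
      = ‖∑ a, x a * w a‖ ^ 2 := by
  rw [PiLp.inner_apply, ← real_inner_self_eq_norm_sq, Quaternion.inner_def]
  have hre : ∀ p q : ℍ[ℝ], (p * q).re = (q * p).re := fun p q => by simp; ring
  simp only [outer, Fintype.sum_prod_type, Quaternion.inner_def, star_sum, Finset.mul_sum,
    Finset.sum_mul, star_mul, star_star, Quaternion.re_finsetSum]
  refine Finset.sum_congr rfl fun a _ => Finset.sum_congr rfl fun b _ => ?_
  rw [mul_assoc, hre]
  simp only [mul_assoc]

/-- The projection onto the plane annihilated by `w`. -/
theorem exists_projection (w : QVec) (hw : w ≠ 0) :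
    ∃ Q : QMat, ‖Q‖ ^ 2 ≤ 2 ∧ ∀ x : QVec, ∑ a, x a * w a = 0 →
      inner ℝ (outer (fun a => star (x a)) x) Q = ‖x‖ ^ 2 := by
  have hw' : ‖w‖ ^ 2 ≠ 0 := by simpa using hw
  refine ⟨idMat - (‖w‖ ^ 2)⁻¹ • outer w (fun a => star (w a)), ?_, fun x hx => ?_⟩
  · have hW : ‖outer w (fun a => star (w a))‖ ^ 2 = (‖w‖ * ‖w‖) ^ 2 := by
      have := norm_outer_sq (WithLp.toLp 2 fun a => star (w a)) (WithLp.toLp 2 fun a => star (w a))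
      have hs : ‖(WithLp.toLp 2 fun a => star (w a) : QVec)‖ ^ 2 = ‖w‖ ^ 2 := by
        simp [QVec.norm_sq]
      simpa [mul_pow, hs] using this
    have hI : inner ℝ idMat (outer w (fun a => star (w a))) = ‖w‖ ^ 2 := by
      have := inner_outer_idMat (WithLp.toLp 2 fun a => star (w a))
      rw [real_inner_comm]
      simpa [QVec.norm_sq] using this
    rw [norm_sub_sq_real, norm_idMat_sq, inner_smul_right, hI, norm_smul, mul_pow, hW, mul_pow]
    simp only [norm_inv, norm_pow, norm_norm]
    field_simp
    norm_num
  · rw [inner_sub_right, inner_smul_right, inner_outer_outer, inner_outer_idMat, hx]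
    simp

/-- The image of the homogeneous vector `(1, p.1, p.2)` under the left-linear map sending the
standard basis to `g`. -/
noncomputable def framePoint (g : QVec × QVec × QVec) (p : ℍ[ℝ] × ℍ[ℝ]) : QVec :=
  g.1 + p.1 • g.2.1 + p.2 • g.2.2

/-- Triangular frames with diagonal entries of norm product one. -/
def triangularFrames : Set (QVec × QVec × QVec) :=
  {g | g.2.1 0 = 0 ∧ g.2.2 0 = 0 ∧ g.2.2 1 = 0 ∧ ‖g.1 0‖ * ‖g.2.1 1‖ * ‖g.2.2 2‖ = 1}

theorem framePoint_zero {g : QVec × QVec × QVec} (hg : g ∈ triangularFrames)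
    (p : ℍ[ℝ] × ℍ[ℝ]) : framePoint g p 0 = g.1 0 := by
  simp [framePoint, hg.1, hg.2.1]

theorem framePoint_ne_zero {g : QVec × QVec × QVec} (hg : g ∈ triangularFrames)
    (p : ℍ[ℝ] × ℍ[ℝ]) : framePoint g p ≠ 0 := by
  intro h
  have h0 := framePoint_zero hg p
  have h1 := hg.2.2.2
  rw [← h0, h] at h1
  simp at h1

theorem framePoint_sub (g : QVec × QVec × QVec) (p q : ℍ[ℝ] × ℍ[ℝ]) :
    framePoint g q - framePoint g p = (q - p).1 • g.2.1 + (q - p).2 • g.2.2 := by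
  simp only [framePoint, Prod.fst_sub, Prod.snd_sub, sub_smul]
  abel

theorem framePoint_mem_span (g : QVec × QVec × QVec) {p q z : ℍ[ℝ] × ℍ[ℝ]}
    (hz : z ∈ line[ℍ[ℝ], p, q]) :
    framePoint g z ∈ Submodule.span ℍ[ℝ] {framePoint g p, framePoint g q} := by
  obtain ⟨t, rfl⟩ := mem_affineSpan_pair_iff_exists_lineMap_eq.1 hz
  have : framePoint g (AffineMap.lineMap p q t)
      = framePoint g p + t • (framePoint g q - framePoint g p) := by
    rw [framePoint_sub]
    simp only [framePoint, AffineMap.lineMap_apply, vsub_eq_sub, vadd_eq_add, Prod.fst_add,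
      Prod.snd_add, Prod.smul_fst, Prod.smul_snd, smul_eq_mul, add_smul, mul_smul, smul_add]
    abel
  rw [this]
  have hp := Submodule.subset_span (R := ℍ[ℝ]) (s := {framePoint g p, framePoint g q})
    (Set.mem_insert _ _)
  have hq := Submodule.subset_span (R := ℍ[ℝ]) (s := {framePoint g p, framePoint g q})
    (Set.mem_insert_of_mem _ rfl)
  exact Submodule.add_mem _ hp (Submodule.smul_mem _ _ (Submodule.sub_mem _ hq hp))

/-- The images of the points of a line lie in a common plane. -/
theorem exists_annihilator (g : QVec × QVec × QVec) (p q : ℍ[ℝ] × ℍ[ℝ]) :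
    ∃ w : QVec, w ≠ 0 ∧ ∀ z ∈ line[ℍ[ℝ], p, q], ∑ a, framePoint g z a * w a = 0 := by
  classical
  have hlt : Submodule.span ℍ[ℝ] {framePoint g p, framePoint g q} < ⊤ := by
    refine lt_top_iff_ne_top.2 fun h => ?_
    have h2 := finrank_span_finset_le_card (R := ℍ[ℝ]) {framePoint g p, framePoint g q}
    rw [Set.finrank, Finset.coe_insert, Finset.coe_singleton] at h2
    rw [h, finrank_top, finrank_qVec] at h2
    have := Finset.card_le_two (a := framePoint g p) (b := framePoint g q)
    omega
  obtain ⟨φ, hφ, hker⟩ := Submodule.exists_le_ker_of_lt_top _ hlt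
  have hsum : ∀ v : QVec, φ v = ∑ a, v a * φ (WithLp.toLp 2 (Pi.single a 1)) := by
    intro v
    have hv : v = ∑ a, v a • (WithLp.toLp 2 (Pi.single a 1) : QVec) := by
      ext a : 1
      simp [Pi.single_apply]
    conv_lhs => rw [hv]
    simp
  refine ⟨WithLp.toLp 2 fun a => φ (WithLp.toLp 2 (Pi.single a 1)), fun h => hφ ?_, fun z hz => ?_⟩
  · refine LinearMap.ext fun v => ?_
    rw [hsum, LinearMap.zero_apply]
    refine Finset.sum_eq_zero fun a _ => ?_
    rw [show φ (WithLp.toLp 2 (Pi.single a 1)) = 0 from congrFun (congrArg WithLp.ofLp h) a,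
      mul_zero]
  · have := hker (framePoint_mem_span g hz)
    rw [LinearMap.mem_ker, hsum] at this
    exact this

theorem exists_smul_combination {p q r : ℍ[ℝ] × ℍ[ℝ]}
    (h : ¬ Collinear ℍ[ℝ] {p, q, r}) (v : ℍ[ℝ] × ℍ[ℝ]) :
    ∃ s t : ℍ[ℝ], s • (q - p) + t • (r - p) = v := by
  rw [← affineIndependent_iff_not_collinear_set,
    affineIndependent_iff_linearIndependent_vsub _ _ (0 : Fin 3)] at h
  have hli : LinearIndependent ℍ[ℝ] ![q - p, r - p] := by
    rw [← linearIndependent_equiv (finSuccAboveEquiv (0 : Fin 3))] at h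
    have heq : (fun i : {i : Fin 3 // i ≠ 0} => ![p, q, r] i -ᵥ ![p, q, r] 0) ∘
        finSuccAboveEquiv (0 : Fin 3) = ![q - p, r - p] := by
      ext i : 1
      fin_cases i <;> rfl
    rwa [heq] at h
  have htop := hli.span_eq_top_of_card_eq_finrank (by simp)
  have hv : v ∈ Submodule.span ℍ[ℝ] (Set.range ![q - p, r - p]) := htop ▸ Submodule.mem_top
  rw [Matrix.range_cons, Matrix.range_cons, Matrix.range_empty, Set.union_empty,
    Set.singleton_union, Submodule.mem_span_pair] at hv
  exact hv

theorem exists_norm_linear_le {p q r : ℍ[ℝ] × ℍ[ℝ]} (h : ¬ Collinear ℍ[ℝ] {p, q, r})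
    (v : ℍ[ℝ] × ℍ[ℝ]) :
    ∃ C : ℝ, 0 ≤ C ∧ ∀ g, ‖framePoint g p‖ ≤ ‖framePoint g r‖ →
      ‖framePoint g q‖ ≤ ‖framePoint g r‖ →
      ‖v.1 • g.2.1 + v.2 • g.2.2‖ ≤ C * ‖framePoint g r‖ := by
  obtain ⟨s, t, rfl⟩ := exists_smul_combination h v
  refine ⟨‖s‖ * 2 + ‖t‖ * 2, by positivity, fun g hp hq => ?_⟩
  have : (s • (q - p) + t • (r - p)).1 • g.2.1 + (s • (q - p) + t • (r - p)).2 • g.2.2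
      = s • (framePoint g q - framePoint g p) + t • (framePoint g r - framePoint g p) := by
    rw [framePoint_sub, framePoint_sub]
    simp only [Prod.fst_add, Prod.snd_add, Prod.smul_fst, Prod.smul_snd, smul_eq_mul, add_smul,
      mul_smul, smul_add]
    abel
  rw [this, add_mul, mul_assoc, mul_assoc]
  refine (norm_add_le _ _).trans (add_le_add ?_ ?_) <;> rw [norm_smul] <;>
    refine mul_le_mul_of_nonneg_left ((norm_sub_le _ _).trans ?_) (norm_nonneg _) <;> linarith

/-- A Hadamard-type inequality for the images of three noncollinear points. -/
theorem exists_frame_bound {p q r : ℍ[ℝ] × ℍ[ℝ]} (h : ¬ Collinear ℍ[ℝ] {p, q, r}) :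
    ∃ K : ℝ, ∀ g ∈ triangularFrames, ‖framePoint g p‖ ≤ ‖framePoint g q‖ →
      ‖framePoint g q‖ ≤ ‖framePoint g r‖ →
      1 ≤ K * (‖framePoint g p‖ * ‖framePoint g q‖ * ‖framePoint g r‖) ∧
      ‖g‖ ≤ K * ‖framePoint g r‖ := by
  have hpq : p ≠ q := by
    rintro rfl
    exact h (by simpa using collinear_pair ℍ[ℝ] p r)
  obtain ⟨C₁, hC₁, h₁⟩ := exists_norm_linear_le h (1, 0)
  obtain ⟨C₂, hC₂, h₂⟩ := exists_norm_linear_le h (0, 1)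
  simp only [one_smul, zero_smul, add_zero, zero_add] at h₁ h₂
  set d : ℝ := ‖(q - p).1‖⁻¹ * 2 * C₂ + ‖(q - p).2‖⁻¹ * 2 * C₁ with hd
  have hd0 : 0 ≤ d := by positivity
  set e : ℝ := 1 + ‖p.1‖ * C₁ + ‖p.2‖ * C₂ with he
  have he0 : 0 ≤ e := by positivity
  refine ⟨d + (C₁ + C₂ + e), fun g hg hgp hgq => ⟨?_, ?_⟩⟩
  · have hA : ‖g.1 0‖ ≤ ‖framePoint g p‖ := by
      rw [← framePoint_zero hg p]
      exact PiLp.norm_apply_le _ _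
    have hB : ‖g.2.1 1‖ ≤ C₁ * ‖framePoint g r‖ :=
      (PiLp.norm_apply_le _ _).trans (h₁ g (hgp.trans hgq) hgq)
    have hC : ‖g.2.2 2‖ ≤ C₂ * ‖framePoint g r‖ :=
      (PiLp.norm_apply_le _ _).trans (h₂ g (hgp.trans hgq) hgq)
    have hdiff : ‖framePoint g q - framePoint g p‖ ≤ 2 * ‖framePoint g q‖ :=
      (norm_sub_le _ _).trans (by linarith)
    have hBC : ‖g.2.1 1‖ * ‖g.2.2 2‖ ≤ d * (‖framePoint g q‖ * ‖framePoint g r‖) := by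
      by_cases hx : (q - p).1 = 0
      · have hy : (q - p).2 ≠ 0 := fun hy => hpq (sub_eq_zero.1 (Prod.ext hx hy)).symm
        have h' : ‖(q - p).2‖ * ‖g.2.2 2‖ ≤ 2 * ‖framePoint g q‖ := by
          rw [framePoint_sub, hx, zero_smul, zero_add] at hdiff
          refine le_trans ?_ hdiff
          rw [norm_smul]
          exact mul_le_mul_of_nonneg_left (PiLp.norm_apply_le _ _) (norm_nonneg _)
        have h'' : ‖g.2.2 2‖ ≤ ‖(q - p).2‖⁻¹ * (2 * ‖framePoint g q‖) := by
          rwa [← div_eq_inv_mul, le_div_iff₀' (norm_pos_iff.2 hy)]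
        calc _ ≤ (C₁ * ‖framePoint g r‖) * (‖(q - p).2‖⁻¹ * (2 * ‖framePoint g q‖)) := by gcongr
          _ = (‖(q - p).2‖⁻¹ * 2 * C₁) * (‖framePoint g q‖ * ‖framePoint g r‖) := by ring
          _ ≤ _ := by
            gcongr
            rw [hd]
            exact le_add_of_nonneg_left (by positivity)
      · have h' : ‖(q - p).1‖ * ‖g.2.1 1‖ ≤ 2 * ‖framePoint g q‖ := by
          refine le_trans ?_ hdiff
          have := PiLp.norm_apply_le (framePoint g q - framePoint g p) 1
          rw [framePoint_sub] at this ⊢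
          simpa [hg.2.2.1] using this
        have h'' : ‖g.2.1 1‖ ≤ ‖(q - p).1‖⁻¹ * (2 * ‖framePoint g q‖) := by
          rwa [← div_eq_inv_mul, le_div_iff₀' (norm_pos_iff.2 hx)]
        calc _ ≤ (‖(q - p).1‖⁻¹ * (2 * ‖framePoint g q‖)) * (C₂ * ‖framePoint g r‖) := by gcongr
          _ = (‖(q - p).1‖⁻¹ * 2 * C₂) * (‖framePoint g q‖ * ‖framePoint g r‖) := by ring
          _ ≤ _ := by
            gcongr
            rw [hd]
            exact le_add_of_nonneg_right (by positivity)
    calc (1 : ℝ) = ‖g.1 0‖ * (‖g.2.1 1‖ * ‖g.2.2 2‖) := by rw [← mul_assoc, hg.2.2.2]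
      _ ≤ ‖framePoint g p‖ * (d * (‖framePoint g q‖ * ‖framePoint g r‖)) := by gcongr
      _ = d * (‖framePoint g p‖ * ‖framePoint g q‖ * ‖framePoint g r‖) := by ring
      _ ≤ _ := by
        gcongr
        exact le_add_of_nonneg_right (by positivity)
  · have b₁ := h₁ g (hgp.trans hgq) hgq
    have b₂ := h₂ g (hgp.trans hgq) hgq
    have b₀ : ‖g.1‖ ≤ e * ‖framePoint g r‖ := by
      have : g.1 = framePoint g p - p.1 • g.2.1 - p.2 • g.2.2 := by
        simp only [framePoint]
        abel
      rw [this]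
      refine (norm_sub_le _ _).trans ((add_le_add_left (norm_sub_le _ _) _).trans ?_)
      rw [norm_smul, norm_smul, he, add_mul, add_mul, one_mul, mul_assoc, mul_assoc]
      gcongr
      exact hgp.trans hgq
    have hr := norm_nonneg (framePoint g r)
    have n₁ := mul_nonneg hC₁ hr
    have n₂ := mul_nonneg hC₂ hr
    have n₃ := mul_nonneg hd0 hr
    have n₄ := mul_nonneg he0 hr
    have : (d + (C₁ + C₂ + e)) * ‖framePoint g r‖ = d * ‖framePoint g r‖
      + (C₁ * ‖framePoint g r‖ + C₂ * ‖framePoint g r‖ + e * ‖framePoint g r‖) := by ring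
    rw [this, Prod.norm_def, Prod.norm_def]
    exact max_le (by linarith) (max_le (by linarith) (by linarith))

open scoped Classical in
/-- The points of `S` on the line through `p` and `q`. -/
noncomputable def pointsOnLine (S : Finset (ℍ[ℝ] × ℍ[ℝ])) (x : (ℍ[ℝ] × ℍ[ℝ]) × (ℍ[ℝ] × ℍ[ℝ])) :
    Finset (ℍ[ℝ] × ℍ[ℝ]) :=
  S.filter (· ∈ line[ℍ[ℝ], x.1, x.2])

/-- The sum of the log-norms is coercive on triangular frames if no line is too rich. -/
theorem exists_norm_bound (S : Finset (ℍ[ℝ] × ℍ[ℝ])) (hcard : 2 ≤ S.card)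
    (hS : ∀ p ∈ S, ∀ q ∈ S, p ≠ q → 3 * (pointsOnLine S (p, q)).card < 2 * S.card) (F : ℝ) :
    ∃ R : ℝ, ∀ g ∈ triangularFrames, ∑ p ∈ S, Real.log ‖framePoint g p‖ ≤ F → ‖g‖ ≤ R := by
  classical
  have hK : ∀ x : (ℍ[ℝ] × ℍ[ℝ]) × (ℍ[ℝ] × ℍ[ℝ]) × (ℍ[ℝ] × ℍ[ℝ]), ∃ K : ℝ,
      ¬ Collinear ℍ[ℝ] {x.1, x.2.1, x.2.2} → ∀ g ∈ triangularFrames,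
      ‖framePoint g x.1‖ ≤ ‖framePoint g x.2.1‖ →
      ‖framePoint g x.2.1‖ ≤ ‖framePoint g x.2.2‖ →
      1 ≤ K * (‖framePoint g x.1‖ * ‖framePoint g x.2.1‖ * ‖framePoint g x.2.2‖) ∧
      ‖g‖ ≤ K * ‖framePoint g x.2.2‖ := by
    intro x
    by_cases h : Collinear ℍ[ℝ] {x.1, x.2.1, x.2.2}
    · exact ⟨0, fun h' => absurd h h'⟩
    · obtain ⟨K, hK⟩ := exists_frame_bound h
      exact ⟨K, fun _ => hK⟩
  choose K hK using hK
  obtain ⟨M, hM⟩ := ((S ×ˢ S ×ˢ S).image K).exists_le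
  set C := max M 1 with hC
  have hC1 : 1 ≤ C := le_max_right _ _
  have hKC : ∀ p ∈ S, ∀ q ∈ S, ∀ r ∈ S, K (p, q, r) ≤ C := fun p hp q hq r hr =>
    (hM _ (Finset.mem_image_of_mem _ (by simp [hp, hq, hr]))).trans (le_max_left _ _)
  set k := Real.log C
  have hk : 0 ≤ k := Real.log_nonneg hC1
  refine ⟨C * Real.exp (2 * (F + S.card * k / 3)), fun g hg hF => ?_⟩
  have hpos : ∀ p, 0 < ‖framePoint g p‖ := fun p => norm_pos_iff.2 (framePoint_ne_zero hg p)
  obtain ⟨p, hp, hpmin⟩ := S.exists_min_image (fun p => ‖framePoint g p‖)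
    (Finset.card_pos.1 (by omega))
  obtain ⟨q, hq, hqmin⟩ := (S.erase p).exists_min_image (fun p => ‖framePoint g p‖)
    (Finset.card_pos.1 (by rw [Finset.card_erase_of_mem hp]; omega))
  have hqS := Finset.mem_of_mem_erase hq
  have hqp := Finset.ne_of_mem_erase hq
  have hm := hS p hp q hqS hqp.symm
  set L := pointsOnLine S (p, q) with hL
  have hLS : L ⊆ S := Finset.filter_subset _ _
  have hpL : p ∈ L := Finset.mem_filter.2 ⟨hp, left_mem_affineSpan_pair _ _ _⟩
  have hqL : q ∈ L := Finset.mem_filter.2 ⟨hqS, right_mem_affineSpan_pair _ _ _⟩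
  have hdiff : (S \ L).card = S.card - L.card := Finset.card_sdiff_of_subset hLS
  obtain ⟨r, hr, hrmin⟩ := (S \ L).exists_min_image (fun p => ‖framePoint g p‖)
    (Finset.card_pos.1 (by omega))
  obtain ⟨hrS, hrL⟩ := Finset.mem_sdiff.1 hr
  have hncol : ¬ Collinear ℍ[ℝ] {p, q, r} := fun hcol => hrL <| Finset.mem_filter.2 ⟨hrS,
    hcol.mem_affineSpan_of_mem_of_ne (by simp) (by simp) (by simp) hqp.symm⟩
  have hpq := hpmin q hqS
  have hqr := hqmin r (Finset.mem_erase.2 ⟨fun h => hrL (h ▸ hpL), hrS⟩)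
  obtain ⟨h1, h2⟩ := hK (p, q, r) hncol g hg hpq hqr
  have hKle := hKC p hp q hqS r hrS
  have h1' : 1 ≤ C * (‖framePoint g p‖ * ‖framePoint g q‖ * ‖framePoint g r‖) :=
    h1.trans (mul_le_mul_of_nonneg_right hKle (by positivity))
  have h2' : ‖g‖ ≤ C * ‖framePoint g r‖ :=
    h2.trans (mul_le_mul_of_nonneg_right hKle (by positivity))
  refine h2'.trans (mul_le_mul_of_nonneg_left ?_ (by positivity))
  rw [← Real.log_le_iff_le_exp (hpos r)]
  have hlog : 0 ≤ k + (Real.log ‖framePoint g p‖ + Real.log ‖framePoint g q‖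
      + Real.log ‖framePoint g r‖) := by
    have := Real.log_le_log one_pos h1'
    rwa [Real.log_one, Real.log_mul (by positivity)
      (mul_pos (mul_pos (hpos p) (hpos q)) (hpos r)).ne',
      Real.log_mul (mul_pos (hpos p) (hpos q)).ne' (hpos r).ne',
      Real.log_mul (hpos p).ne' (hpos q).ne'] at this
  have hlpq := Real.log_le_log (hpos p) hpq
  have hlqr := Real.log_le_log (hpos q) hqr
  have hsumL : Real.log ‖framePoint g p‖ + (L.card - 1) * Real.log ‖framePoint g q‖
      ≤ ∑ z ∈ L, Real.log ‖framePoint g z‖ := by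
    rw [← Finset.add_sum_erase L _ hpL]
    have hle := Finset.card_nsmul_le_sum (L.erase p) (fun z => Real.log ‖framePoint g z‖)
      (Real.log ‖framePoint g q‖) fun z hz => Real.log_le_log (hpos q)
        (hqmin z (Finset.erase_subset_erase _ hLS hz))
    rw [Finset.card_erase_of_mem hpL, nsmul_eq_mul,
      Nat.cast_sub (Finset.card_pos.2 ⟨p, hpL⟩), Nat.cast_one] at hle
    linarith
  have hsumS : ((S.card : ℝ) - L.card) * Real.log ‖framePoint g r‖
      ≤ ∑ z ∈ S \ L, Real.log ‖framePoint g z‖ := by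
    have hle := Finset.card_nsmul_le_sum (S \ L) (fun z => Real.log ‖framePoint g z‖)
      (Real.log ‖framePoint g r‖) fun z hz => Real.log_le_log (hpos r) (hrmin z hz)
    rwa [hdiff, nsmul_eq_mul, Nat.cast_sub (Finset.card_le_card hLS)] at hle
  have htot := Finset.sum_sdiff hLS (f := fun z => Real.log ‖framePoint g z‖)
  have hL2 : (2 : ℝ) ≤ L.card := by
    have : ({p, q} : Finset _).card ≤ L.card :=
      Finset.card_le_card (by simp [Finset.insert_subset_iff, hpL, hqL])
    rw [Finset.card_pair hqp.symm] at this
    exact_mod_cast this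
  have hmR : 3 * (L.card : ℝ) + 1 ≤ 2 * S.card := by exact_mod_cast hm
  generalize Real.log ‖framePoint g p‖ = a at *
  generalize Real.log ‖framePoint g q‖ = b at *
  generalize Real.log ‖framePoint g r‖ = c at *
  have e1 : 0 ≤ ((L.card : ℝ) / 2 - 1) * (b - a) :=
    mul_nonneg (by linarith) (by linarith)
  have e2 : 0 ≤ (L.card : ℝ) / 2 * (k + (a + b + c)) := by positivity
  have e3 : 0 ≤ ((S.card : ℝ) - 3 * L.card / 2 - 1 / 2) * (c + k / 3) :=
    mul_nonneg (by linarith) (by linarith)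
  nlinarith

theorem sum_div_eq_zero_of_log_min {α : Type*} (s : Finset α) (f : α → ℝ → ℝ) (f' : α → ℝ)
    (hf : ∀ i ∈ s, HasDerivAt (f i) (f' i) 0) (h0 : ∀ i ∈ s, f i 0 ≠ 0)
    (hmin : ∀ t, ∑ i ∈ s, Real.log (f i 0) ≤ ∑ i ∈ s, Real.log (f i t)) :
    ∑ i ∈ s, f' i / f i 0 = 0 := by
  have hd : HasDerivAt (fun t => ∑ i ∈ s, Real.log (f i t)) (∑ i ∈ s, f' i / f i 0) 0 :=
    HasDerivAt.fun_sum fun i hi => (hf i hi).log (h0 i hi)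
  exact IsLocalMin.hasDerivAt_eq_zero (Filter.Eventually.of_forall hmin) hd

/-- Add `v j * q` to the `k`-th coordinate. -/
noncomputable def shear (j k : Fin 3) (q : ℍ[ℝ]) : QVec →ₗ[ℍ[ℝ]] QVec where
  toFun v := v + WithLp.toLp 2 (Pi.single k (v j * q))
  map_add' v w := by
    ext a : 1
    simp only [PiLp.add_apply, Pi.single_apply, add_mul]
    split_ifs
    · abel
    · abel
  map_smul' c v := by
    ext a : 1
    simp only [PiLp.add_apply, PiLp.smul_apply, Pi.single_apply, smul_eq_mul, mul_add, mul_assoc,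
      RingHom.id_apply, mul_ite, mul_zero]

/-- Multiply the `i`-th coordinate by the real number `d i`. -/
noncomputable def diagScale (d : Fin 3 → ℝ) : QVec →ₗ[ℍ[ℝ]] QVec where
  toFun v := WithLp.toLp 2 fun i => d i • v i
  map_add' v w := by
    ext a : 1
    simp
  map_smul' c v := by
    ext a : 1
    simp

theorem framePoint_map (A : QVec →ₗ[ℍ[ℝ]] QVec) (g : QVec × QVec × QVec) (p : ℍ[ℝ] × ℍ[ℝ]) :
    framePoint (A g.1, A g.2.1, A g.2.2) p = A (framePoint g p) := by
  simp [framePoint]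

theorem shear_mem_triangularFrames {g : QVec × QVec × QVec} (hg : g ∈ triangularFrames)
    {j k : Fin 3} (hjk : j < k) (q : ℍ[ℝ]) :
    (shear j k q g.1, shear j k q g.2.1, shear j k q g.2.2) ∈ triangularFrames := by
  obtain ⟨h1, h2, h3, h4⟩ := hg
  fin_cases j <;> fin_cases k <;> simp [triangularFrames, shear, h1, h2, h3, h4] at hjk ⊢

theorem diagScale_mem_triangularFrames {g : QVec × QVec × QVec} (hg : g ∈ triangularFrames)
    {d : Fin 3 → ℝ} (hd : d 0 * d 1 * d 2 = 1) :
    (diagScale d g.1, diagScale d g.2.1, diagScale d g.2.2) ∈ triangularFrames := by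
  obtain ⟨h1, h2, h3, h4⟩ := hg
  refine ⟨by simp [diagScale, h1], by simp [diagScale, h2], by simp [diagScale, h3], ?_⟩
  have : |d 0| * |d 1| * |d 2| = 1 := by rw [← abs_mul, ← abs_mul, hd, abs_one]
  simp only [diagScale, LinearMap.coe_mk, AddHom.coe_mk, norm_smul, Real.norm_eq_abs]
  linear_combination (‖g.1 0‖ * ‖g.2.1 1‖ * ‖g.2.2 2‖) * this + h4

theorem norm_shear_sq (j k : Fin 3) (q : ℍ[ℝ]) (t : ℝ) (v : QVec) :
    ‖shear j k (t • q) v‖ ^ 2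
      = ‖v‖ ^ 2 + t * (2 * inner ℝ (v k) (v j * q)) + t ^ 2 * ‖v j * q‖ ^ 2 := by
  have : shear j k (t • q) v = v + t • WithLp.toLp 2 (Pi.single k (v j * q)) := by
    ext a : 1
    simp [shear]
  rw [this, norm_add_sq_real, inner_smul_right, norm_smul, mul_pow, Real.norm_eq_abs, sq_abs]
  have h1 : inner ℝ v (WithLp.toLp 2 (Pi.single k (v j * q)) : QVec) = inner ℝ (v k) (v j * q) := by
    rw [PiLp.inner_apply, Finset.sum_eq_single k]
    · simp
    · intro b _ hb
      simp [hb]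
    · simp
  have h2 : ‖(WithLp.toLp 2 (Pi.single k (v j * q)) : QVec)‖ = ‖v j * q‖ := by simp
  rw [h1, h2]
  ring

theorem norm_diagScale_sq (d : Fin 3 → ℝ) (v : QVec) :
    ‖diagScale d v‖ ^ 2 = d 0 ^ 2 * ‖v 0‖ ^ 2 + d 1 ^ 2 * ‖v 1‖ ^ 2 + d 2 ^ 2 * ‖v 2‖ ^ 2 := by
  simp [QVec.norm_sq, diagScale, norm_smul, mul_pow]

theorem isClosed_triangularFrames : IsClosed triangularFrames := by
  have h₁ : IsClosed {g : QVec × QVec × QVec | g.2.1 0 = 0} :=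
    isClosed_eq (by fun_prop) (by fun_prop)
  have h₂ : IsClosed {g : QVec × QVec × QVec | g.2.2 0 = 0} :=
    isClosed_eq (by fun_prop) (by fun_prop)
  have h₃ : IsClosed {g : QVec × QVec × QVec | g.2.2 1 = 0} :=
    isClosed_eq (by fun_prop) (by fun_prop)
  have h₄ : IsClosed {g : QVec × QVec × QVec | ‖g.1 0‖ * ‖g.2.1 1‖ * ‖g.2.2 2‖ = 1} :=
    isClosed_eq (by fun_prop) (by fun_prop)
  exact h₁.inter (h₂.inter (h₃.inter h₄))

theorem exists_minimal_frame (S : Finset (ℍ[ℝ] × ℍ[ℝ])) (hcard : 2 ≤ S.card)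
    (hS : ∀ p ∈ S, ∀ q ∈ S, p ≠ q → 3 * (pointsOnLine S (p, q)).card < 2 * S.card) :
    ∃ g ∈ triangularFrames, ∀ h ∈ triangularFrames,
      ∑ p ∈ S, Real.log (‖framePoint g p‖ ^ 2) ≤ ∑ p ∈ S, Real.log (‖framePoint h p‖ ^ 2) := by
  set e : QVec × QVec × QVec := (WithLp.toLp 2 (Pi.single 0 1), WithLp.toLp 2 (Pi.single 1 1),
    WithLp.toLp 2 (Pi.single 2 1)) with he
  have heT : e ∈ triangularFrames := by simp [triangularFrames, he]
  obtain ⟨R, hR⟩ := exists_norm_bound S hcard hS (∑ p ∈ S, Real.log ‖framePoint e p‖)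
  have hcompact : IsCompact (triangularFrames ∩ Metric.closedBall 0 R) :=
    (isCompact_closedBall _ _).inter_left isClosed_triangularFrames
  have hcont : ContinuousOn (fun g => ∑ p ∈ S, Real.log ‖framePoint g p‖)
      (triangularFrames ∩ Metric.closedBall 0 R) := by
    refine continuousOn_finsetSum _ fun p _ => ContinuousOn.log ?_ fun g hg =>
      norm_ne_zero_iff.2 (framePoint_ne_zero hg.1 p)
    simp only [framePoint]
    fun_prop
  have heR : e ∈ triangularFrames ∩ Metric.closedBall 0 R :=
    ⟨heT, mem_closedBall_zero_iff.2 (hR e heT le_rfl)⟩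
  obtain ⟨g, hg, hmin⟩ := hcompact.exists_isMinOn ⟨e, heR⟩ hcont
  refine ⟨g, hg.1, fun h hh => ?_⟩
  simp only [Real.log_pow, ← Finset.mul_sum]
  refine mul_le_mul_of_nonneg_left ?_ (by norm_num)
  by_cases hle : ∑ p ∈ S, Real.log ‖framePoint h p‖ ≤ ∑ p ∈ S, Real.log ‖framePoint e p‖
  · exact hmin ⟨hh, mem_closedBall_zero_iff.2 (hR h hh hle)⟩
  · exact (hmin heR).trans (not_le.1 hle).le

/-- The points of `S` can be put in radial isotropic position if no line is too rich. -/
theorem exists_isotropic_frame (S : Finset (ℍ[ℝ] × ℍ[ℝ])) (hcard : 2 ≤ S.card)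
    (hS : ∀ p ∈ S, ∀ q ∈ S, p ≠ q → 3 * (pointsOnLine S (p, q)).card < 2 * S.card) :
    ∃ g ∈ triangularFrames, ∑ p ∈ S, (‖framePoint g p‖ ^ 2)⁻¹ •
      outer (fun a => star (framePoint g p a)) (framePoint g p) = ((S.card : ℝ) / 3) • idMat := by
  obtain ⟨g, hg, hmin⟩ := exists_minimal_frame S hcard hS
  have hpos : ∀ p, ‖framePoint g p‖ ^ 2 ≠ 0 := fun p =>
    pow_ne_zero 2 (norm_ne_zero_iff.2 (framePoint_ne_zero hg p))
  have hoff : ∀ j k : Fin 3, j < k → ∑ p ∈ S, (‖framePoint g p‖ ^ 2)⁻¹ •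
      (star (framePoint g p j) * framePoint g p k) = 0 := by
    intro j k hjk
    set N := ∑ p ∈ S, (‖framePoint g p‖ ^ 2)⁻¹ • (star (framePoint g p j) * framePoint g p k)
      with hN
    have key := sum_div_eq_zero_of_log_min S
      (fun p t => ‖framePoint g p‖ ^ 2 + t * (2 * inner ℝ (framePoint g p k) (framePoint g p j * N))
        + t ^ 2 * ‖framePoint g p j * N‖ ^ 2)
      (fun p => 2 * inner ℝ (framePoint g p k) (framePoint g p j * N))
      (fun p _ => by
        have h1 := (hasDerivAt_id' (0 : ℝ)).mul_const
          (2 * inner ℝ (framePoint g p k) (framePoint g p j * N))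
        have h2 := ((hasDerivAt_id' (0 : ℝ)).fun_pow 2).mul_const (‖framePoint g p j * N‖ ^ 2)
        exact ((h1.const_add (‖framePoint g p‖ ^ 2)).fun_add h2).congr_deriv (by simp))
      (fun p _ => by simpa using hpos p)
      (fun t => by
        have := hmin _ (shear_mem_triangularFrames hg hjk (t • N))
        simp only [framePoint_map, norm_shear_sq] at this
        simpa using this)
    have hnorm : ‖N‖ ^ 2 = 0 := by
      have hre : ‖N‖ ^ 2 = ∑ p ∈ S, (‖framePoint g p‖ ^ 2)⁻¹ *
          inner ℝ (framePoint g p k) (framePoint g p j * N) := by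
        rw [← real_inner_self_eq_norm_sq]
        nth_rw 1 [hN]
        rw [sum_inner]
        refine Finset.sum_congr rfl fun p _ => ?_
        rw [real_inner_smul_left, Quaternion.inner_def, Quaternion.inner_def, star_mul]
        congr 1
        simp
        ring
      rw [hre, ← mul_right_inj' (two_ne_zero (α := ℝ)), mul_zero, ← key, Finset.mul_sum]
      refine Finset.sum_congr rfl fun p _ => ?_
      simp
      ring
    simpa using hnorm
  have hscale : ∀ c : Fin 3 → ℝ, c 0 + c 1 + c 2 = 0 →
      ∑ p ∈ S, (c 0 * ‖framePoint g p 0‖ ^ 2 + c 1 * ‖framePoint g p 1‖ ^ 2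
        + c 2 * ‖framePoint g p 2‖ ^ 2) / ‖framePoint g p‖ ^ 2 = 0 := by
    intro c hc
    have hexp : ∀ (a b : ℝ), HasDerivAt (fun t => Real.exp (t * a) ^ 2 * b) (2 * (a * b)) 0 := by
      intro a b
      refine (((((hasDerivAt_id' (0 : ℝ)).mul_const a).exp).fun_pow 2).mul_const b).congr_deriv ?_
      simp
      ring
    have key := sum_div_eq_zero_of_log_min S
      (fun p t => Real.exp (t * c 0) ^ 2 * ‖framePoint g p 0‖ ^ 2
        + Real.exp (t * c 1) ^ 2 * ‖framePoint g p 1‖ ^ 2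
        + Real.exp (t * c 2) ^ 2 * ‖framePoint g p 2‖ ^ 2)
      _ (fun p _ => ((hexp (c 0) _).add (hexp (c 1) _)).add (hexp (c 2) _))
      (fun p _ => by simpa [← QVec.norm_sq] using framePoint_ne_zero hg p)
      (fun t => by
        have := hmin _ (diagScale_mem_triangularFrames hg (d := fun i => Real.exp (t * c i))
          (by rw [← Real.exp_add, ← Real.exp_add, ← mul_add, ← mul_add, hc, mul_zero,
            Real.exp_zero]))
        simp only [framePoint_map, norm_diagScale_sq] at this
        simpa [← QVec.norm_sq] using this)
    rw [← mul_right_inj' (two_ne_zero (α := ℝ)), mul_zero, ← key, Finset.mul_sum]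
    refine Finset.sum_congr rfl fun p _ => ?_
    simp [QVec.norm_sq]
    ring
  have hdiag : ∀ i : Fin 3, ∑ p ∈ S, ‖framePoint g p i‖ ^ 2 / ‖framePoint g p‖ ^ 2
      = (S.card : ℝ) / 3 := by
    have h1 := hscale ![1, -1, 0] (by simp)
    have h2 := hscale ![0, 1, -1] (by simp)
    have h3 : ∑ p ∈ S, (‖framePoint g p 0‖ ^ 2 + ‖framePoint g p 1‖ ^ 2
        + ‖framePoint g p 2‖ ^ 2) / ‖framePoint g p‖ ^ 2 = S.card := by
      simp_rw [← QVec.norm_sq]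
      rw [Finset.sum_congr rfl fun p _ => div_self (hpos p)]
      simp
    simp [add_div, neg_div, Finset.sum_add_distrib] at h1 h2 h3
    intro i
    fin_cases i <;> simp <;> linarith
  refine ⟨g, hg, ?_⟩
  ext ⟨j, k⟩ : 1
  simp only [outer, idMat, WithLp.ofLp_sum, WithLp.ofLp_smul, Finset.sum_apply, Pi.smul_apply]
  rcases lt_trichotomy j k with h | rfl | h
  · rw [hoff j k h, if_neg h.ne, smul_zero]
  · rw [if_pos rfl, ← hdiag j, Finset.sum_smul]
    refine Finset.sum_congr rfl fun p _ => ?_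
    rw [Quaternion.star_mul_self, Quaternion.normSq_eq_norm_mul_self, ← pow_two,
      div_eq_inv_mul, mul_smul]
    exact congrArg _ (Algebra.algebraMap_eq_smul_one (A := ℍ[ℝ]) (‖framePoint g p j‖ ^ 2))
  · have := congrArg star (hoff k j h)
    rw [if_neg h.ne', smul_zero]
    simpa [star_sum] using this

/-- Unit vectors in isotropic position, each line of which projects onto a plane, determine a line
with at most three points. -/
theorem exists_card_line_le_three_of_isotropic {α H : Type*} [DecidableEq α] [NormedAddCommGroup H]
    [InnerProductSpace ℝ H] (S : Finset α) (hne : S.Nonempty) (P : α → H)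
    (hP : ∀ i ∈ S, ‖P i‖ = 1)
    (hsum : ‖∑ i ∈ S, P i‖ ^ 2 = (S.card : ℝ) ^ 2 / 3) (line : α × α → Finset α)
    (hline : ∀ x ∈ S.offDiag, ∀ y, y ∈ (line x).offDiag ↔ y ∈ S.offDiag ∧ line y = line x)
    (hsub : ∀ x ∈ S.offDiag, line x ⊆ S)
    (hproj : ∀ x ∈ S.offDiag, ∃ Q : H, ‖Q‖ ^ 2 ≤ 2 ∧ ∀ i ∈ line x, inner ℝ (P i) Q = 1) :
    ∃ x ∈ S.offDiag, (line x).card ≤ 3 := by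
  by_contra! hcard
  have expand : ∀ T ⊆ S, ‖∑ i ∈ T, P i‖ ^ 2
      = T.card + ∑ x ∈ T.offDiag, inner ℝ (P x.1) (P x.2) := by
    intro T hT
    rw [← real_inner_self_eq_norm_sq, sum_inner]
    simp_rw [inner_sum]
    rw [← Finset.sum_product', ← Finset.diag_union_offDiag,
      Finset.sum_union (Finset.disjoint_diag_offDiag _), Finset.sum_diag]
    congr 1
    rw [Finset.sum_congr rfl (g := fun _ => (1 : ℝ))]
    · simp
    · intro i hi
      simp [hP i (hT hi)]
  have local_bound : ∀ l ∈ S.offDiag.image line,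
      ((l.offDiag.card : ℝ)) / 3 ≤ ∑ x ∈ l.offDiag, inner ℝ (P x.1) (P x.2) := by
    intro l hl
    obtain ⟨x, hx, rfl⟩ := Finset.mem_image.1 hl
    obtain ⟨Q, hQ, hPQ⟩ := hproj x hx
    have h4 : (4 : ℝ) ≤ (line x).card := by exact_mod_cast hcard x hx
    have hr : inner ℝ (∑ i ∈ line x, P i) Q = ((line x).card : ℝ) := by
      rw [sum_inner, Finset.sum_congr rfl hPQ]
      simp
    have hcs := real_inner_mul_inner_self_le (∑ i ∈ line x, P i) Q
    rw [hr, real_inner_self_eq_norm_sq, real_inner_self_eq_norm_sq] at hcs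
    have he := expand _ (hsub x hx)
    have hle := mul_le_mul_of_nonneg_left hQ (sq_nonneg ‖∑ i ∈ line x, P i‖)
    rw [Finset.offDiag_card, Nat.cast_sub (Nat.le_mul_self _)]
    push_cast
    nlinarith
  have total : ∀ f : α × α → ℝ, ∑ x ∈ S.offDiag, f x
      = ∑ l ∈ S.offDiag.image line, ∑ x ∈ l.offDiag, f x := by
    intro f
    rw [← Finset.sum_fiberwise_of_maps_to (g := line) (t := S.offDiag.image line)
      (fun x hx => Finset.mem_image_of_mem _ hx)]
    refine Finset.sum_congr rfl fun l hl => ?_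
    obtain ⟨x, hx, rfl⟩ := Finset.mem_image.1 hl
    refine Finset.sum_congr ?_ fun _ _ => rfl
    ext y
    rw [hline x hx, Finset.mem_filter]
  have hS := expand S subset_rfl
  have hcount : (S.offDiag.card : ℝ) / 3 ≤ ∑ x ∈ S.offDiag, inner ℝ (P x.1) (P x.2) := by
    rw [total]
    have := total (fun _ => 1 / 3)
    simp only [Finset.sum_const, nsmul_eq_mul] at this
    rw [div_eq_mul_one_div, this]
    exact Finset.sum_le_sum fun l hl => by
      rw [← div_eq_mul_one_div]
      exact local_bound l hl
  rw [Finset.offDiag_card, Nat.cast_sub (Nat.le_mul_self _)] at hcount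
  push_cast at hcount
  have : (1 : ℝ) ≤ S.card := by exact_mod_cast hne.card_pos
  nlinarith

theorem mem_pointsOnLine {S : Finset (ℍ[ℝ] × ℍ[ℝ])} {p q z : ℍ[ℝ] × ℍ[ℝ]} :
    z ∈ pointsOnLine S (p, q) ↔ z ∈ S ∧ z ∈ line[ℍ[ℝ], p, q] := by
  classical
  exact Finset.mem_filter

theorem pointsOnLine_eq_of_mem {S : Finset (ℍ[ℝ] × ℍ[ℝ])} {p q x y : ℍ[ℝ] × ℍ[ℝ]}
    (hx : x ∈ pointsOnLine S (p, q)) (hy : y ∈ pointsOnLine S (p, q)) (hxy : x ≠ y) :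
    pointsOnLine S (x, y) = pointsOnLine S (p, q) := by
  ext z
  rw [mem_pointsOnLine, mem_pointsOnLine,
    affineSpan_pair_eq_of_mem_of_mem_of_ne (mem_pointsOnLine.1 hx).2 (mem_pointsOnLine.1 hy).2 hxy]

theorem three_mul_card_pointsOnLine_lt {S : Finset (ℍ[ℝ] × ℍ[ℝ])}
    (hS : ¬ Collinear ℍ[ℝ] (S : Set (ℍ[ℝ] × ℍ[ℝ])))
    (hcard : ∀ p ∈ S, ∀ q ∈ S, p ≠ q → 4 ≤ (pointsOnLine S (p, q)).card)
    {p q : ℍ[ℝ] × ℍ[ℝ]} : 3 * (pointsOnLine S (p, q)).card < S.card := by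
  classical
  obtain ⟨r, hrS, hr⟩ : ∃ r ∈ S, r ∉ line[ℍ[ℝ], p, q] := by
    by_contra! h
    have hline : Collinear ℍ[ℝ] (line[ℍ[ℝ], p, q] : Set (ℍ[ℝ] × ℍ[ℝ])) := by
      rw [Collinear, ← AffineSubspace.direction_eq_vectorSpan, direction_affineSpan]
      exact collinear_pair ℍ[ℝ] p q
    exact hS (hline.subset h)
  have hne : ∀ z ∈ pointsOnLine S (p, q), r ≠ z := by
    rintro z hz rfl
    exact hr (mem_pointsOnLine.1 hz).2
  have hdisj : (pointsOnLine S (p, q) : Set (ℍ[ℝ] × ℍ[ℝ])).PairwiseDisjoint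
      fun z => (pointsOnLine S (r, z)).erase r := by
    intro z hz z' hz' hzz'
    refine Finset.disjoint_left.2 fun y hy hy' => hr ?_
    obtain ⟨hyr, hy⟩ := Finset.mem_erase.1 hy
    have hy' := (Finset.mem_erase.1 hy').2
    have h1 := affineSpan_pair_eq_of_mem_of_mem_of_ne (left_mem_affineSpan_pair _ _ _)
      (mem_pointsOnLine.1 hy).2 hyr.symm
    have h2 := affineSpan_pair_eq_of_mem_of_mem_of_ne (left_mem_affineSpan_pair _ _ _)
      (mem_pointsOnLine.1 hy').2 hyr.symm
    have hmem : z' ∈ line[ℍ[ℝ], r, z] := by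
      rw [← h1, h2]
      exact right_mem_affineSpan_pair _ _ _
    rw [← affineSpan_pair_eq_of_mem_of_mem_of_ne (mem_pointsOnLine.1 hz).2
        (mem_pointsOnLine.1 hz').2 hzz',
      affineSpan_pair_eq_of_mem_of_mem_of_ne (right_mem_affineSpan_pair _ _ _) hmem hzz']
    exact left_mem_affineSpan_pair _ _ _
  have hsub : ((pointsOnLine S (p, q)).biUnion fun z => (pointsOnLine S (r, z)).erase r)
      ⊆ S.erase r := by
    refine Finset.biUnion_subset.2 fun z _ => Finset.erase_subset_erase _ (Finset.filter_subset _ _)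
  have hle := Finset.card_le_card hsub
  rw [Finset.card_biUnion hdisj, Finset.card_erase_of_mem hrS] at hle
  have hsum := Finset.card_nsmul_le_sum (pointsOnLine S (p, q))
    (fun z => ((pointsOnLine S (r, z)).erase r).card) 3 fun z hz => by
      have hzS := (mem_pointsOnLine.1 hz).1
      rw [Finset.card_erase_of_mem (mem_pointsOnLine.2 ⟨hrS, left_mem_affineSpan_pair _ _ _⟩)]
      have := hcard r hrS z hzS (hne z hz)
      omega
  rw [smul_eq_mul] at hsum
  have := Finset.card_pos.2 ⟨r, hrS⟩
  omega

/-- A finite noncollinear set in the quaternionic plane has a line through exactly two or exactly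
three of its points. -/
theorem exists_pointsOnLine_card_le_three {S : Finset (ℍ[ℝ] × ℍ[ℝ])}
    (hS : ¬ Collinear ℍ[ℝ] (S : Set (ℍ[ℝ] × ℍ[ℝ]))) :
    ∃ p ∈ S, ∃ q ∈ S, p ≠ q ∧ (pointsOnLine S (p, q)).card ≤ 3 := by
  classical
  by_contra! hcard
  have hnt : (S : Set (ℍ[ℝ] × ℍ[ℝ])).Nontrivial := by
    by_contra h
    rcases (Set.not_nontrivial_iff.1 h).eq_empty_or_singleton with h | ⟨a, h⟩
    · exact hS (h ▸ collinear_empty _ _)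
    · exact hS (h ▸ collinear_singleton _ _)
  have hlight : ∀ p ∈ S, ∀ q ∈ S, p ≠ q →
      3 * (pointsOnLine S (p, q)).card < 2 * S.card := fun p _ q _ _ =>
    (three_mul_card_pointsOnLine_lt hS hcard).trans_le (by omega)
  obtain ⟨g, hg, hiso⟩ := exists_isotropic_frame S (Finset.one_lt_card_iff_nontrivial.2 hnt) hlight
  have hpos : ∀ p, ‖framePoint g p‖ ≠ 0 := fun p => norm_ne_zero_iff.2 (framePoint_ne_zero hg p)
  obtain ⟨x, hx, hle⟩ := exists_card_line_le_three_of_isotropic S hnt.nonempty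
    (fun p => (‖framePoint g p‖ ^ 2)⁻¹ •
      outer (fun a => star (framePoint g p a)) (framePoint g p))
    (fun p _ => by
      rw [← sq_eq_sq₀ (norm_nonneg _) zero_le_one, norm_smul, mul_pow, norm_outer_sq]
      simp only [norm_inv, norm_pow, norm_norm]
      field_simp [hpos p])
    (by
      rw [hiso, norm_smul, mul_pow, norm_idMat_sq, Real.norm_eq_abs, sq_abs]
      ring)
    (pointsOnLine S)
    (fun x hx y => by
      obtain ⟨p, q⟩ := x
      obtain ⟨a, b⟩ := y
      simp only [Finset.mem_offDiag] at hx ⊢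
      constructor
      · rintro ⟨ha, hb, hab⟩
        exact ⟨⟨(mem_pointsOnLine.1 ha).1, (mem_pointsOnLine.1 hb).1, hab⟩,
          pointsOnLine_eq_of_mem ha hb hab⟩
      · rintro ⟨⟨ha, hb, hab⟩, h⟩
        rw [← h]
        exact ⟨mem_pointsOnLine.2 ⟨ha, left_mem_affineSpan_pair _ _ _⟩,
          mem_pointsOnLine.2 ⟨hb, right_mem_affineSpan_pair _ _ _⟩, hab⟩)
    (fun x _ => Finset.filter_subset _ _)
    (fun x _ => by
      obtain ⟨w, hw, hann⟩ := exists_annihilator g x.1 x.2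
      obtain ⟨Q, hQ, hproj⟩ := exists_projection w hw
      refine ⟨Q, hQ, fun p hp => ?_⟩
      rw [real_inner_smul_left, hproj _ (hann p (mem_pointsOnLine.1 hp).2),
        inv_mul_cancel₀ (pow_ne_zero 2 (hpos p))])
  obtain ⟨h1, h2, h3⟩ := Finset.mem_offDiag.1 hx
  have := hcard _ h1 _ h2 h3
  simp only [Prod.mk.eta] at this
  omega

theorem sylvester_gallai_quaternionic_plane
    (S : Set (Quaternion ℝ × Quaternion ℝ)) (hfin : S.Finite)
    (hS : ¬ Collinear (Quaternion ℝ) S) :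
    ∃ p ∈ S, ∃ q ∈ S, p ≠ q ∧
      2 ≤ (S ∩ (affineSpan (Quaternion ℝ) {p, q} : Set (Quaternion ℝ × Quaternion ℝ))).ncard ∧
      (S ∩ (affineSpan (Quaternion ℝ) {p, q} : Set (Quaternion ℝ × Quaternion ℝ))).ncard ≤ 24 := by
  lift S to Finset (ℍ[ℝ] × ℍ[ℝ]) using hfin
  obtain ⟨p, hp, q, hq, hpq, hcard⟩ := exists_pointsOnLine_card_le_three hS
  have hline : (S : Set (ℍ[ℝ] × ℍ[ℝ])) ∩ (affineSpan ℍ[ℝ] {p, q} : Set (ℍ[ℝ] × ℍ[ℝ]))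
      = pointsOnLine S (p, q) := by
    ext z
    exact mem_pointsOnLine.symm
  refine ⟨p, hp, q, hq, hpq, ?_, ?_⟩ <;> rw [hline, Set.ncard_coe_finset]
  · exact Finset.one_lt_card.2 ⟨p, mem_pointsOnLine.2 ⟨hp, left_mem_affineSpan_pair _ _ _⟩,
      q, mem_pointsOnLine.2 ⟨hq, right_mem_affineSpan_pair _ _ _⟩, hpq⟩
  · omega
end

section
/- Let A and B be finite subsets of ℂ, each with at least two elements. Then there exist two distinct points p, q of the Cartesian product A × B ⊆ ℂ² such that the intersection of A × B with the line through p and q (the affine span over ℂ of {p, q}) is exactly {p, q}. -/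
/-- A complex number at distance one from both `0` and `1` is a primitive sixth root of unity. -/
lemma sq_sub_self_add_one_eq_zero_of_norm {t : ℂ} (h0 : ‖t‖ = 1) (h1 : ‖t - 1‖ = 1) :
    t ^ 2 - t + 1 = 0 := by
  have e0 : t * (starRingEnd ℂ) t = 1 := by
    rw [Complex.mul_conj']; simp [h0]
  have e1 : (t - 1) * ((starRingEnd ℂ) t - 1) = 1 := by
    have := Complex.mul_conj' (t - 1)
    rw [h1] at this
    simpa using this
  linear_combination t * (e0 - e1) - e0

/-- The two primitive sixth roots of unity are at distance more than one from each other. -/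
lemma eq_of_sq_sub_self_add_one_eq_zero {t s : ℂ} (ht : t ^ 2 - t + 1 = 0)
    (hs : s ^ 2 - s + 1 = 0) (hts : ‖t - s‖ ≤ 1) : t = s := by
  by_contra hne
  have hsum : t + s - 1 = 0 := by
    have : (t - s) * (t + s - 1) = 0 := by linear_combination ht - hs
    exact (mul_eq_zero.mp this).resolve_left (sub_ne_zero.mpr hne)
  have hsq : (t - s) ^ 2 = -3 := by
    linear_combination (t - 3 * s + 1) * hsum + 4 * hs
  have hnorm : ‖t - s‖ ^ 2 = 3 := by
    rw [← norm_pow, hsq]; simp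
  nlinarith [norm_nonneg (t - s)]

/-- A set of complex numbers in which every segment of a given positive length can be rotated
by a primitive sixth root of unity about its endpoints is empty of such segments or infinite. -/
lemma not_finite_of_rotation_closed {A : Set ℂ} {w a d : ℂ} (hw : w ^ 2 - w + 1 = 0)
    (hd : d ≠ 0) (ha : a ∈ A) (had : a + d ∈ A)
    (hrot : ∀ x y : ℂ, x ∈ A → x + y ∈ A → ‖y‖ = ‖d‖ → x + w * y ∈ A) : ¬ A.Finite := by
  have hw3 : w ^ 3 = -1 := by linear_combination (w + 1) * hw
  have hwn : ‖w‖ = 1 := by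
    have : ‖w‖ ^ 3 = 1 := by rw [← norm_pow, hw3]; simp
    exact (pow_eq_one_iff_of_nonneg (norm_nonneg w) three_ne_zero).mp this
  have hback : ∀ x : ℂ, x ∈ A → x + d ∈ A → x - d ∈ A := by
    intro x hx hxd
    have h1 := hrot x d hx hxd rfl
    have h2 := hrot x (w * d) hx h1 (by simp [hwn])
    have h3 := hrot x (w * (w * d)) hx h2 (by simp [hwn])
    convert h3 using 1
    linear_combination (-d) * hw3
  have hall : ∀ n : ℕ, a - n * d ∈ A ∧ a - n * d + d ∈ A := by
    intro n
    induction n with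
    | zero => simpa using ⟨ha, had⟩
    | succ n ih =>
      refine ⟨?_, ?_⟩
      · convert hback _ ih.1 ih.2 using 1
        push_cast; ring
      · convert ih.1 using 1
        push_cast; ring
  intro hfin
  refine Set.infinite_of_injective_forall_mem (f := fun n : ℕ => a - n * d) ?_
    (fun n => (hall n).1) hfin
  intro m n hmn
  have : (m : ℂ) * d = n * d := by simpa using hmn
  exact_mod_cast mul_right_cancel₀ hd this

lemma exists_third_parameter {S : Set (ℂ × ℂ)} {p q : ℂ × ℂ} (hp : p ∈ S) (hq : q ∈ S)
    (h : S ∩ (affineSpan ℂ {p, q} : Set (ℂ × ℂ)) ≠ {p, q}) :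
    ∃ t : ℂ, t ≠ 0 ∧ t ≠ 1 ∧ p + t • (q - p) ∈ S := by
  by_contra! hno
  refine h (Set.Subset.antisymm ?_ ?_)
  · rintro r ⟨hrS, hr⟩
    obtain ⟨t, rfl⟩ := mem_affineSpan_pair_iff_exists_lineMap_eq.mp hr
    have hline : AffineMap.lineMap p q t = p + t • (q - p) := by
      rw [AffineMap.lineMap_apply_module']; abel
    rw [hline] at hrS ⊢
    by_cases h0 : t = 0
    · simp [h0]
    by_cases h1 : t = 1
    · simp [h1]
    exact absurd hrS (hno t h0 h1)
  · rintro r (rfl | rfl)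
    · exact ⟨hp, left_mem_affineSpan_pair ℂ _ _⟩
    · exact ⟨hq, right_mem_affineSpan_pair ℂ _ _⟩

theorem complex_grid_ordinary_line
    (A B : Set ℂ) (hA : A.Finite) (hB : B.Finite)
    (hA2 : 2 ≤ A.ncard) (hB2 : 2 ≤ B.ncard) :
    ∃ p ∈ A ×ˢ B, ∃ q ∈ A ×ˢ B, p ≠ q ∧
      (A ×ˢ B) ∩ (affineSpan ℂ {p, q} : Set (ℂ × ℂ)) = {p, q} := by
  by_contra! hno
  have hAoff : A.offDiag.Nonempty :=
    Set.offDiag_nonempty.mpr ((Set.one_lt_ncard_iff_nontrivial_and_finite.mp hA2).1)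
  have hBoff : B.offDiag.Nonempty :=
    Set.offDiag_nonempty.mpr ((Set.one_lt_ncard_iff_nontrivial_and_finite.mp hB2).1)
  -- a shortest segment of `A` and a longest segment of `B`
  obtain ⟨⟨a, a'⟩, ⟨ha, ha', haa⟩, hmin⟩ :=
    Set.exists_min_image A.offDiag (fun z => ‖z.2 - z.1‖) hA.offDiag hAoff
  obtain ⟨⟨b, b'⟩, ⟨hb, hb', hbb⟩, hmax⟩ :=
    Set.exists_max_image B.offDiag (fun z => ‖z.2 - z.1‖) hB.offDiag hBoff
  dsimp only at ha ha' haa hb hb' hbb hmin hmax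
  have hmax' : ∀ u ∈ B, ∀ v ∈ B, ‖v - u‖ ≤ ‖b' - b‖ := by
    intro u hu v hv
    by_cases huv : u = v
    · simp [huv]
    · exact hmax (u, v) ⟨hu, hv, huv⟩
  have hd : a' - a ≠ 0 := sub_ne_zero.mpr haa.symm
  have hepos : 0 < ‖b' - b‖ := norm_pos_iff.mpr (sub_ne_zero.mpr hbb.symm)
  have hdpos : 0 < ‖a' - a‖ := norm_pos_iff.mpr hd
  have key : ∀ x y : ℂ, x ∈ A → x + y ∈ A → ‖y‖ = ‖a' - a‖ →
      ∃ t : ℂ, t ^ 2 - t + 1 = 0 ∧ x + t * y ∈ A ∧ b + t * (b' - b) ∈ B := by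
    intro x y hx hxy hy
    have hypos : 0 < ‖y‖ := hy ▸ hdpos
    have hp : (x, b) ∈ A ×ˢ B := ⟨hx, hb⟩
    have hq : (x + y, b') ∈ A ×ˢ B := ⟨hxy, hb'⟩
    have hpq : (x, b) ≠ (x + y, b') := fun h => hbb (congrArg Prod.snd h)
    obtain ⟨t, ht0, ht1, htA, htB⟩ := exists_third_parameter hp hq (hno _ hp _ hq hpq)
    simp only [Prod.fst_add, Prod.snd_add, Prod.smul_fst, Prod.smul_snd, Prod.fst_sub,
      Prod.snd_sub, add_sub_cancel_left, smul_eq_mul] at htA htB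
    have hy0 : y ≠ 0 := norm_pos_iff.mp hypos
    refine ⟨t, sq_sub_self_add_one_eq_zero_of_norm (le_antisymm ?_ ?_) (le_antisymm ?_ ?_),
      htA, htB⟩
    · have h := hmax' _ hb _ htB
      rw [add_sub_cancel_left, norm_mul] at h
      exact le_of_mul_le_mul_right (by linarith) hepos
    · have h := hmin (x, x + t * y) ⟨hx, htA, by simp [ht0, hy0]⟩
      dsimp only at h
      rw [add_sub_cancel_left, norm_mul, ← hy] at h
      exact le_of_mul_le_mul_right (by linarith) hypos
    · have h := hmax' _ hb' _ htB
      rw [show b + t * (b' - b) - b' = (t - 1) * (b' - b) by ring, norm_mul] at h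
      exact le_of_mul_le_mul_right (by linarith) hepos
    · have h := hmin (x + y, x + t * y) ⟨hxy, htA, by simp [ht1, hy0]⟩
      dsimp only at h
      rw [show x + t * y - (x + y) = (t - 1) * y by ring, norm_mul, ← hy] at h
      exact le_of_mul_le_mul_right (by linarith) hypos
  have haa' : a + (a' - a) ∈ A := by simpa using ha'
  obtain ⟨w, hw, -, hwB⟩ := key a (a' - a) ha haa' rfl
  refine not_finite_of_rotation_closed hw hd ha haa' ?_ hA
  intro x y hx hxy hy
  obtain ⟨t, ht, htA, htB⟩ := key x y hx hxy hy
  have hwt : w = t := by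
    refine eq_of_sq_sub_self_add_one_eq_zero hw ht ?_
    have h := hmax' _ htB _ hwB
    rw [show b + w * (b' - b) - (b + t * (b' - b)) = (w - t) * (b' - b) by ring, norm_mul] at h
    exact le_of_mul_le_mul_right (by linarith) hepos
  rwa [hwt]
end

section
/- Let A and B be finite subsets of the quaternions ℍ, each with at least two elements. Then there exist two distinct points p, q of the Cartesian product A × B ⊆ ℍ² such that the intersection of A × B with the line through p and q (the affine span over ℍ of {p, q}) contains at least 2 and at most 5 points. -/
/-- A finite family of points of a Euclidean space at a common nonzero mutual distance is affinely
independent. -/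
theorem affineIndependent_of_dist_eq {V ι : Type*} [NormedAddCommGroup V] [InnerProductSpace ℝ V]
    [Fintype ι] (x : ι → V) {d : ℝ} (hd : d ≠ 0) (h : ∀ i j, i ≠ j → dist (x i) (x j) = d) :
    AffineIndependent ℝ x := by
  classical
  rw [affineIndependent_iff_of_fintype]
  intro w hw h0
  have key := EuclideanGeometry.inner_weightedVSub (s₁ := Finset.univ) (w₁ := w) x hw
    (s₂ := Finset.univ) (w₂ := w) x hw
  have hterm (i j : ι) : w i * w j * (dist (x i) (x j) * dist (x i) (x j)) =
      w i * w j * d ^ 2 - if i = j then w i * w j * d ^ 2 else 0 := by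
    split_ifs with hij
    · simp [hij]
    · rw [h i j hij]
      ring
  have hinner (i : ι) : ∑ j, w i * w j * d ^ 2 = 0 := by
    rw [← Finset.sum_mul, ← Finset.mul_sum, hw]
    simp
  simp only [h0, inner_zero_left, hterm, Finset.sum_sub_distrib, hinner, Finset.sum_ite_eq,
    Finset.mem_univ, if_true, Finset.sum_const_zero, ← Finset.sum_mul] at key
  have hsum : ∑ i, w i * w i = 0 := by
    have hmul : (∑ i, w i * w i) * d ^ 2 = 0 := by linarith
    exact (mul_eq_zero.mp hmul).resolve_right (pow_ne_zero 2 hd)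
  intro i
  have := (Finset.sum_eq_zero_iff_of_nonneg fun i _ => mul_self_nonneg (w i)).mp hsum i
    (Finset.mem_univ i)
  exact mul_self_eq_zero.mp this

/-- A finite family of points of `V` at a common nonzero mutual distance has at most
`dim V + 1` members. -/
theorem card_le_finrank_succ_of_dist_eq {V ι : Type*} [NormedAddCommGroup V]
    [InnerProductSpace ℝ V] [FiniteDimensional ℝ V] [Fintype ι] (x : ι → V) {d : ℝ} (hd : d ≠ 0)
    (h : ∀ i j, i ≠ j → dist (x i) (x j) = d) :
    Fintype.card ι ≤ Module.finrank ℝ V + 1 :=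
  (affineIndependent_of_dist_eq x hd h).card_le_finrank_succ.trans
    (Nat.add_le_add_right (Submodule.finrank_le _) 1)

theorem quaternion_grid_line
    (A B : Set (Quaternion ℝ)) (hA : A.Finite) (hB : B.Finite)
    (hA2 : 2 ≤ A.ncard) (hB2 : 2 ≤ B.ncard) :
    ∃ p ∈ A ×ˢ B, ∃ q ∈ A ×ˢ B, p ≠ q ∧
      2 ≤ ((A ×ˢ B) ∩
          (affineSpan (Quaternion ℝ) {p, q} : Set (Quaternion ℝ × Quaternion ℝ))).ncard ∧
      ((A ×ˢ B) ∩
          (affineSpan (Quaternion ℝ) {p, q} : Set (Quaternion ℝ × Quaternion ℝ))).ncard ≤ 5 := by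
  -- Join a closest pair of `A` to a farthest pair of `B`.
  obtain ⟨a₀, ha₀, a₁, ha₁, ha⟩ := (Set.one_lt_ncard hA).mp hA2
  obtain ⟨b₀, hb₀, b₁, hb₁, hb⟩ := (Set.one_lt_ncard hB).mp hB2
  obtain ⟨⟨a, a'⟩, ⟨haA, ha'A, haa'⟩, hmin⟩ := Set.exists_min_image A.offDiag
    (fun z => dist z.1 z.2) hA.offDiag ⟨(a₀, a₁), ha₀, ha₁, ha⟩
  obtain ⟨⟨b, b'⟩, ⟨hbB, hb'B, hbb'⟩, hmax⟩ := Set.exists_max_image B.offDiag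
    (fun z => dist z.1 z.2) hB.offDiag ⟨(b₀, b₁), hb₀, hb₁, hb⟩
  have hpq : (a, b) ≠ (a', b') := fun h => haa' (congrArg Prod.fst h)
  refine ⟨(a, b), ⟨haA, hbB⟩, (a', b'), ⟨ha'A, hb'B⟩, hpq, ?_⟩
  set S := (A ×ˢ B) ∩
    (affineSpan (Quaternion ℝ) {(a, b), (a', b')} : Set (Quaternion ℝ × Quaternion ℝ))
  have hSfin : S.Finite := (hA.prod hB).subset Set.inter_subset_left
  refine ⟨(Set.one_lt_ncard hSfin).mpr
    ⟨(a, b), ⟨⟨haA, hbB⟩, left_mem_affineSpan_pair _ _ _⟩,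
      (a', b'), ⟨⟨ha'A, hb'B⟩, right_mem_affineSpan_pair _ _ _⟩, hpq⟩, ?_⟩
  have hda : 0 < dist a a' := dist_pos.mpr haa'
  have hdb : 0 < dist b b' := dist_pos.mpr hbb'
  have hdist : ∀ z w : S, z ≠ w → dist z.1.1 w.1.1 = dist a a' := by
    rintro ⟨⟨x, y⟩, ⟨hx, hy⟩, hz⟩ ⟨⟨x', y'⟩, ⟨hx', hy'⟩, hw⟩ hne
    obtain ⟨t, ht⟩ := mem_affineSpan_pair_iff_exists_lineMap_eq.mp hz
    obtain ⟨s, hs⟩ := mem_affineSpan_pair_iff_exists_lineMap_eq.mp hw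
    simp only [AffineMap.lineMap_apply, vsub_eq_sub, vadd_eq_add, Prod.ext_iff, Prod.fst_add,
      Prod.snd_add, Prod.smul_fst, Prod.smul_snd, Prod.fst_sub, Prod.snd_sub, smul_eq_mul] at ht hs
    obtain ⟨rfl, rfl⟩ := ht
    obtain ⟨rfl, rfl⟩ := hs
    have hscale (u v : Quaternion ℝ) :
        dist (t * (v - u) + u) (s * (v - u) + u) = ‖t - s‖ * dist u v := by
      rw [dist_add_right, dist_eq_norm, ← sub_mul, norm_mul, dist_comm, dist_eq_norm]
    have hts : t ≠ s := by
      rintro rfl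
      exact hne rfl
    have hpos : 0 < ‖t - s‖ := norm_pos_iff.mpr (sub_ne_zero.mpr hts)
    have h₁ := hmin (t * (a' - a) + a, s * (a' - a) + a)
      ⟨hx, hx', dist_pos.mp (by rw [hscale]; positivity)⟩
    have h₂ := hmax (t * (b' - b) + b, s * (b' - b) + b)
      ⟨hy, hy', dist_pos.mp (by rw [hscale]; positivity)⟩
    simp only [hscale] at h₁ h₂ ⊢
    have h₁' : 1 ≤ ‖t - s‖ := le_of_mul_le_mul_right (by linarith) hda
    have h₂' : ‖t - s‖ ≤ 1 := le_of_mul_le_mul_right (by linarith) hdb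
    rw [le_antisymm h₂' h₁', one_mul]
  have := hSfin.fintype
  have hcard := card_le_finrank_succ_of_dist_eq (fun z : S => z.1.1) hda.ne' hdist
  rwa [Quaternion.finrank_eq_four, ← Nat.card_eq_fintype_card, Nat.card_coe_set_eq] at hcard
end

section
/- In ℍ² = ℍ × ℍ with the norm ‖(a,b)‖ = √(‖a‖² + ‖b‖²), for any quaternions z, w ∈ ℍ, the distance from the point (w, 0) to the line through (0, 1) and (z, 0) (the affine span over ℍ of these two points, where ℍ² is a left ℍ-module) equals ‖z − w‖ / √(1 + ‖z‖²). -/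
/-- The squared `ℓ²` distance from `(w, 0)` to a point `(t * z, 1 - t)` of the quaternionic line
through `(0, 1)` and `(z, 0)` is bounded below. -/
lemma norm_sub_sq_le_mul_line_dist_sq (z w t : Quaternion ℝ) :
    ‖z - w‖ ^ 2 ≤ (1 + ‖z‖ ^ 2) * (‖w - t * z‖ ^ 2 + ‖1 - t‖ ^ 2) := by
  have h : ‖z - w‖ ≤ ‖1 - t‖ * ‖z‖ + ‖w - t * z‖ := by
    rw [← norm_mul]
    calc ‖z - w‖ = ‖(1 - t) * z - (w - t * z)‖ := by congr 1; noncomm_ring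
      _ ≤ _ := norm_sub_le _ _
  nlinarith [sq_nonneg (‖1 - t‖ - ‖z‖ * ‖w - t * z‖), pow_le_pow_left₀ (norm_nonneg _) h 2]

/-- The lower bound for the distance from `(w, 0)` to the quaternionic line through `(0, 1)` and
`(z, 0)` is attained. -/
lemma exists_line_dist_sq_eq (z w : Quaternion ℝ) :
    ∃ t : Quaternion ℝ,
      ‖w - t * z‖ ^ 2 + ‖1 - t‖ ^ 2 = ‖z - w‖ ^ 2 / (1 + ‖z‖ ^ 2) := by
  have hpos : 0 < 1 + ‖z‖ ^ 2 := by positivity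
  set c : ℝ := (1 + ‖z‖ ^ 2)⁻¹ with hc
  have hcz : c + c * ‖z‖ ^ 2 = 1 := by rw [hc]; field_simp
  have hs : star z * z = ((‖z‖ ^ 2 : ℝ) : Quaternion ℝ) := by
    rw [Quaternion.star_mul_self, Quaternion.normSq_eq_norm_mul_self, sq]
  have hs' : z * star z = ((‖z‖ ^ 2 : ℝ) : Quaternion ℝ) := by
    rw [Quaternion.self_mul_star, Quaternion.normSq_eq_norm_mul_self, sq]
  have smul_coe (a : ℝ) (q : Quaternion ℝ) : q * (a : Quaternion ℝ) = a • q :=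
    Quaternion.mul_coe_eq_smul a q
  have h₁ : w - (c • (1 + w * star z)) * z = c • (w - z) := by
    rw [smul_mul_assoc, add_mul, one_mul, mul_assoc, hs, smul_coe]
    nth_rw 1 [← one_smul ℝ w, ← hcz]
    module
  have h₂ : 1 - c • (1 + w * star z) = c • ((z - w) * star z) := by
    rw [sub_mul, hs', ← one_mul ((‖z‖ ^ 2 : ℝ) : Quaternion ℝ), smul_coe]
    nth_rw 1 [← one_smul ℝ (1 : Quaternion ℝ), ← hcz]
    module
  refine ⟨c • (1 + w * star z), ?_⟩
  rw [h₁, h₂, norm_smul, norm_smul, norm_mul, norm_star, norm_sub_rev w z, Real.norm_eq_abs,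
    mul_pow, mul_pow, mul_pow, sq_abs, hc]
  field_simp

theorem dist_point_to_quaternion_line (z w : Quaternion ℝ) :
    Metric.infDist ((WithLp.equiv 2 (Quaternion ℝ × Quaternion ℝ)).symm (w, 0))
      (affineSpan (Quaternion ℝ)
        ({(WithLp.equiv 2 (Quaternion ℝ × Quaternion ℝ)).symm (0, 1),
          (WithLp.equiv 2 (Quaternion ℝ × Quaternion ℝ)).symm (z, 0)} :
          Set (WithLp 2 (Quaternion ℝ × Quaternion ℝ))) :
        Set (WithLp 2 (Quaternion ℝ × Quaternion ℝ))) =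
      ‖z - w‖ / Real.sqrt (1 + ‖z‖ ^ 2) := by
  have hdist (t : Quaternion ℝ) :
      dist ((WithLp.equiv 2 (Quaternion ℝ × Quaternion ℝ)).symm (w, 0))
        (AffineMap.lineMap ((WithLp.equiv 2 (Quaternion ℝ × Quaternion ℝ)).symm (0, 1))
          ((WithLp.equiv 2 (Quaternion ℝ × Quaternion ℝ)).symm (z, 0)) t) =
      Real.sqrt (‖w - t * z‖ ^ 2 + ‖1 - t‖ ^ 2) := by
    rw [WithLp.prod_dist_eq_of_L2, dist_eq_norm, dist_eq_norm, ← norm_neg (1 - t)]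
    simp [AffineMap.lineMap_apply, sub_eq_add_neg, add_comm]
  have hpos : 0 < 1 + ‖z‖ ^ 2 := by positivity
  have hval : ‖z - w‖ / Real.sqrt (1 + ‖z‖ ^ 2) =
      Real.sqrt (‖z - w‖ ^ 2 / (1 + ‖z‖ ^ 2)) := by
    rw [Real.sqrt_div (sq_nonneg _), Real.sqrt_sq (norm_nonneg _)]
  rw [hval]
  apply le_antisymm
  · obtain ⟨t, ht⟩ := exists_line_dist_sq_eq z w
    rw [← ht, ← hdist t]
    exact Metric.infDist_le_dist_of_mem (AffineMap.lineMap_mem_affineSpan_pair t _ _)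
  · refine (Metric.le_infDist ⟨_, left_mem_affineSpan_pair _ _ _⟩).2 fun p hp => ?_
    obtain ⟨t, rfl⟩ := mem_affineSpan_pair_iff_exists_lineMap_eq.1 hp
    rw [hdist t]
    refine Real.sqrt_le_sqrt ((div_le_iff₀' hpos).2 ?_)
    exact norm_sub_sq_le_mul_line_dist_sq z w t
end

section
/- Let S be a finite set of nonzero vectors in the Euclidean plane ℝ² (e.g. EuclideanSpace ℝ (Fin 2)) such that for any two distinct a, b ∈ S one has ⟨a, b⟩ < (1/2)·‖a‖·‖b‖ (i.e., the angle between a and b is strictly greater than π/3). Then S has at most 5 elements. -/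
open scoped RealInnerProductSpace

/-- The inner product of two plane vectors in terms of norms and principal arguments. -/
lemma Complex.inner_eq_norm_mul_norm_mul_cos_arg_sub (z w : ℂ) :
    ⟪z, w⟫ = ‖z‖ * ‖w‖ * Real.cos (z.arg - w.arg) := by
  rw [Complex.inner, Real.cos_sub, Complex.mul_re, Complex.conj_re, Complex.conj_im,
    ← Complex.norm_mul_cos_arg z, ← Complex.norm_mul_cos_arg w,
    ← Complex.norm_mul_sin_arg z, ← Complex.norm_mul_sin_arg w]
  ring

/-- Polar angles in the plane, measured from the direction of a nonzero vector `a`. -/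
lemma exists_polar_angle (a : EuclideanSpace ℝ (Fin 2)) (ha : a ≠ 0) :
    ∃ φ : EuclideanSpace ℝ (Fin 2) → ℝ, φ a = 0 ∧ (∀ b, -Real.pi < φ b ∧ φ b ≤ Real.pi) ∧
      ∀ b c, ⟪b, c⟫ = ‖b‖ * ‖c‖ * Real.cos (φ b - φ c) := by
  let e := Complex.orthonormalBasisOneI.repr.symm
  have hea : e a ≠ 0 := by simpa using ha
  refine ⟨fun b => (e b / e a).arg, by simp [hea],
    fun b => ⟨Complex.neg_pi_lt_arg _, Complex.arg_le_pi _⟩, fun b c => ?_⟩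
  have key := Complex.inner_eq_norm_mul_norm_mul_cos_arg_sub (e b / e a) (e c / e a)
  have hn : ‖a‖ ≠ 0 := norm_ne_zero_iff.mpr ha
  have hscale : ⟪e b / e a, e c / e a⟫ = ⟪e b, e c⟫ / ‖e a‖ ^ 2 := by
    rw [Complex.inner, Complex.inner, map_div₀, div_mul_div_comm, Complex.mul_conj',
      ← Complex.ofReal_pow, Complex.div_ofReal_re]
  rw [hscale, norm_div, norm_div, e.inner_map_map, e.norm_map, e.norm_map, e.norm_map] at key
  field_simp at key
  exact key

theorem card_le_five_of_pairwise_angle_gt_sixty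
    (S : Set (EuclideanSpace ℝ (Fin 2))) (hfin : S.Finite)
    (h0 : ∀ a ∈ S, a ≠ 0)
    (h : ∀ a ∈ S, ∀ b ∈ S, a ≠ b → ⟪a, b⟫ < (1 / 2) * ‖a‖ * ‖b‖) :
    S.ncard ≤ 5 := by
  obtain rfl | ⟨a, ha⟩ := S.eq_empty_or_nonempty
  · simp
  obtain ⟨φ, hφa, hφ, hinner⟩ := exists_polar_angle a (h0 a ha)
  have hsep : ∀ b ∈ S, ∀ c ∈ S, |φ b - φ c| ≤ Real.pi / 3 → b = c := by
    intro b hb c hc hbc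
    by_contra hne
    have hlt := h b hb c hc hne
    have hcos : 1 / 2 ≤ Real.cos (φ b - φ c) := by
      rw [← Real.cos_abs, ← Real.cos_pi_div_three]
      exact Real.cos_le_cos_of_nonneg_of_le_pi (abs_nonneg _) (by linarith [Real.pi_pos]) hbc
    have hmul := mul_le_mul_of_nonneg_left hcos (mul_nonneg (norm_nonneg b) (norm_nonneg c))
    rw [hinner] at hlt
    linarith
  let sector : EuclideanSpace ℝ (Fin 2) → Fin 5 := fun b =>
    if |φ b| ≤ Real.pi / 3 then 0
    else if φ b ≤ -(2 * Real.pi / 3) then 1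
    else if φ b ≤ 0 then 2
    else if φ b ≤ 2 * Real.pi / 3 then 3
    else 4
  have hinj : Set.InjOn sector S := by
    intro b hb c hc hbc
    by_cases hb0 : |φ b| ≤ Real.pi / 3
    · by_cases hc0 : |φ c| ≤ Real.pi / 3
      · rw [hsep b hb a ha (by simpa [hφa] using hb0), hsep c hc a ha (by simpa [hφa] using hc0)]
      · simp only [sector, hb0, hc0, if_true, if_false] at hbc
        split_ifs at hbc <;> exact absurd hbc (by decide)
    · by_cases hc0 : |φ c| ≤ Real.pi / 3
      · simp only [sector, hb0, hc0, if_true, if_false] at hbc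
        split_ifs at hbc <;> exact absurd hbc (by decide)
      · apply hsep b hb c hc
        obtain ⟨hb1, hb2⟩ := hφ b
        obtain ⟨hc1, hc2⟩ := hφ c
        simp only [sector, hb0, hc0, if_false] at hbc
        rw [not_le, lt_abs] at hb0 hc0
        rw [abs_le]
        split_ifs at hbc <;> first
          | exact absurd hbc (by decide)
          | rcases hb0 with hb0 | hb0 <;> rcases hc0 with hc0 | hc0 <;> constructor <;> linarith
  rw [← hinj.ncard_image]
  simpa using Set.ncard_le_card (sector '' S)
end

section
/- Let S be a finite set of nonzero vectors in 4-dimensional real Euclidean space ℝ⁴ (e.g. EuclideanSpace ℝ (Fin 4)) such that for any two distinct a, b ∈ S one has ⟨a, b⟩ < (1/2)·‖a‖·‖b‖ (i.e., the angle between a and b is strictly greater than π/3). Then S has at most 24 elements. -/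
open scoped RealInnerProductSpace

section SymmetricPower

open Polynomial Matrix

/-- The linear polynomial whose coefficients form the `r`-th row of a `2 × 2` matrix. -/
private noncomputable def rowPoly (M : Matrix (Fin 2) (Fin 2) ℂ) (r : Fin 2) : ℂ[X] :=
  C (M r 0) * X + C (M r 1)

/-- The `k`-th symmetric power of a `2 × 2` matrix, in the monomial basis. -/
private noncomputable def symPower (k : ℕ) (M : Matrix (Fin 2) (Fin 2) ℂ) :
    Matrix (Fin (k + 1)) (Fin (k + 1)) ℂ :=
  Matrix.of fun i j => (rowPoly M 0 ^ (i : ℕ) * rowPoly M 1 ^ (k - i)).coeff j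

private theorem natDegree_rowPoly_le (M : Matrix (Fin 2) (Fin 2) ℂ) (r : Fin 2) :
    (rowPoly M r).natDegree ≤ 1 :=
  natDegree_linear_le

private theorem natDegree_rowPoly_pow_mul_le (M : Matrix (Fin 2) (Fin 2) ℂ) (i m : ℕ) :
    (rowPoly M 0 ^ i * rowPoly M 1 ^ m).natDegree ≤ i + m := by
  refine natDegree_mul_le_of_le ?_ ?_
  · simpa using natDegree_pow_le_of_le i (natDegree_rowPoly_le M 0)
  · simpa using natDegree_pow_le_of_le m (natDegree_rowPoly_le M 1)

private theorem sum_coeff_linear_mul (a b : ℂ) {p : ℂ[X]} {n : ℕ} (hp : p.natDegree ≤ n)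
    (Z W : ℂ[X]) :
    ∑ j ∈ Finset.range (n + 2), C (((C a * X + C b) * p).coeff j) * (Z ^ j * W ^ (n + 1 - j)) =
      (C a * Z + C b * W) * ∑ j ∈ Finset.range (n + 1), C (p.coeff j) * (Z ^ j * W ^ (n - j)) := by
  have hsplit : ∀ j, ((C a * X + C b) * p).coeff j = a * (X * p).coeff j + b * p.coeff j := by
    intro j
    rw [add_mul, coeff_add, mul_assoc, coeff_C_mul, coeff_C_mul]
  simp only [hsplit]
  simp only [C_add, C_mul, add_mul, Finset.sum_add_distrib]
  congr 1
  · rw [Finset.sum_range_succ', Finset.mul_sum]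
    simp only [coeff_X_mul, coeff_X_mul_zero, C_0, mul_zero, zero_mul, add_zero]
    refine Finset.sum_congr rfl fun j _ => ?_
    rw [Nat.add_sub_add_right]
    ring
  · rw [Finset.sum_range_succ, coeff_eq_zero_of_natDegree_lt (by omega : p.natDegree < n + 1),
      Finset.mul_sum]
    simp only [C_0, mul_zero, zero_mul, add_zero]
    refine Finset.sum_congr rfl fun j hj => ?_
    rw [Nat.sub_add_comm (Nat.lt_succ_iff.mp (Finset.mem_range.mp hj))]
    ring

private theorem sum_coeff_rowPoly_pow_mul (M : Matrix (Fin 2) (Fin 2) ℂ) (Z W : ℂ[X]) (i m : ℕ) :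
    ∑ j ∈ Finset.range (i + m + 1),
        C ((rowPoly M 0 ^ i * rowPoly M 1 ^ m).coeff j) * (Z ^ j * W ^ (i + m - j)) =
      (C (M 0 0) * Z + C (M 0 1) * W) ^ i * (C (M 1 0) * Z + C (M 1 1) * W) ^ m := by
  induction i with
  | zero =>
    induction m with
    | zero => simp
    | succ m ih =>
      have h := natDegree_rowPoly_pow_mul_le M 0 m
      rw [pow_zero, one_mul] at ih h ⊢
      have := sum_coeff_linear_mul (M 1 0) (M 1 1) h Z W
      rw [ih] at this
      rw [pow_succ' (rowPoly M 1), pow_succ' (_ + _), pow_zero, one_mul]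
      rw [pow_zero, one_mul] at this
      exact this
  | succ i ih =>
    have := sum_coeff_linear_mul (M 0 0) (M 0 1) (natDegree_rowPoly_pow_mul_le M i m) Z W
    rw [ih] at this
    rw [pow_succ' (rowPoly M 0), pow_succ' (C (M 0 0) * Z + _), mul_assoc, mul_assoc,
      show i + 1 + m = i + m + 1 by omega]
    exact this

private theorem symPower_mul (k : ℕ) (M N : Matrix (Fin 2) (Fin 2) ℂ) :
    symPower k (M * N) = symPower k M * symPower k N := by
  ext i l
  have hi : (i : ℕ) + (k - i) = k := by omega
  have h := sum_coeff_rowPoly_pow_mul M (rowPoly N 0) (rowPoly N 1) i (k - i)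
  have hrow : ∀ r, C (M r 0) * rowPoly N 0 + C (M r 1) * rowPoly N 1 = rowPoly (M * N) r := by
    intro r
    simp only [rowPoly, Matrix.mul_apply, Fin.sum_univ_two, C_add, C_mul]
    ring
  rw [hrow, hrow, hi] at h
  rw [Matrix.mul_apply]
  simp only [symPower, Matrix.of_apply]
  rw [← h, finsetSum_coeff, Finset.sum_range]
  simp only [coeff_C_mul]

private theorem coeff_coeff_swap (p : ℂ[X][X]) (i j : ℕ) :
    ((Bivariate.swap p).coeff i).coeff j = (p.coeff j).coeff i := by
  induction p using Polynomial.induction_on' with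
  | add p q hp hq => simp [hp, hq]
  | monomial n f =>
    induction f using Polynomial.induction_on' with
    | add p q hp hq => simp only [map_add, coeff_add, hp, hq]
    | monomial m r =>
      rw [Bivariate.swap_monomial_monomial]
      simp only [coeff_monomial]
      split_ifs <;> simp_all [coeff_monomial]

private theorem coeff_linear_pow (f g : ℂ[X]) (k i : ℕ) (hi : i ≤ k) :
    ((X * C f + C g : ℂ[X][X]) ^ k).coeff i = (f ^ i * g ^ (k - i)) * (k.choose i : ℂ[X]) := by
  rw [add_pow, finsetSum_coeff, Finset.sum_eq_single i]
  · rw [mul_pow, ← C_pow, ← C_pow, ← C_eq_natCast, mul_assoc, mul_assoc, ← C_mul, ← C_mul,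
      mul_comm, coeff_C_mul_X_pow]
    simp [mul_assoc]
  · intro j _ hj
    rw [mul_pow, ← C_pow, ← C_pow, ← C_eq_natCast, mul_assoc, mul_assoc, ← C_mul, ← C_mul,
      mul_comm, coeff_C_mul_X_pow, if_neg (Ne.symm hj)]
  · intro h
    exact absurd (Finset.mem_range.mpr (by omega)) h

private theorem choose_mul_symPower_transpose (k : ℕ) (M : Matrix (Fin 2) (Fin 2) ℂ)
    (i j : Fin (k + 1)) :
    (k.choose i : ℂ) * symPower k Mᵀ i j = k.choose j * symPower k M j i := by
  have key : ∀ (N : Matrix (Fin 2) (Fin 2) ℂ) (i j : Fin (k + 1)),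
      (k.choose i : ℂ) * symPower k N i j =
        (((X * C (rowPoly N 0) + C (rowPoly N 1) : ℂ[X][X]) ^ k).coeff i).coeff j := by
    intro N i j
    rw [coeff_linear_pow _ _ _ _ (by omega), ← C_eq_natCast, coeff_mul_C, mul_comm]
    rfl
  rw [key, key, ← coeff_coeff_swap, map_pow]
  congr 3
  simp only [rowPoly, Matrix.transpose_apply, map_add, map_mul, Bivariate.swap_X,
    Bivariate.swap_Y, Bivariate.swap_C_C]
  ring

private theorem symPower_map_conj (k : ℕ) (M : Matrix (Fin 2) (Fin 2) ℂ) (i j : Fin (k + 1)) :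
    symPower k (M.map (starRingEnd ℂ)) i j = starRingEnd ℂ (symPower k M i j) := by
  have h : ∀ r, rowPoly (M.map (starRingEnd ℂ)) r = (rowPoly M r).map (starRingEnd ℂ) := by
    intro r
    simp [rowPoly]
  simp only [symPower, Matrix.of_apply, h]
  rw [← Polynomial.map_pow, ← Polynomial.map_pow, ← Polynomial.map_mul, coeff_map]

private theorem symPower_conjTranspose (k : ℕ) (M : Matrix (Fin 2) (Fin 2) ℂ)
    (i j : Fin (k + 1)) :
    symPower k Mᴴ j i = (k.choose i / k.choose j : ℂ) * starRingEnd ℂ (symPower k M i j) := by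
  have hj : (k.choose j : ℂ) ≠ 0 := by exact_mod_cast (Nat.choose_pos (by omega)).ne'
  have h := choose_mul_symPower_transpose k (M.map (starRingEnd ℂ)) j i
  rw [symPower_map_conj] at h
  have hM : (M.map (starRingEnd ℂ))ᵀ = Mᴴ := rfl
  rw [hM] at h
  field_simp
  linear_combination h

private theorem symPower_one (k : ℕ) : symPower k 1 = 1 := by
  ext i j
  simp [symPower, rowPoly, Matrix.one_apply, coeff_X_pow, Fin.ext_iff, eq_comm]

/-- The complete homogeneous symmetric polynomials in `x` and `x⁻¹` are Chebyshev polynomials. -/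
private theorem sum_pow_mul_pow_eq_eval_U {x y t : ℂ} (hxy : x * y = 1) (ht : x + y = 2 * t)
    (k : ℕ) :
    ∑ i ∈ Finset.range (k + 1), x ^ i * y ^ (k - i) = (Chebyshev.U ℂ k).eval t := by
  have hstep : ∀ k : ℕ, ∑ i ∈ Finset.range (k + 2), x ^ i * y ^ (k + 1 - i) =
      x * ∑ i ∈ Finset.range (k + 1), x ^ i * y ^ (k - i) + y ^ (k + 1) := by
    intro k
    rw [Finset.sum_range_succ', Finset.mul_sum]
    simp only [Nat.add_sub_add_right, pow_zero, one_mul, Nat.sub_zero]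
    congr 1
    exact Finset.sum_congr rfl fun i _ => by ring
  induction k using Nat.twoStepInduction with
  | zero => simp
  | one =>
    simp [Finset.sum_range_succ]
    linear_combination ht
  | more k ih1 ih2 =>
    have h2 := hstep (k + 1)
    have h1 := hstep k
    push_cast at ih2 ⊢
    rw [Chebyshev.U_add_two, eval_sub, eval_mul, eval_mul, eval_X, ← ih1, ← ih2]
    simp only [eval_ofNat]
    rw [h2, h1, ← ht]
    linear_combination
      (-∑ i ∈ Finset.range (k + 1), x ^ i * y ^ (k - i)) * hxy

private theorem trace_symPower_of_lower_zero (k : ℕ) (M : Matrix (Fin 2) (Fin 2) ℂ)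
    (h : M 1 0 = 0) :
    (symPower k M).trace = ∑ i ∈ Finset.range (k + 1), M 0 0 ^ i * M 1 1 ^ (k - i) := by
  rw [Matrix.trace, Finset.sum_range]
  refine Finset.sum_congr rfl fun i _ => ?_
  have hdeg : (rowPoly M 0 ^ (i : ℕ)).coeff i = M 0 0 ^ (i : ℕ) := by
    have := coeff_pow_of_natDegree_le (m := i) (natDegree_rowPoly_le M 0)
    rw [mul_one] at this
    rw [this]
    simp [rowPoly]
  simp only [Matrix.diag_apply, symPower, Matrix.of_apply]
  rw [show rowPoly M 1 = C (M 1 1) by simp [rowPoly, h], ← C_pow, coeff_mul_C, hdeg]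

private theorem trace_symPower (k : ℕ) {M : Matrix (Fin 2) (Fin 2) ℂ} {t : ℂ} (hdet : M.det = 1)
    (htr : M.trace = 2 * t) : (symPower k M).trace = (Chebyshev.U ℂ k).eval t := by
  rw [Matrix.det_fin_two] at hdet
  rw [Matrix.trace_fin_two] at htr
  by_cases hc : M 1 0 = 0
  · rw [trace_symPower_of_lower_zero k M hc]
    exact sum_pow_mul_pow_eq_eval_U (by rw [hc] at hdet; linear_combination hdet) htr k
  obtain ⟨s, hs⟩ := IsAlgClosed.exists_pow_nat_eq (t ^ 2 - 1) (n := 2) (by norm_num)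
  set x := t + s with hx
  have hxx : x * x = 2 * t * x - 1 := by rw [hx]; linear_combination hs
  let P : Matrix (Fin 2) (Fin 2) ℂ := !![x - M 1 1, 1; M 1 0, 0]
  let Q : Matrix (Fin 2) (Fin 2) ℂ := !![0, (M 1 0)⁻¹; 1, -(x - M 1 1) * (M 1 0)⁻¹]
  let D : Matrix (Fin 2) (Fin 2) ℂ := !![x, 1; 0, 2 * t - x]
  have hPQ : P * Q = 1 := by
    ext i j
    fin_cases i <;> fin_cases j <;> simp [P, Q, Matrix.mul_apply, hc]
    ring
  have hQP : Q * P = 1 := mul_eq_one_comm.mp hPQ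
  have hMP : M * P = P * D := by
    ext i j
    fin_cases i <;> fin_cases j <;> simp [P, D, Matrix.mul_apply]
    · linear_combination x * htr - hdet - hxx
    · linear_combination htr
    · ring
  have hM : M = P * D * Q := by rw [← hMP, Matrix.mul_assoc, hPQ, Matrix.mul_one]
  have hD : (symPower k M).trace = (symPower k D).trace := by
    rw [hM, symPower_mul, symPower_mul, Matrix.trace_mul_comm, ← Matrix.mul_assoc, ← symPower_mul,
      hQP, symPower_one, Matrix.one_mul]
  rw [hD, trace_symPower_of_lower_zero k D rfl]
  refine sum_pow_mul_pow_eq_eval_U ?_ ?_ k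
  · simp only [D, Matrix.cons_val', Matrix.cons_val_zero, Matrix.cons_val_one, Matrix.of_apply]
    linear_combination -hxx
  · simp only [D, Matrix.cons_val', Matrix.cons_val_zero, Matrix.cons_val_one, Matrix.of_apply]
    ring

/-- The `2 × 2` complex matrix representing a quaternion. -/
private noncomputable def quatMatrix (x : EuclideanSpace ℝ (Fin 4)) : Matrix (Fin 2) (Fin 2) ℂ :=
  !![x 0 + x 1 * Complex.I, x 2 + x 3 * Complex.I;
    -(x 2 - x 3 * Complex.I), x 0 - x 1 * Complex.I]

private theorem det_quatMatrix (x : EuclideanSpace ℝ (Fin 4)) :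
    (quatMatrix x).det = ((‖x‖ ^ 2 : ℝ) : ℂ) := by
  rw [EuclideanSpace.real_norm_sq_eq, Matrix.det_fin_two]
  simp [quatMatrix, Fin.sum_univ_four]
  linear_combination (-(x 1 : ℂ) ^ 2 - (x 3 : ℂ) ^ 2) * Complex.I_sq

private theorem trace_quatMatrix_mul_conjTranspose (x y : EuclideanSpace ℝ (Fin 4)) :
    (quatMatrix x * (quatMatrix y)ᴴ).trace = 2 * ((inner ℝ x y : ℝ) : ℂ) := by
  rw [Matrix.trace_fin_two]
  simp [quatMatrix, Matrix.mul_apply, PiLp.inner_apply, Fin.sum_univ_four]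
  linear_combination (-2 * (x 1 : ℂ) * y 1 - 2 * (x 3 : ℂ) * y 3) * Complex.I_sq

private theorem eval_U_inner (k : ℕ) {x y : EuclideanSpace ℝ (Fin 4)} (hx : ‖x‖ = 1)
    (hy : ‖y‖ = 1) :
    (Chebyshev.U ℂ k).eval ((inner ℝ x y : ℝ) : ℂ) =
      (symPower k (quatMatrix x) * symPower k ((quatMatrix y)ᴴ)).trace := by
  rw [← symPower_mul, trace_symPower k _ (trace_quatMatrix_mul_conjTranspose x y)]
  rw [Matrix.det_mul, Matrix.det_conjTranspose, det_quatMatrix, det_quatMatrix, hx, hy]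
  simp

/-- Schoenberg's theorem on `S³`: the zonal kernels `U k ⟪x, y⟫` are positive definite. -/
private theorem sum_sum_eval_U_nonneg (k : ℕ) (T : Finset (EuclideanSpace ℝ (Fin 4)))
    (hT : ∀ x ∈ T, ‖x‖ = 1) :
    0 ≤ ∑ x ∈ T, ∑ y ∈ T, (Chebyshev.U ℝ k).eval (inner ℝ x y) := by
  have h : ((∑ x ∈ T, ∑ y ∈ T, (Chebyshev.U ℝ k).eval (inner ℝ x y) : ℝ) : ℂ) =
      ((∑ i : Fin (k + 1), ∑ j : Fin (k + 1), (k.choose i / k.choose j : ℝ) *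
        Complex.normSq (∑ x ∈ T, symPower k (quatMatrix x) i j) : ℝ) : ℂ) := by
    push_cast
    simp only [← Complex.mul_conj, map_sum, Finset.sum_mul_sum]
    simp only [Finset.mul_sum]
    rw [Finset.sum_congr rfl fun x hx => Finset.sum_congr rfl fun y hy =>
      eval_U_inner k (hT x hx) (hT y hy)]
    simp only [Matrix.trace, Matrix.diag_apply, Matrix.mul_apply, symPower_conjTranspose]
    rw [Finset.sum_congr rfl fun x _ => Finset.sum_comm, Finset.sum_comm]
    refine Finset.sum_congr rfl fun i _ => ?_
    rw [Finset.sum_congr rfl fun x _ => Finset.sum_comm, Finset.sum_comm]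
    refine Finset.sum_congr rfl fun j _ => Finset.sum_congr rfl fun x _ =>
      Finset.sum_congr rfl fun y _ => ?_
    ring
  rw [Complex.ofReal_inj.mp h]
  exact Finset.sum_nonneg fun i _ => Finset.sum_nonneg fun j _ =>
    mul_nonneg (by positivity) (Complex.normSq_nonneg _)

end SymmetricPower

private noncomputable def radialOne (u : ℝ) : ℝ :=
  (-1227 / 2000) + (3301 / 2500) * (5 * u + 4) + (-2571 / 2500) * (5 * u + 4) ^ 2 +
    (289 / 1000) * (5 * u + 4) ^ 3

private noncomputable def radialTwo (u : ℝ) : ℝ :=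
  (259 / 10000) + (-71 / 1250) * (5 * u + 4) + (-1261 / 10000) * (5 * u + 4) ^ 2 +
    (251 / 2000) * (5 * u + 4) ^ 3

private noncomputable def linearOne (u : ℝ) : ℝ :=
  (-1627 / 1000) + (20501 / 10000) * (5 * u + 4) + (-1771 / 2500) * (5 * u + 4) ^ 2

private noncomputable def linearTwo (u : ℝ) : ℝ :=
  (41 / 1000) + (-57 / 5000) * (5 * u + 4) + (569 / 5000) * (5 * u + 4) ^ 2

private noncomputable def quadFactor (u : ℝ) : ℝ :=
  (7181 / 10000) + (-3427 / 10000) * (5 * u + 4)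

/-- A kernel on the spherical cap around a point `z`, positive semidefinite in `x` and `y`, where
`u = ⟪x, z⟫`, `v = ⟪y, z⟫` and `t = ⟪x, y⟫`. -/
private noncomputable def localKernel (u v t : ℝ) : ℝ :=
  radialOne u * radialOne v + radialTwo u * radialTwo v +
    (linearOne u * linearOne v + linearTwo u * linearTwo v) * (t - u * v) +
    quadFactor u * quadFactor v * ((3 * (t - u * v) ^ 2 - (1 - u ^ 2) * (1 - v ^ 2)) / 2)

/-- A polynomial with nonnegative coefficients in the Chebyshev basis of the second kind. -/
private noncomputable def zonalPoly (u : ℝ) : ℝ :=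
    (-89 / 5000) + (-293 / 625) * u + (-5053 / 1250) * u ^ 2 + (-5769 / 625) * u ^ 3 +
    (10142 / 625) * u ^ 4 + (42042 / 625) * u ^ 5 + (-64064 / 625) * u ^ 7 +
    (32032 / 625) * u ^ 9

/-- `localKernel u v (1 / 2)` in terms of `a = u + v` and `q = (u - v) ^ 2`. -/
private noncomputable def kernelAtHalf (a q : ℝ) : ℝ :=
    (73393444207 / 800000000) + (-531786008943 / 3200000000) * q +
    (320292688633 / 3200000000) * q ^ 2 + (-2464622477 / 128000000) * q ^ 3 +
    (13593120943 / 32000000) * a + (-3276853369 / 6400000) * a * q +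
    (24124792027 / 160000000) * a * q ^ 2 + (2626881139807 / 3200000000) * a ^ 2 +
    (-943891645483 / 1600000000) * a ^ 2 * q + (7393867431 / 128000000) * a ^ 2 * q ^ 2 +
    (135383753341 / 160000000) * a ^ 3 + (-24124792027 / 80000000) * a ^ 3 * q +
    (1567490602333 / 3200000000) * a ^ 4 + (-7393867431 / 128000000) * a ^ 4 * q +
    (24124792027 / 160000000) * a ^ 5 + (2464622477 / 128000000) * a ^ 6

/-- `localKernel u v ((u + v) ^ 2 / 2 - 1)` in terms of `a = u + v` and `q = (u - v) ^ 2`. -/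
private noncomputable def kernelAtLower (a q : ℝ) : ℝ :=
    (1065450391 / 20000000) + (-10436759391 / 100000000) * q +
    (113206862579 / 1600000000) * q ^ 2 + (-2464622477 / 128000000) * q ^ 3 +
    (5692798087 / 20000000) * a + (-31068848843 / 80000000) * a * q +
    (24124792027 / 160000000) * a * q ^ 2 + (63720204959 / 100000000) * a ^ 2 +
    (-440829864867 / 800000000) * a ^ 2 * q + (2110739 / 31250) * a ^ 2 * q ^ 2 +
    (61436605607 / 80000000) * a ^ 3 + (-54844129567 / 160000000) * a ^ 3 * q +
    (840295996729 / 1600000000) * a ^ 4 + (-2483134861 / 32000000) * a ^ 4 * q +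
    (30786441627 / 160000000) * a ^ 5 + (3751574977 / 128000000) * a ^ 6

private theorem kernelAtHalf_nonpos_leftmost {a q : ℝ} (ha : -17321 / 10000 ≤ a) (ha' : a ≤ -8 / 5)
    (hq : 0 ≤ q) (hq' : q ≤ 4 / 25) : kernelAtHalf a q ≤ 0 := by
  have key : ∀ x x' y y' : ℝ, 0 ≤ x → 0 ≤ x' → 0 ≤ y → 0 ≤ y' → 0 ≤
      115513206896795226802373391683 * x' ^ 6 * y' ^ 3 +
      43077984122910809159023296175049 * x' ^ 6 * y * y' ^ 2 +
      45737031535964980861639472175049 * x' ^ 6 * y ^ 2 * y' +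
      12869654285742966929418549391683 * x' ^ 6 * y ^ 3 +
      9751161956360251540973288824000 * x * x' ^ 5 * y' ^ 3 +
      236515912517380078435704218472000 * x * x' ^ 5 * y * y' ^ 2 +
      224696395807185019144488570472000 * x * x' ^ 5 * y ^ 2 * y' +
      58502207240917192249757640824000 * x * x' ^ 5 * y ^ 3 +
      33681871387375705631002508000000 * x ^ 2 * x' ^ 4 * y' ^ 3 +
      518814894819793692546727700000000 * x ^ 2 * x' ^ 4 * y * y' ^ 2 +
      438957348957673253544447876000000 * x ^ 2 * x' ^ 4 * y ^ 2 * y' +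
      105250730512135266628722684000000 * x ^ 2 * x' ^ 4 * y ^ 3 +
      46962888088879085420192000000000 * x ^ 3 * x' ^ 3 * y' ^ 3 +
      589312800232093266044128000000000 * x ^ 3 * x' ^ 3 * y * y' ^ 2 +
      436601121920020012723680000000000 * x ^ 3 * x' ^ 3 * y ^ 2 * y' +
      96153083092645832099744000000000 * x ^ 3 * x' ^ 3 * y ^ 3 +
      32606825989569212048000000000000 * x ^ 4 * x' ^ 2 * y' ^ 3 +
      368490049975563106608000000000000 * x ^ 4 * x' ^ 2 * y * y' ^ 2 +
      231779661021102821296000000000000 * x ^ 4 * x' ^ 2 * y ^ 2 * y' +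
      47322842021988926736000000000000 * x ^ 4 * x' ^ 2 * y ^ 3 +
      11243733996817280000000000000000 * x ^ 5 * x' * y' ^ 3 +
      120951594510286976000000000000000 * x ^ 5 * x' * y * y' ^ 2 +
      61287536118404736000000000000000 * x ^ 5 * x' * y ^ 2 * y' +
      12150237599687040000000000000000 * x ^ 5 * x' * y ^ 3 +
      1540476594432000000000000000000 * x ^ 6 * y' ^ 3 +
      16358087750144000000000000000000 * x ^ 6 * y * y' ^ 2 +
      6071721739520000000000000000000 * x ^ 6 * y ^ 2 * y' +
      1349204249600000000000000000000 * x ^ 6 * y ^ 3 := by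
    intros; positivity
  have := key (a + 17321 / 10000) (-8 / 5 - a) (q - 0) (4 / 25 - q)
    (by linarith) (by linarith) (by linarith) (by linarith)
  unfold kernelAtHalf
  linear_combination (1 / 2786036637696054484533248) * this

private theorem kernelAtHalf_nonpos_left_lower {a q : ℝ} (ha : -8 / 5 ≤ a) (ha' : a ≤ -3 / 2)
    (hq : 0 ≤ q) (hq' : q ≤ 111 / 1000) : kernelAtHalf a q ≤ 0 := by
  have key : ∀ x x' y y' : ℝ, 0 ≤ x → 0 ≤ x' → 0 ≤ y → 0 ≤ y' → 0 ≤
      1540476594432000 * x' ^ 6 * y' ^ 3 + 12763736247796800 * x' ^ 6 * y * y' ^ 2 +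
      10306602148765080 * x' ^ 6 * y ^ 2 * y' + 2454036598242267 * x' ^ 6 * y ^ 3 +
      7728193078912000 * x * x' ^ 5 * y' ^ 3 + 63215323002067200 * x * x' ^ 5 * y * y' ^ 2 +
      45022047378582240 * x * x' ^ 5 * y ^ 2 * y' + 9759082072478962 * x * x' ^ 5 * y ^ 3 +
      15244599733008000 * x ^ 2 * x' ^ 4 * y' ^ 3 +
      127973954256866400 * x ^ 2 * x' ^ 4 * y * y' ^ 2 +
      77174622417442290 * x ^ 2 * x' ^ 4 * y ^ 2 * y' +
      15005679436213695 * x ^ 2 * x' ^ 4 * y ^ 3 + 15302724158880000 * x ^ 3 * x' ^ 3 * y' ^ 3 +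
      136439443985726400 * x ^ 3 * x' ^ 3 * y * y' ^ 2 +
      65064150523257960 * x ^ 3 * x' ^ 3 * y ^ 2 * y' +
      11341312753251300 * x ^ 3 * x' ^ 3 * y ^ 3 + 8321110127500000 * x ^ 4 * x' ^ 2 * y' ^ 3 +
      81371127176988900 * x ^ 4 * x' ^ 2 * y * y' ^ 2 +
      27047565005238540 * x ^ 4 * x' ^ 2 * y ^ 2 * y' +
      4557959498379445 * x ^ 4 * x' ^ 2 * y ^ 3 + 2357946304000000 * x ^ 5 * x' * y' ^ 3 +
      25956358165437000 * x ^ 5 * x' * y * y' ^ 2 + 4461360374879640 * x ^ 5 * x' * y ^ 2 * y' +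
      1087113130494562 * x ^ 5 * x' * y ^ 3 + 280212464375000 * x ^ 6 * y' ^ 3 +
      3494913604147500 * x ^ 6 * y * y' ^ 2 + 11374837842930 * x ^ 6 * y ^ 2 * y' +
      167367800912417 * x ^ 6 * y ^ 3 := by
    intros; positivity
  have := key (a + 8 / 5) (-3 / 2 - a) (q - 0) (111 / 1000 - q)
    (by linarith) (by linarith) (by linarith) (by linarith)
  unfold kernelAtHalf
  linear_combination (1 / 175056768) * this

private theorem kernelAtHalf_nonpos_left_upper {a q : ℝ} (ha : -8 / 5 ≤ a) (ha' : a ≤ -3 / 2)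
    (hq : 111 / 1000 ≤ q) (hq' : q ≤ 97 / 500) : kernelAtHalf a q ≤ 0 := by
  have key : ∀ x x' y y' : ℝ, 0 ≤ x → 0 ≤ x' → 0 ≤ y → 0 ≤ y' → 0 ≤
      2454036598242267 * x' ^ 6 * y' ^ 3 + 5160372268734214 * x' ^ 6 * y * y' ^ 2 +
      2686139732698596 * x' ^ 6 * y ^ 2 * y' + 1389043154463048 * x' ^ 6 * y ^ 3 +
      9759082072478962 * x * x' ^ 5 * y' ^ 3 + 17504106610454324 * x * x' ^ 5 * y * y' ^ 2 +
      7099974435584216 * x * x' ^ 5 * y ^ 2 * y' + 7810384451147248 * x * x' ^ 5 * y ^ 3 +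
      15005679436213695 * x ^ 2 * x' ^ 4 * y' ^ 3 +
      20971277218276220 * x ^ 2 * x' ^ 4 * y * y' ^ 2 +
      7348614911797500 * x ^ 2 * x' ^ 4 * y ^ 2 * y' +
      22521603513580960 * x ^ 2 * x' ^ 4 * y ^ 3 + 11341312753251300 * x ^ 3 * x' ^ 3 * y' ^ 3 +
      10813689450106720 * x ^ 3 * x' ^ 3 * y * y' ^ 2 +
      10155861254018960 * x ^ 3 * x' ^ 3 * y ^ 2 * y' +
      38868266402291520 * x ^ 3 * x' ^ 3 * y ^ 3 + 4557959498379445 * x ^ 4 * x' ^ 2 * y' ^ 3 +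
      3673734528126470 * x ^ 4 * x' ^ 2 * y * y' ^ 2 +
      16569759170246000 * x ^ 4 * x' ^ 2 * y ^ 2 * y' +
      38592570524344960 * x ^ 4 * x' ^ 2 * y ^ 3 + 1087113130494562 * x ^ 5 * x' * y' ^ 3 +
      2364026403899324 * x ^ 5 * x' * y * y' ^ 2 + 12814176708623616 * x ^ 5 * x' * y ^ 2 * y' +
      19992697988757248 * x ^ 5 * x' * y ^ 3 + 167367800912417 * x ^ 6 * y' ^ 3 +
      869044581892464 * x ^ 6 * y * y' ^ 2 + 3458104716053696 * x ^ 6 * y ^ 2 * y' +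
      4165667027330048 * x ^ 6 * y ^ 3 := by
    intros; positivity
  have := key (a + 8 / 5) (-3 / 2 - a) (q - 111 / 1000) (97 / 500 - q)
    (by linarith) (by linarith) (by linarith) (by linarith)
  unfold kernelAtHalf
  linear_combination (1 / 73188736) * this

private theorem kernelAtHalf_nonpos_middle_lower {a q : ℝ} (ha : -3 / 2 ≤ a) (ha' : a ≤ -137 / 100)
    (hq : 0 ≤ q) (hq' : q ≤ 39 / 500) : kernelAtHalf a q ≤ 0 := by
  have key : ∀ x x' y y' : ℝ, 0 ≤ x → 0 ≤ x' → 0 ≤ y → 0 ≤ y' → 0 ≤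
      280212464375000000 * x' ^ 6 * y' ^ 3 + 2705804460330000000 * x' ^ 6 * y * y' ^ 2 +
      1540173189570720000 * x' ^ 6 * y ^ 2 * y' + 284172719321024000 * x' ^ 6 * y ^ 3 +
      801601813175000000 * x * x' ^ 5 * y' ^ 3 + 10894674459760200000 * x * x' ^ 5 * y * y' ^ 2 +
      3479001929793408000 * x * x' ^ 5 * y ^ 2 * y' + 403478437440032000 * x * x' ^ 5 * y ^ 3 +
      1046237918831250000 * x ^ 2 * x' ^ 4 * y' ^ 3 +
      19759270737558618000 * x ^ 2 * x' ^ 4 * y * y' ^ 2 +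
      1553860545369278400 * x ^ 2 * x' ^ 4 * y ^ 2 * y' +
      384700612221470400 * x ^ 2 * x' ^ 4 * y ^ 3 +
      1787469040243140000 * x ^ 3 * x' ^ 3 * y' ^ 3 +
      23261611846450627200 * x ^ 3 * x' ^ 3 * y * y' ^ 2 +
      296396621889324000 * x ^ 3 * x' ^ 3 * y ^ 2 * y' +
      2214084329787916800 * x ^ 3 * x' ^ 3 * y ^ 3 +
      2574534375673627300 * x ^ 4 * x' ^ 2 * y' ^ 3 +
      18783777085275792480 * x ^ 4 * x' ^ 2 * y * y' ^ 2 +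
      2613053799652697460 * x ^ 4 * x' ^ 2 * y ^ 2 * y' +
      3947683975630092280 * x ^ 4 * x' ^ 2 * y ^ 3 + 1751877079848846620 * x ^ 5 * x' * y' ^ 3 +
      8902250205206211420 * x ^ 5 * x' * y * y' ^ 2 +
      2719383564164852580 * x ^ 5 * x' * y ^ 2 * y' + 2586559593039311780 * x ^ 5 * x' * y ^ 3 +
      428066912433523427 * x ^ 6 * y' ^ 3 + 1773995442391870461 * x ^ 6 * y * y' ^ 2 +
      752005795394131041 * x ^ 6 * y ^ 2 * y' + 575668791141088007 * x ^ 6 * y ^ 3 := by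
    intros; positivity
  have := key (a + 3 / 2) (-137 / 100 - a) (q - 0) (39 / 500 - q)
    (by linarith) (by linarith) (by linarith) (by linarith)
  unfold kernelAtHalf
  linear_combination (125 / 36649149833088) * this

private theorem kernelAtHalf_nonpos_middle_upper {a q : ℝ} (ha : -3 / 2 ≤ a) (ha' : a ≤ -137 / 100)
    (hq : 39 / 500 ≤ q) (hq' : q ≤ 29 / 250) : kernelAtHalf a q ≤ 0 := by
  have key : ∀ x x' y y' : ℝ, 0 ≤ x → 0 ≤ x' → 0 ≤ y → 0 ≤ y' → 0 ≤
      284172719321024000 * x' ^ 6 * y' ^ 3 + 517506732308064000 * x' ^ 6 * y * y' ^ 2 +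
      295940028765968000 * x' ^ 6 * y ^ 2 * y' + 197844780336872000 * x' ^ 6 * y ^ 3 +
      403478437440032000 * x * x' ^ 5 * y' ^ 3 + 105236190986944000 * x * x' ^ 5 * y * y' ^ 2 +
      221671017326472000 * x * x' ^ 5 * y ^ 2 * y' + 1331345851127224000 * x * x' ^ 5 * y ^ 3 +
      384700612221470400 * x ^ 2 * x' ^ 4 * y' ^ 3 +
      959347593962040000 * x ^ 2 * x' ^ 4 * y * y' ^ 2 +
      4990655274690237200 * x ^ 2 * x' ^ 4 * y ^ 2 * y' +
      6444589761318827600 * x ^ 2 * x' ^ 4 * y ^ 3 +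
      2214084329787916800 * x ^ 3 * x' ^ 3 * y' ^ 3 +
      9733824040184624800 * x ^ 3 * x' ^ 3 * y * y' ^ 2 +
      19782197750259212800 * x ^ 3 * x' ^ 3 * y ^ 2 * y' +
      14967233331021384800 * x ^ 3 * x' ^ 3 * y ^ 3 +
      3947683975630092280 * x ^ 4 * x' ^ 2 * y' ^ 3 +
      16339717681185507820 * x ^ 4 * x' ^ 2 * y * y' ^ 2 +
      26865088517691589200 * x ^ 4 * x' ^ 2 * y ^ 2 * y' +
      16501636280505333660 * x ^ 4 * x' ^ 2 * y ^ 3 + 2586559593039311780 * x ^ 5 * x' * y' ^ 3 +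
      10215207217172001300 * x ^ 5 * x' * y * y' ^ 2 +
      15334484129922972860 * x ^ 5 * x' * y ^ 2 * y' + 8517269093137947340 * x ^ 5 * x' * y ^ 3 +
      575668791141088007 * x ^ 6 * y' ^ 3 + 2202006655027200601 * x ^ 6 * y * y' ^ 2 +
      3150980290500105581 * x ^ 6 * y ^ 2 * y' + 1659881191171936987 * x ^ 6 * y ^ 3 := by
    intros; positivity
  have := key (a + 3 / 2) (-137 / 100 - a) (q - 39 / 500) (29 / 250 - q)
    (by linarith) (by linarith) (by linarith) (by linarith)
  unfold kernelAtHalf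
  linear_combination (125 / 4237706615168) * this

private theorem kernelAtHalf_nonpos_right {a q : ℝ} (ha : -137 / 100 ≤ a) (ha' : a ≤ -29 / 25)
    (hq : 0 ≤ q) (hq' : q ≤ 9 / 200) : kernelAtHalf a q ≤ 0 := by
  have key : ∀ x x' y y' : ℝ, 0 ≤ x → 0 ≤ x' → 0 ≤ y → 0 ≤ y' → 0 ≤
      428066912433523427 * x' ^ 6 * y' ^ 3 + 1566774605622474231 * x' ^ 6 * y * y' ^ 2 +
      1346165812376280681 * x' ^ 6 * y ^ 2 * y' + 432046842403954877 * x' ^ 6 * y ^ 3 +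
      3887402419970230776 * x * x' ^ 5 * y' ^ 3 +
      12697967092444958628 * x * x' ^ 5 * y * y' ^ 2 +
      11122600130574974928 * x * x' ^ 5 * y ^ 2 * y' + 3659567797399997076 * x * x' ^ 5 * y ^ 3 +
      13632241101828304320 * x ^ 2 * x' ^ 4 * y' ^ 3 +
      42098864388103938510 * x ^ 2 * x' ^ 4 * y * y' ^ 2 +
      37132820575966299060 * x ^ 2 * x' ^ 4 * y ^ 2 * y' +
      12035028137940039870 * x ^ 2 * x' ^ 4 * y ^ 3 +
      22333036666066382080 * x ^ 3 * x' ^ 3 * y' ^ 3 +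
      66301933786762167840 * x ^ 3 * x' ^ 3 * y * y' ^ 2 +
      56979632708979079440 * x ^ 3 * x' ^ 3 * y ^ 2 * y' +
      17502510052615793680 * x ^ 3 * x' ^ 3 * y ^ 3 +
      17885229582718049280 * x ^ 4 * x' ^ 2 * y' ^ 3 +
      51117388947974903040 * x ^ 4 * x' ^ 2 * y * y' ^ 2 +
      41149295896776280740 * x ^ 4 * x' ^ 2 * y ^ 2 * y' +
      11285967379768801980 * x ^ 4 * x' ^ 2 * y ^ 3 + 6823516544974319616 * x ^ 5 * x' * y' ^ 3 +
      18810687046611598848 * x ^ 5 * x' * y * y' ^ 2 +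
      13530410978885818848 * x ^ 5 * x' * y ^ 2 * y' + 2890772816548289616 * x ^ 5 * x' * y ^ 3 +
      887036924449353728 * x ^ 6 * y' ^ 3 + 2393416655372304384 * x ^ 6 * y * y' ^ 2 +
      1370218204575907584 * x ^ 6 * y ^ 2 * y' + 88427196869581928 * x ^ 6 * y ^ 3 := by
    intros; positivity
  have := key (a + 137 / 100) (-29 / 25 - a) (q - 0) (9 / 200 - q)
    (by linarith) (by linarith) (by linarith) (by linarith)
  unfold kernelAtHalf
  linear_combination (1 / 1000376035344) * this

private theorem kernelAtLower_nonpos_left {a q : ℝ} (ha : -17321 / 10000 ≤ a) (ha' : a ≤ -29 / 20)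
    (hq : 0 ≤ q) (hq' : q ≤ 3 / 10) : kernelAtLower a q ≤ 0 := by
  have key : ∀ x x' y y' : ℝ, 0 ≤ x → 0 ≤ x' → 0 ≤ y → 0 ≤ y' → 0 ≤
      59284695838957889310819439183 * x' ^ 6 * y' ^ 3 +
      80356364856860713391293378317549 * x' ^ 6 * y * y' ^ 2 +
      19636157112605519514654298317549 * x' ^ 6 * y ^ 2 * y' +
      5883883830583764012671739439183 * x' ^ 6 * y ^ 3 +
      342242142003799266691028826217000 * x * x' ^ 5 * y' ^ 3 +
      983863710080195131493088318651000 * x * x' ^ 5 * y * y' ^ 2 +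
      366006830985072328513090158651000 * x * x' ^ 5 * y ^ 2 * y' +
      123654104182676463711030666217000 * x * x' ^ 5 * y ^ 3 +
      1112613027043119689914480554250000 * x ^ 2 * x' ^ 4 * y' ^ 3 +
      2430307386698896362673362582750000 * x ^ 2 * x' ^ 4 * y * y' ^ 2 +
      699363912320343454003283502750000 * x ^ 2 * x' ^ 4 * y ^ 2 * y' +
      379841655849566781244401474250000 * x ^ 2 * x' ^ 4 * y ^ 3 +
      1443316308824476626416691500000000 * x ^ 3 * x' ^ 3 * y' ^ 3 +
      2564042591327580149743354500000000 * x ^ 3 * x' ^ 3 * y * y' ^ 2 +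
      436456397756590285836634500000000 * x ^ 3 * x' ^ 3 * y ^ 2 * y' +
      646626252833486762509971500000000 * x ^ 3 * x' ^ 3 * y ^ 3 +
      931704930013219154551062500000000 * x ^ 4 * x' ^ 2 * y' ^ 3 +
      1330152086146623752913187500000000 * x ^ 4 * x' ^ 2 * y * y' ^ 2 +
      84159632731495008573187500000000 * x ^ 4 * x' ^ 2 * y ^ 2 * y' +
      683884579783090410211062500000000 * x ^ 4 * x' ^ 2 * y ^ 3 +
      298711956820893363562500000000000 * x ^ 5 * x' * y' ^ 3 +
      329187334664387410687500000000000 * x ^ 5 * x' * y * y' ^ 2 +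
      21150260042970730687500000000000 * x ^ 5 * x' * y ^ 2 * y' +
      389943723473476683562500000000000 * x ^ 5 * x' * y ^ 3 +
      38002424437377859375000000000000 * x ^ 6 * y' ^ 3 +
      30605573990941078125000000000000 * x ^ 6 * y * y' ^ 2 +
      14781562241348578125000000000000 * x ^ 6 * y ^ 2 * y' +
      88723219566785359375000000000000 * x ^ 6 * y ^ 3 := by
    intros; positivity
  have := key (a + 17321 / 10000) (-29 / 20 - a) (q - 0) (3 / 10 - q)
    (by linarith) (by linarith) (by linarith) (by linarith)
  unfold kernelAtLower
  linear_combination (1 / 1741775794029288332654976000) * this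

private theorem kernelAtLower_nonpos_right {a q : ℝ} (ha : -29 / 20 ≤ a) (ha' : a ≤ -29 / 25)
    (hq : 0 ≤ q) (hq' : q ≤ 9 / 100) : kernelAtLower a q ≤ 0 := by
  have key : ∀ x x' y y' : ℝ, 0 ≤ x → 0 ≤ x' → 0 ≤ y → 0 ≤ y' → 0 ≤
      38002424437377859375 * x' ^ 6 * y' ^ 3 + 88986763515775828125 * x' ^ 6 * y * y' ^ 2 +
      70048245600862078125 * x' ^ 6 * y ^ 2 * y' + 20860616308197109375 * x' ^ 6 * y ^ 3 +
      155337308208735075000 * x * x' ^ 5 * y' ^ 3 +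
      336409374776768325000 * x * x' ^ 5 * y * y' ^ 2 +
      256858069860079425000 * x * x' ^ 5 * y ^ 2 * y' +
      86566262006444175000 * x * x' ^ 5 * y ^ 3 +
      215296337510795870000 * x ^ 2 * x' ^ 4 * y' ^ 3 +
      410833573805161140000 * x ^ 2 * x' ^ 4 * y * y' ^ 2 +
      328915021237892430000 * x ^ 2 * x' ^ 4 * y ^ 2 * y' +
      160328431729522160000 * x ^ 2 * x' ^ 4 * y ^ 3 +
      129168133039642784000 * x ^ 3 * x' ^ 3 * y' ^ 3 +
      212752941301073256000 * x ^ 3 * x' ^ 3 * y * y' ^ 2 +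
      271676416424449200000 * x ^ 3 * x' ^ 3 * y ^ 2 * y' +
      224025803877678728000 * x ^ 3 * x' ^ 3 * y ^ 3 +
      29711750523383276800 * x ^ 4 * x' ^ 2 * y' ^ 3 +
      60818245718383200000 * x ^ 4 * x' ^ 2 * y * y' ^ 2 +
      223987292836383129600 * x ^ 4 * x' ^ 2 * y ^ 2 * y' +
      219831444427378206400 * x ^ 4 * x' ^ 2 * y ^ 3 + 860962844306667520 * x ^ 5 * x' * y' ^ 3 +
      27871185843084149760 * x ^ 5 * x' * y * y' ^ 2 +
      133890061533843336960 * x ^ 5 * x' * y ^ 2 * y' +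
      117660097249463854720 * x ^ 5 * x' * y ^ 3 + 124367334327881728 * x ^ 6 * y' ^ 3 +
      9700346021206646784 * x ^ 6 * y * y' ^ 2 + 32779415282835408384 * x ^ 6 * y ^ 2 * y' +
      25000146381689643328 * x ^ 6 * y ^ 3 := by
    intros; positivity
  have := key (a + 29 / 20) (-29 / 25 - a) (q - 0) (9 / 100 - q)
    (by linarith) (by linarith) (by linarith) (by linarith)
  unfold kernelAtLower
  linear_combination (1 / 55504153729152) * this

private theorem zonalPoly_nonpos_left {u : ℝ} (hu : -29 / 50 ≤ u) (hu' : u ≤ -8 / 25) :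
    zonalPoly u ≤ 0 := by
  have key : ∀ x x' : ℝ, 0 ≤ x → 0 ≤ x' → 0 ≤
      38718222252994 * x' ^ 9 + 11316519537156634 * x * x' ^ 8 +
      52853075495591494 * x ^ 2 * x' ^ 7 + 98393073534204294 * x ^ 3 * x' ^ 6 +
      92332237687947239 * x ^ 4 * x' ^ 5 + 44994105220152356 * x ^ 5 * x' ^ 4 +
      10124981727544516 * x ^ 6 * x' ^ 3 + 694864549063106 * x ^ 7 * x' ^ 2 +
      113740013326506 * x ^ 8 * x' + 53575202213986 * x ^ 9 := by
    intros; positivity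
  have := key (u + 29 / 50) (-8 / 25 - u) (by linarith) (by linarith)
  simp only [zonalPoly]
  linear_combination (32 / 6627812108125) * this

private theorem zonalPoly_nonpos_middle {u : ℝ} (hu : -8 / 25 ≤ u) (hu' : u ≤ -2 / 25) :
    zonalPoly u ≤ 0 := by
  have key : ∀ x x' : ℝ, 0 ≤ x → 0 ≤ x' → 0 ≤
      26787601106993 * x' ^ 9 + 411136166854953 * x * x' ^ 8 +
      3054812168331828 * x ^ 2 * x' ^ 7 + 10570475265927108 * x ^ 3 * x' ^ 6 +
      18636091940690478 * x ^ 4 * x' ^ 5 + 17435091479299182 * x ^ 5 * x' ^ 4 +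
      8321279676877572 * x ^ 6 * x' ^ 3 + 1685068091001972 * x ^ 7 * x' ^ 2 +
      84360348026217 * x ^ 8 * x' + 18978261883697 * x ^ 9 := by
    intros; positivity
  have := key (u + 8 / 25) (-2 / 25 - u) (by linarith) (by linarith)
  simp only [zonalPoly]
  linear_combination (1 / 50388480000) * this

private theorem zonalPoly_nonpos_right {u : ℝ} (hu : -2 / 25 ≤ u) (hu' : u ≤ 1 / 2) :
    zonalPoly u ≤ 0 := by
  have key : ∀ x x' : ℝ, 0 ≤ x → 0 ≤ x' → 0 ≤
      37956523767394 * x' ^ 9 + 759421423720650 * x * x' ^ 8 +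
      24488821253626250 * x ^ 2 * x' ^ 7 + 229739228064250000 * x ^ 3 * x' ^ 6 +
      940180195896875000 * x ^ 4 * x' ^ 5 + 1928951469892578125 * x ^ 5 * x' ^ 4 +
      2010861417480468750 * x ^ 6 * x' ^ 3 + 985346618652343750 * x ^ 7 * x' ^ 2 +
      183788146972656250 * x ^ 8 * x' + 38146972656250 * x ^ 9 := by
    intros; positivity
  have := key (u + 2 / 25) (1 / 2 - u) (by linarith) (by linarith)
  simp only [zonalPoly]
  linear_combination (32 / 9066966234918125) * this

private theorem diagonal_nonpos_left {u : ℝ} (hu : -1 ≤ u) (hu' : u ≤ -87 / 100) :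
    zonalPoly u + 2 * (25409 / 10000) * radialOne u + localKernel u u 1 ≤ 0 := by
  have key : ∀ x x' : ℝ, 0 ≤ x → 0 ≤ x' → 0 ≤
      90971800000000000000 * x' ^ 9 + 412540159500000000000 * x * x' ^ 8 +
      737490537840000000000 * x ^ 2 * x' ^ 7 + 631650735577025000000 * x ^ 3 * x' ^ 6 +
      241003900630353875000 * x ^ 4 * x' ^ 5 + 43361467273656975000 * x ^ 5 * x' ^ 4 +
      59081046634917966875 * x ^ 6 * x' ^ 3 + 62147164413325880625 * x ^ 7 * x' ^ 2 +
      24570312522525515225 * x ^ 8 * x' + 3417391497141669603 * x ^ 9 := by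
    intros; positivity
  have := key (u + 1) (-87 / 100 - u) (by linarith) (by linarith)
  simp only [zonalPoly, localKernel, radialOne, radialTwo, linearOne, linearTwo, quadFactor]
  linear_combination (1 / 13255624216250) * this

private theorem diagonal_nonpos_middle {u : ℝ} (hu : -87 / 100 ≤ u) (hu' : u ≤ -69 / 100) :
    zonalPoly u + 2 * (25409 / 10000) * radialOne u + localKernel u u 1 ≤ 0 := by
  have key : ∀ x x' : ℝ, 0 ≤ x → 0 ≤ x' → 0 ≤
      1139130499047223201 * x' ^ 9 + 13107348776847860133 * x * x' ^ 8 +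
      56571760166621078784 * x ^ 2 * x' ^ 7 + 102598933524558418152 * x ^ 3 * x' ^ 6 +
      77634702482205782586 * x ^ 4 * x' ^ 5 + 13499538600268837482 * x ^ 5 * x' ^ 4 +
      1808001940637736456 * x ^ 6 * x' ^ 3 + 20498778002780664288 * x ^ 7 * x' ^ 2 +
      15780349376938351389 * x ^ 8 * x' + 3225109664468347177 * x ^ 9 := by
    intros; positivity
  have := key (u + 87 / 100) (-69 / 100 - u) (by linarith) (by linarith)
  simp only [zonalPoly, localKernel, radialOne, radialTwo, linearOne, linearTwo, quadFactor]
  linear_combination (1 / 82649704320000) * this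

private theorem diagonal_nonpos_right {u : ℝ} (hu : -69 / 100 ≤ u) (hu' : u ≤ -29 / 50) :
    zonalPoly u + 2 * (25409 / 10000) * radialOne u + localKernel u u 1 ≤ 0 := by
  have key : ∀ x x' : ℝ, 0 ≤ x → 0 ≤ x' → 0 ≤
      9675328993405041531 * x' ^ 9 + 111361629879986124653 * x * x' ^ 8 +
      554188154905865433009 * x ^ 2 * x' ^ 7 + 1553887583361152760947 * x ^ 3 * x' ^ 6 +
      2684036213807730736656 * x ^ 4 * x' ^ 5 + 2927612136719086468892 * x ^ 5 * x' ^ 4 +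
      1974082873341974658896 * x ^ 6 * x' ^ 3 + 756572640796255983888 * x ^ 7 * x' ^ 2 +
      128996161328228171904 * x ^ 8 * x' + 1544590561161827392 * x ^ 9 := by
    intros; positivity
  have := key (u + 69 / 100) (-29 / 50 - u) (by linarith) (by linarith)
  simp only [zonalPoly, localKernel, radialOne, radialTwo, linearOne, linearTwo, quadFactor]
  linear_combination (1 / 2947434613750) * this

private theorem localKernel_half (u v : ℝ) :
    localKernel u v (1 / 2) = kernelAtHalf (u + v) ((u - v) ^ 2) := by
  simp only [localKernel, radialOne, radialTwo, linearOne, linearTwo, quadFactor, kernelAtHalf]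
  ring

private theorem localKernel_lower (u v : ℝ) :
    localKernel u v ((u + v) ^ 2 / 2 - 1) = kernelAtLower (u + v) ((u - v) ^ 2) := by
  simp only [localKernel, radialOne, radialTwo, linearOne, linearTwo, quadFactor, kernelAtLower]
  ring

private theorem zonalPoly_eq (t : ℝ) :
    zonalPoly t = (Polynomial.Chebyshev.U ℝ (0 : ℕ)).eval t +
      9615 / 10000 * (Polynomial.Chebyshev.U ℝ (1 : ℕ)).eval t +
      2032 / 1000 * (Polynomial.Chebyshev.U ℝ (2 : ℕ)).eval t +
      8482 / 10000 * (Polynomial.Chebyshev.U ℝ (3 : ℕ)).eval t +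
      10142 / 10000 * (Polynomial.Chebyshev.U ℝ (4 : ℕ)).eval t +
      1001 / 10000 * (Polynomial.Chebyshev.U ℝ (9 : ℕ)).eval t := by
  have step (n : ℕ) : (Polynomial.Chebyshev.U ℝ ((n + 2 : ℕ) : ℤ)).eval t =
      2 * t * (Polynomial.Chebyshev.U ℝ ((n + 1 : ℕ) : ℤ)).eval t -
        (Polynomial.Chebyshev.U ℝ (n : ℤ)).eval t := by
    push_cast
    simp [Polynomial.Chebyshev.U_add_two]
  have u0 : (Polynomial.Chebyshev.U ℝ ((0 : ℕ) : ℤ)).eval t = 1 := by simp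
  have u1 : (Polynomial.Chebyshev.U ℝ ((1 : ℕ) : ℤ)).eval t = 2 * t := by simp
  rw [step 7, step 6, step 5, step 4, step 3, step 2, step 1, step 0, u0, u1, zonalPoly]
  ring

private theorem card_sq_le_sum_zonalPoly (T : Finset (EuclideanSpace ℝ (Fin 4)))
    (hT : ∀ x ∈ T, ‖x‖ = 1) :
    (T.card : ℝ) ^ 2 ≤ ∑ x ∈ T, ∑ y ∈ T, zonalPoly (inner ℝ x y) := by
  have h1 := sum_sum_eval_U_nonneg 1 T hT
  have h2 := sum_sum_eval_U_nonneg 2 T hT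
  have h3 := sum_sum_eval_U_nonneg 3 T hT
  have h4 := sum_sum_eval_U_nonneg 4 T hT
  have h9 := sum_sum_eval_U_nonneg 9 T hT
  have h0 : ∑ x ∈ T, ∑ y ∈ T, (Polynomial.Chebyshev.U ℝ (0 : ℕ)).eval (inner ℝ x y) =
      (T.card : ℝ) ^ 2 := by
    simp [sq]
  simp only [zonalPoly_eq, Finset.sum_add_distrib, ← Finset.mul_sum]
  rw [h0]
  have key : ∀ n a b c d e : ℝ, 0 ≤ a → 0 ≤ b → 0 ≤ c → 0 ≤ d → 0 ≤ e →
      n ≤ n + 9615 / 10000 * a + 2032 / 1000 * b + 8482 / 10000 * c + 10142 / 10000 * d +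
        1001 / 10000 * e := by
    intros
    linarith
  exact key _ _ _ _ _ _ h1 h2 h3 h4 h9

private theorem zonalPoly_nonpos {u : ℝ} (hu : -29 / 50 ≤ u) (hu' : u ≤ 1 / 2) :
    zonalPoly u ≤ 0 := by
  rcases le_total u (-8 / 25) with h | h
  · exact zonalPoly_nonpos_left hu h
  rcases le_total u (-2 / 25) with h' | h'
  · exact zonalPoly_nonpos_middle h h'
  · exact zonalPoly_nonpos_right h' hu'

private theorem diagonal_nonpos {u : ℝ} (hu : -1 ≤ u) (hu' : u ≤ -29 / 50) :
    zonalPoly u + 2 * (25409 / 10000) * radialOne u + localKernel u u 1 ≤ 0 := by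
  rcases le_total u (-87 / 100) with h | h
  · exact diagonal_nonpos_left hu h
  rcases le_total u (-69 / 100) with h' | h'
  · exact diagonal_nonpos_middle h h'
  · exact diagonal_nonpos_right h' hu'

private theorem kernelAtHalf_nonpos {a q : ℝ} (ha : -17321 / 10000 ≤ a) (ha' : a ≤ -29 / 25)
    (hq : 0 ≤ q) (h₁ : q ≤ (a + 2) ^ 2) (h₂ : q ≤ (a + 29 / 25) ^ 2) : kernelAtHalf a q ≤ 0 := by
  rcases le_total a (-8 / 5) with h | h
  · exact kernelAtHalf_nonpos_leftmost ha h hq (by nlinarith)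
  rcases le_total a (-3 / 2) with h' | h'
  · rcases le_total q (111 / 1000) with hq' | hq'
    · exact kernelAtHalf_nonpos_left_lower h h' hq hq'
    · exact kernelAtHalf_nonpos_left_upper h h' hq' (by nlinarith)
  rcases le_total a (-137 / 100) with h'' | h''
  · rcases le_total q (39 / 500) with hq' | hq'
    · exact kernelAtHalf_nonpos_middle_lower h' h'' hq hq'
    · exact kernelAtHalf_nonpos_middle_upper h' h'' hq' (by nlinarith)
  · exact kernelAtHalf_nonpos_right h'' ha' hq (by nlinarith)

private theorem kernelAtLower_nonpos {a q : ℝ} (ha : -17321 / 10000 ≤ a) (ha' : a ≤ -29 / 25)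
    (hq : 0 ≤ q) (h₁ : a ^ 2 + 3 * q ≤ 3) (h₂ : q ≤ (a + 29 / 25) ^ 2) : kernelAtLower a q ≤ 0 := by
  rcases le_total a (-29 / 20) with h | h
  · exact kernelAtLower_nonpos_left ha h hq (by nlinarith)
  · exact kernelAtLower_nonpos_right h ha' hq (by nlinarith)

/-- The kernel is convex in `t`, so it suffices to bound it at both ends of the range of `t`. -/
private theorem localKernel_nonpos {u v t : ℝ} (hu : -1 ≤ u) (hu' : u ≤ -29 / 50) (hv : -1 ≤ v)
    (hv' : v ≤ -29 / 50) (ht : t ≤ 1 / 2)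
    (hgram : (t - u * v) ^ 2 ≤ (1 - u ^ 2) * (1 - v ^ 2)) : localKernel u v t ≤ 0 := by
  have hell : u ^ 2 + v ^ 2 - u * v ≤ 3 / 4 := by
    rcases le_total (1 / 2) (u * v) with huv | huv
    · nlinarith
    · nlinarith
  have ha : -17321 / 10000 ≤ u + v := by nlinarith [sq_nonneg (u - v)]
  have hq : 0 ≤ (u - v) ^ 2 := sq_nonneg _
  have hq2 : (u - v) ^ 2 ≤ (u + v + 29 / 25) ^ 2 := by
    nlinarith [mul_nonneg (sub_nonneg.mpr hu') (sub_nonneg.mpr hv')]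
  have hhalf : localKernel u v (1 / 2) ≤ 0 := by
    rw [localKernel_half]
    refine kernelAtHalf_nonpos ha (by linarith) hq ?_ hq2
    nlinarith [mul_nonneg (sub_nonneg.mpr hu) (sub_nonneg.mpr hv)]
  have hlower : localKernel u v ((u + v) ^ 2 / 2 - 1) ≤ 0 := by
    rw [localKernel_lower]
    exact kernelAtLower_nonpos ha (by linarith) hq (by nlinarith) hq2
  have hl : (u + v) ^ 2 / 2 - 1 ≤ t := by
    have h1 : 0 ≤ 1 - u ^ 2 := by nlinarith
    have h2 : 0 ≤ 1 - v ^ 2 := by nlinarith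
    have := abs_le_of_sq_le_sq' (a := t - u * v) (b := ((1 - u ^ 2) + (1 - v ^ 2)) / 2)
      (by nlinarith [sq_nonneg ((1 - u ^ 2) - (1 - v ^ 2))]) (by linarith)
    nlinarith [this.1]
  have hQ : 0 < quadFactor u * quadFactor v := by
    unfold quadFactor
    apply mul_pos <;> linarith
  rcases hl.eq_or_lt with h | h
  · rwa [← h]
  set l := (u + v) ^ 2 / 2 - 1
  have hid : (1 / 2 - l) * localKernel u v t =
      (1 / 2 - t) * localKernel u v l + (t - l) * localKernel u v (1 / 2) -
        3 / 2 * (quadFactor u * quadFactor v) * ((t - l) * (1 / 2 - t) * (1 / 2 - l)) := by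
    simp only [localKernel]
    ring
  have h1 : 0 ≤ 1 / 2 - t := by linarith
  have h2 : 0 ≤ t - l := by linarith
  have h3 : 0 < 1 / 2 - l := by linarith
  have h4 : 0 ≤ 3 / 2 * (quadFactor u * quadFactor v) * ((t - l) * (1 / 2 - t) * (1 / 2 - l)) := by
    positivity
  have h5 := mul_nonneg h1 (neg_nonneg.mpr hlower)
  have h6 := mul_nonneg h2 (neg_nonneg.mpr hhalf)
  by_contra! hc
  nlinarith [mul_pos h3 hc]

/-- Quadratic zonal harmonics of the orthogonal complement of a line are positive definite. -/
private theorem sum_sum_quadratic_nonneg {ι : Type*} (A : Finset ι) (c : ι → ℝ)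
    (w : ι → EuclideanSpace ℝ (Fin 4)) {z : EuclideanSpace ℝ (Fin 4)} (hz : ‖z‖ = 1)
    (hw : ∀ i, inner ℝ (w i) z = 0) :
    0 ≤ ∑ i ∈ A, ∑ j ∈ A,
      c i * c j * (3 * inner ℝ (w i) (w j) ^ 2 - ‖w i‖ ^ 2 * ‖w j‖ ^ 2) := by
  let M : Fin 4 → Fin 4 → ℝ := fun p r => ∑ i ∈ A, c i * (w i p * w i r)
  let s : ℝ := ∑ i ∈ A, c i * ‖w i‖ ^ 2
  have hz' : ∑ p, z p ^ 2 = 1 := by rw [← EuclideanSpace.real_norm_sq_eq, hz, one_pow]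
  have hMz : ∑ p, ∑ r, M p r * (z p * z r) = 0 := by
    simp only [Fin.sum_univ_four, M, Finset.sum_mul, ← Finset.sum_add_distrib]
    refine Finset.sum_eq_zero fun i _ => ?_
    have h := hw i
    simp only [PiLp.inner_apply, RCLike.inner_apply, conj_trivial, Fin.sum_univ_four] at h
    linear_combination c i * (z 0 * w i 0 + z 1 * w i 1 + z 2 * w i 2 + z 3 * w i 3) * h
  have htr : ∑ p, M p p = s := by
    simp only [Fin.sum_univ_four, M, s, EuclideanSpace.real_norm_sq_eq, ← Finset.sum_add_distrib]
    exact Finset.sum_congr rfl fun i _ => by ring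
  have hM : ∑ p, ∑ r, M p r ^ 2 = ∑ i ∈ A, ∑ j ∈ A, c i * c j * inner ℝ (w i) (w j) ^ 2 := by
    simp only [Fin.sum_univ_four, M, sq (Finset.sum _ _), Finset.sum_mul_sum,
      ← Finset.sum_add_distrib, PiLp.inner_apply, RCLike.inner_apply, conj_trivial]
    exact Finset.sum_congr rfl fun i _ => Finset.sum_congr rfl fun j _ => by ring
  have hs : s ^ 2 = ∑ i ∈ A, ∑ j ∈ A, c i * c j * (‖w i‖ ^ 2 * ‖w j‖ ^ 2) := by
    rw [sq, Finset.sum_mul_sum]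
    exact Finset.sum_congr rfl fun i _ => Finset.sum_congr rfl fun j _ => by ring
  have hsq : 0 ≤ ∑ p, ∑ r, (M p r - s / 3 * ((if p = r then 1 else 0) - z p * z r)) ^ 2 :=
    Finset.sum_nonneg fun p _ => Finset.sum_nonneg fun r _ => sq_nonneg _
  have hexp : ∑ p, ∑ r, (M p r - s / 3 * ((if p = r then 1 else 0) - z p * z r)) ^ 2 =
      ∑ p, ∑ r, M p r ^ 2 - 2 * (s / 3) * (∑ p, M p p - ∑ p, ∑ r, M p r * (z p * z r)) +
        (s / 3) ^ 2 * (4 - 2 * ∑ p, z p ^ 2 + (∑ p, z p ^ 2) ^ 2) := by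
    simp [Fin.sum_univ_four]
    ring
  rw [hexp, hMz, htr, hz', hM] at hsq
  have : ∑ i ∈ A, ∑ j ∈ A, c i * c j * (3 * inner ℝ (w i) (w j) ^ 2 - ‖w i‖ ^ 2 * ‖w j‖ ^ 2) =
      3 * (∑ i ∈ A, ∑ j ∈ A, c i * c j * inner ℝ (w i) (w j) ^ 2) - s ^ 2 := by
    rw [hs]
    simp only [Finset.mul_sum, ← Finset.sum_sub_distrib]
    exact Finset.sum_congr rfl fun i _ => Finset.sum_congr rfl fun j _ => by ring
  rw [this]
  linarith

private theorem inner_sub_smul_self {z : EuclideanSpace ℝ (Fin 4)} (hz : ‖z‖ = 1)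
    (x : EuclideanSpace ℝ (Fin 4)) : inner ℝ (x - (inner ℝ x z : ℝ) • z) z = 0 := by
  rw [inner_sub_left, real_inner_smul_left, real_inner_self_eq_norm_sq, hz]
  ring

private theorem inner_sub_smul_inner_sub_smul {z : EuclideanSpace ℝ (Fin 4)} (hz : ‖z‖ = 1)
    (x y : EuclideanSpace ℝ (Fin 4)) :
    inner ℝ (x - (inner ℝ x z : ℝ) • z) (y - (inner ℝ y z : ℝ) • z) =
      (inner ℝ x y - inner ℝ x z * inner ℝ y z : ℝ) := by
  rw [inner_sub_right, real_inner_smul_right, inner_sub_smul_self hz, inner_sub_left,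
    real_inner_smul_left, real_inner_comm y z]
  ring

private theorem sum_localKernel_nonneg (A : Finset (EuclideanSpace ℝ (Fin 4)))
    {z : EuclideanSpace ℝ (Fin 4)} (hz : ‖z‖ = 1) (hA : ∀ x ∈ A, ‖x‖ = 1) (α : ℝ) :
    0 ≤ α ^ 2 + 2 * α * ∑ x ∈ A, radialOne (inner ℝ x z) +
      ∑ x ∈ A, ∑ y ∈ A, localKernel (inner ℝ x z) (inner ℝ y z) (inner ℝ x y) := by
  let w : EuclideanSpace ℝ (Fin 4) → EuclideanSpace ℝ (Fin 4) := fun x => x - (inner ℝ x z : ℝ) • z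
  have hww : ∀ x y, inner ℝ (w x) (w y) = (inner ℝ x y - inner ℝ x z * inner ℝ y z : ℝ) :=
    inner_sub_smul_inner_sub_smul hz
  have hnorm : ∀ x ∈ A, ‖w x‖ ^ 2 = 1 - (inner ℝ x z : ℝ) ^ 2 := by
    intro x hx
    rw [← real_inner_self_eq_norm_sq, hww, real_inner_self_eq_norm_sq, hA x hx]
    ring
  have hlin : ∀ g : ℝ → ℝ, 0 ≤ ∑ x ∈ A, ∑ y ∈ A,
      g (inner ℝ x z) * g (inner ℝ y z) * (inner ℝ x y - inner ℝ x z * inner ℝ y z) := by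
    intro g
    have := real_inner_self_nonneg (x := ∑ x ∈ A, g (inner ℝ x z) • w x)
    simp only [sum_inner, inner_sum, real_inner_smul_left, real_inner_smul_right, hww] at this
    refine this.trans_eq (Finset.sum_congr rfl fun x _ => Finset.sum_congr rfl fun y _ => ?_)
    rw [real_inner_comm x y]
    ring
  have hquad := sum_sum_quadratic_nonneg A (fun x => quadFactor (inner ℝ x z)) w hz
    (inner_sub_smul_self hz)
  have hquad' : ∑ x ∈ A, ∑ y ∈ A, quadFactor (inner ℝ x z) * quadFactor (inner ℝ y z) *
        (3 * inner ℝ (w x) (w y) ^ 2 - ‖w x‖ ^ 2 * ‖w y‖ ^ 2) =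
      ∑ x ∈ A, ∑ y ∈ A, quadFactor (inner ℝ x z) * quadFactor (inner ℝ y z) *
        (3 * (inner ℝ x y - inner ℝ x z * inner ℝ y z) ^ 2 -
          (1 - (inner ℝ x z) ^ 2) * (1 - (inner ℝ y z) ^ 2)) :=
    Finset.sum_congr rfl fun x hx => Finset.sum_congr rfl fun y hy => by
      rw [hww, hnorm x hx, hnorm y hy]
  rw [hquad'] at hquad
  have hexp : ∑ x ∈ A, ∑ y ∈ A, localKernel (inner ℝ x z) (inner ℝ y z) (inner ℝ x y) =
      (∑ x ∈ A, radialOne (inner ℝ x z)) ^ 2 + (∑ x ∈ A, radialTwo (inner ℝ x z)) ^ 2 +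
      ∑ x ∈ A, ∑ y ∈ A, linearOne (inner ℝ x z) * linearOne (inner ℝ y z) *
        (inner ℝ x y - inner ℝ x z * inner ℝ y z) +
      ∑ x ∈ A, ∑ y ∈ A, linearTwo (inner ℝ x z) * linearTwo (inner ℝ y z) *
        (inner ℝ x y - inner ℝ x z * inner ℝ y z) +
      1 / 2 * ∑ x ∈ A, ∑ y ∈ A, quadFactor (inner ℝ x z) * quadFactor (inner ℝ y z) *
        (3 * (inner ℝ x y - inner ℝ x z * inner ℝ y z) ^ 2 -
          (1 - (inner ℝ x z) ^ 2) * (1 - (inner ℝ y z) ^ 2)) := by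
    simp only [sq (Finset.sum _ _), Finset.sum_mul_sum]
    simp only [Finset.mul_sum, ← Finset.sum_add_distrib]
    refine Finset.sum_congr rfl fun x _ => Finset.sum_congr rfl fun y _ => ?_
    rw [localKernel]
    ring
  rw [hexp]
  nlinarith [hlin linearOne, hlin linearTwo, sq_nonneg (α + ∑ x ∈ A, radialOne (inner ℝ x z)),
    sq_nonneg (∑ x ∈ A, radialTwo (inner ℝ x z))]

private theorem sq_inner_sub_mul_inner_le {x y z : EuclideanSpace ℝ (Fin 4)} (hx : ‖x‖ = 1)
    (hy : ‖y‖ = 1) (hz : ‖z‖ = 1) :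
    (inner ℝ x y - inner ℝ x z * inner ℝ y z) ^ 2 ≤
      (1 - (inner ℝ x z : ℝ) ^ 2) * (1 - (inner ℝ y z) ^ 2) := by
  have hxy : ∀ p q : EuclideanSpace ℝ (Fin 4),
      inner ℝ (p - (inner ℝ p z : ℝ) • z) (q - (inner ℝ q z : ℝ) • z) =
        (inner ℝ p q - inner ℝ p z * inner ℝ q z : ℝ) :=
    inner_sub_smul_inner_sub_smul hz
  have h := real_inner_mul_inner_self_le (x - (inner ℝ x z : ℝ) • z) (y - (inner ℝ y z : ℝ) • z)
  simp only [hxy, real_inner_self_eq_norm_sq, hx, hy] at h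
  linarith

/-- The contribution of a single point `z` to the double sum of `zonalPoly`: the points far from
`-z` contribute nonpositively, and those close to `-z` are controlled by `localKernel`. -/
private theorem sum_zonalPoly_le {T : Finset (EuclideanSpace ℝ (Fin 4))} (hT : ∀ x ∈ T, ‖x‖ = 1)
    (hsep : ∀ x ∈ T, ∀ y ∈ T, x ≠ y → (inner ℝ x y : ℝ) ≤ 1 / 2)
    {z : EuclideanSpace ℝ (Fin 4)} (hz : z ∈ T) :
    ∑ x ∈ T, zonalPoly (inner ℝ x z) ≤ zonalPoly 1 + (25409 / 10000) ^ 2 := by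
  classical
  have hzz : inner ℝ z z = (1 : ℝ) := by rw [real_inner_self_eq_norm_sq, hT z hz, one_pow]
  set A := (T.erase z).filter fun x => (inner ℝ x z : ℝ) < -29 / 50 with hA
  have hAT : ∀ x ∈ A, x ∈ T := fun x hx => Finset.mem_of_mem_erase (Finset.mem_filter.mp hx).1
  have hAu : ∀ x ∈ A, (inner ℝ x z : ℝ) ≤ -29 / 50 := fun x hx => (Finset.mem_filter.mp hx).2.le
  have hAl : ∀ x ∈ A, -1 ≤ (inner ℝ x z : ℝ) := by
    intro x hx
    have := neg_le_of_abs_le (abs_real_inner_le_norm x z)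
    rwa [hT x (hAT x hx), hT z hz, mul_one] at this
  have hdiag : ∀ x ∈ A, ∑ y ∈ A, localKernel (inner ℝ x z) (inner ℝ y z) (inner ℝ x y) ≤
      localKernel (inner ℝ x z) (inner ℝ x z) 1 := by
    intro x hx
    rw [← Finset.add_sum_erase _ _ hx, real_inner_self_eq_norm_sq, hT x (hAT x hx), one_pow]
    refine add_le_of_nonpos_right (Finset.sum_nonpos fun y hy => ?_)
    have hyA := Finset.mem_of_mem_erase hy
    exact localKernel_nonpos (hAl x hx) (hAu x hx) (hAl y hyA) (hAu y hyA)
      (hsep x (hAT x hx) y (hAT y hyA) (Finset.ne_of_mem_erase hy).symm)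
      (sq_inner_sub_mul_inner_le (hT x (hAT x hx)) (hT y (hAT y hyA)) (hT z hz))
  have hnonneg := sum_localKernel_nonneg A (hT z hz) (fun x hx => hT x (hAT x hx)) (25409 / 10000)
  have hfar : ∑ x ∈ A, (zonalPoly (inner ℝ x z) + 2 * (25409 / 10000) * radialOne (inner ℝ x z) +
      localKernel (inner ℝ x z) (inner ℝ x z) 1) ≤ 0 :=
    Finset.sum_nonpos fun x hx => diagonal_nonpos (hAl x hx) (hAu x hx)
  rw [Finset.sum_add_distrib, Finset.sum_add_distrib, ← Finset.mul_sum] at hfar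
  have hnear : ∑ x ∈ T.erase z with ¬ (inner ℝ x z : ℝ) < -29 / 50,
      zonalPoly (inner ℝ x z) ≤ 0 := by
    refine Finset.sum_nonpos fun x hx => ?_
    obtain ⟨hx, hxz⟩ := Finset.mem_filter.mp hx
    exact zonalPoly_nonpos (not_lt.mp hxz)
      (hsep x (Finset.mem_of_mem_erase hx) z hz (Finset.ne_of_mem_erase hx))
  rw [← Finset.add_sum_erase _ _ hz, hzz,
    ← Finset.sum_filter_add_sum_filter_not (T.erase z) fun x => (inner ℝ x z : ℝ) < -29 / 50, ← hA]
  linarith [Finset.sum_le_sum hdiag]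

private theorem card_le_twentyfour_of_unit {T : Finset (EuclideanSpace ℝ (Fin 4))}
    (hT : ∀ x ∈ T, ‖x‖ = 1)
    (hsep : ∀ x ∈ T, ∀ y ∈ T, x ≠ y → (inner ℝ x y : ℝ) ≤ 1 / 2) : T.card ≤ 24 := by
  have h1 := card_sq_le_sum_zonalPoly T hT
  rw [Finset.sum_comm] at h1
  have h2 := Finset.sum_le_sum fun z hz => sum_zonalPoly_le hT hsep hz
  rw [Finset.sum_const, nsmul_eq_mul] at h2
  by_contra! h
  have h25 : (25 : ℝ) ≤ T.card := by exact_mod_cast h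
  have hval : zonalPoly 1 + (25409 / 10000) ^ 2 < 25 := by
    norm_num [zonalPoly]
  nlinarith

theorem card_le_twentyfour_of_pairwise_angle_gt_sixty
    (S : Set (EuclideanSpace ℝ (Fin 4))) (hfin : S.Finite)
    (h0 : ∀ a ∈ S, a ≠ 0)
    (h : ∀ a ∈ S, ∀ b ∈ S, a ≠ b → ⟪a, b⟫ < (1 / 2) * ‖a‖ * ‖b‖) :
    S.ncard ≤ 24 := by
  classical
  let ν : EuclideanSpace ℝ (Fin 4) → EuclideanSpace ℝ (Fin 4) := fun x => ‖x‖⁻¹ • x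
  have hnorm : ∀ x ∈ S, ‖ν x‖ = 1 := fun x hx => norm_smul_inv_norm (𝕜 := ℝ) (h0 x hx)
  have hsep : ∀ x ∈ S, ∀ y ∈ S, x ≠ y → (inner ℝ (ν x) (ν y) : ℝ) < 1 / 2 := by
    intro x hx y hy hxy
    have hx0 := norm_pos_iff.mpr (h0 x hx)
    have hy0 := norm_pos_iff.mpr (h0 y hy)
    have := h x hx y hy hxy
    simp only [ν, real_inner_smul_left, real_inner_smul_right]
    rw [← mul_assoc, ← mul_inv, inv_mul_lt_iff₀ (by positivity)]
    linarith
  have hinj : Set.InjOn ν S := by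
    intro x hx y hy hxy
    by_contra hne
    have := hsep x hx y hy hne
    rw [hxy, real_inner_self_eq_norm_sq, hnorm y hy] at this
    norm_num at this
  rw [← Set.InjOn.ncard_image hinj, Set.ncard_eq_toFinset_card _ (hfin.image ν)]
  refine card_le_twentyfour_of_unit ?_ ?_
  · intro x hx
    obtain ⟨a, ha, rfl⟩ := (hfin.image ν).mem_toFinset.mp hx
    exact hnorm a ha
  · intro x hx y hy hxy
    obtain ⟨a, ha, rfl⟩ := (hfin.image ν).mem_toFinset.mp hx
    obtain ⟨b, hb, rfl⟩ := (hfin.image ν).mem_toFinset.mp hy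
    exact (hsep a ha b hb fun hab => hxy (by rw [hab])).le
end

section
/- Let S be a finite set of quaternions such that for any two distinct z, w ∈ S one has ‖z − w‖² ≥ 1 + ‖z‖². Then S has at most 24 elements. -/
/-!
# Quaternions separated by `‖z - w‖ ^ 2 ≥ 1 + ‖z‖ ^ 2`

The directions of such quaternions meet pairwise at angles greater than `π / 3`, so the statement
follows from the bound `24` for the kissing number in dimension four. That bound is proved by a
three-point positive semidefinite certificate in the style of Bachoc and Vallentin.
-/

noncomputable section

namespace ThreePointBound

/-! ### Polynomials in three variables as nested coefficient lists -/

section ListPolynomials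

variable {α : Type*}

/-- Addition of coefficient lists. The operations on coefficient lists are defined by the primitive
recursor because the kernel reduces it fast. -/
def addList (f : α → α → α) (p : List α) : List α → List α :=
  p.rec (fun q => q) fun a p ih q => q.rec (a :: p) fun b q _ => f a b :: ih q

/-- Multiplication of the coefficients in a list by a constant. -/
def smulList (m : α → α → α) (a : α) (p : List α) : List α :=
  p.rec [] fun b _ ih => m a b :: ih

/-- Multiplication of coefficient lists. -/
def mulList (f m : α → α → α) (z : α) (p q : List α) : List α :=
  p.rec [] fun a _ ih => addList f (smulList m a q) (z :: ih)

/-- The value at `x` of a coefficient list whose coefficients are evaluated by `ev`. -/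
def evalList {R : Type*} [Zero R] [Add R] [Mul R] (ev : α → R) (x : R) (p : List α) : R :=
  p.rec 0 fun a _ r => ev a + x * r

@[simp] theorem evalList_nil {R : Type*} [Zero R] [Add R] [Mul R] (ev : α → R) (x : R) :
    evalList ev x [] = 0 := rfl

@[simp] theorem evalList_cons {R : Type*} [Zero R] [Add R] [Mul R] (ev : α → R) (x : R) (a : α)
    (p : List α) : evalList ev x (a :: p) = ev a + x * evalList ev x p := rfl

variable {ev : α → ℝ} {f m : α → α → α} {z : α}

theorem evalList_addList (hf : ∀ a b, ev (f a b) = ev a + ev b) (x : ℝ) (p q : List α) :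
    evalList ev x (addList f p q) = evalList ev x p + evalList ev x q := by
  induction p generalizing q with
  | nil => simp [addList]
  | cons a p ih =>
    cases q with
    | nil => simp [addList]
    | cons b q =>
      change evalList ev x (f a b :: addList f p q) = _
      simp only [evalList_cons, hf, ih]
      ring

theorem evalList_smulList (hm : ∀ a b, ev (m a b) = ev a * ev b) (x : ℝ) (a : α) (p : List α) :
    evalList ev x (smulList m a p) = ev a * evalList ev x p := by
  induction p with
  | nil => simp [smulList]
  | cons b p ih =>
    change evalList ev x (m a b :: smulList m a p) = _
    simp only [evalList_cons, hm, ih]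
    ring

theorem evalList_mulList (hf : ∀ a b, ev (f a b) = ev a + ev b)
    (hm : ∀ a b, ev (m a b) = ev a * ev b) (hz : ev z = 0) (x : ℝ) (p q : List α) :
    evalList ev x (mulList f m z p q) = evalList ev x p * evalList ev x q := by
  induction p with
  | nil => simp [mulList]
  | cons a p ih =>
    change evalList ev x (addList f (smulList m a q) (z :: mulList f m z p q)) = _
    rw [evalList_addList hf, evalList_smulList hm]
    simp only [evalList_cons, ih, hz]
    ring

/-- The sum of the sizes of the coefficients. -/
def sizeList (s : α → ℕ) (p : List α) : ℕ :=
  p.foldr (fun a n => s a + n) 0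

theorem abs_evalList_le {s : α → ℕ} (hs : ∀ a, |ev a| ≤ s a) {x : ℝ} (hx : |x| ≤ 1)
    (p : List α) : |evalList ev x p| ≤ sizeList s p := by
  induction p with
  | nil => simp [sizeList]
  | cons a p ih =>
    simp only [sizeList] at ih
    simp only [evalList_cons, sizeList, List.foldr_cons, Nat.cast_add]
    refine (abs_add_le _ _).trans (add_le_add (hs a) ?_)
    rw [abs_mul]
    exact (mul_le_of_le_one_left (abs_nonneg _) hx).trans ih

end ListPolynomials

/-- Evaluation of a univariate integer polynomial. -/
def eval₁ {R : Type*} [Zero R] [Add R] [Mul R] [IntCast R] (p : List ℤ) (x : R) : R :=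
  evalList (fun n : ℤ => (n : R)) x p

/-- Evaluation of a trivariate integer polynomial, given by nested coefficient lists. -/
def eval₃ {R : Type*} [Zero R] [Add R] [Mul R] [IntCast R] (p : List (List (List ℤ)))
    (x y z : R) : R :=
  evalList (evalList (evalList (fun n : ℤ => (n : R)) z) y) x p

/-- Integer polynomials in three variables. -/
structure TriPoly where
  /-- The coefficients, nested by variable. -/
  coeffs : List (List (List ℤ))

namespace TriPoly

instance : Zero TriPoly := ⟨⟨[]⟩⟩

instance : IntCast TriPoly := ⟨fun n => ⟨[[[n]]]⟩⟩

instance : Add TriPoly :=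
  ⟨fun p q => ⟨addList (addList (addList Int.add)) p.coeffs q.coeffs⟩⟩

instance : Mul TriPoly :=
  ⟨fun p q => ⟨mulList (addList (addList Int.add))
    (mulList (addList Int.add) (mulList Int.add Int.mul 0) []) [] p.coeffs q.coeffs⟩⟩

/-- The value of a polynomial at a point. -/
def eval (u v t : ℝ) (p : TriPoly) : ℝ :=
  eval₃ p.coeffs u v t

variable (u v t : ℝ)

@[simp] theorem eval_zero : eval u v t 0 = 0 := rfl

@[simp] theorem eval_intCast (n : ℤ) : eval u v t (n : TriPoly) = n := by
  change eval₃ [[[n]]] u v t = n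
  simp [eval₃]

@[simp] theorem eval_add (p q : TriPoly) :
    eval u v t (p + q) = eval u v t p + eval u v t q :=
  evalList_addList (evalList_addList (evalList_addList (by simp) _) _) _ _ _

@[simp] theorem eval_mul (p q : TriPoly) :
    eval u v t (p * q) = eval u v t p * eval u v t q :=
  evalList_mulList (evalList_addList (evalList_addList (by simp) _) _)
    (evalList_mulList (evalList_addList (by simp) _)
      (evalList_mulList (by simp) (by simp) (by simp) _) rfl _) rfl _ _ _

theorem eval_evalList {α : Type*} {ev : α → TriPoly} {ev' : α → ℝ}
    (h : ∀ a, eval u v t (ev a) = ev' a) (x : TriPoly) (p : List α) :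
    eval u v t (evalList ev x p) = evalList ev' (eval u v t x) p := by
  induction p with
  | nil => rfl
  | cons a p ih =>
    simp only [evalList_cons, eval_add, eval_mul, h, ih]

@[simp] theorem eval_eval₁ (p : List ℤ) (x : TriPoly) :
    eval u v t (eval₁ p x) = eval₁ p (eval u v t x) :=
  eval_evalList u v t (eval_intCast u v t) x p

@[simp] theorem eval_eval₃ (p : List (List (List ℤ))) (x y z : TriPoly) :
    eval u v t (eval₃ p x y z) = eval₃ p (eval u v t x) (eval u v t y) (eval u v t z) :=
  eval_evalList u v t (fun _ => eval_evalList u v t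
    (fun _ => eval_evalList u v t (eval_intCast u v t) _ _) _ _) _ _

@[simp] theorem eval_sum_map {α : Type*} (f : α → TriPoly) (l : List α) :
    eval u v t (l.map f).sum = (l.map fun a => eval u v t (f a)).sum := by
  induction l with
  | nil => rfl
  | cons a l ih => simp [ih]

/-- The sum of the absolute values of the coefficients. -/
def size (p : TriPoly) : ℕ :=
  sizeList (sizeList (sizeList Int.natAbs)) p.coeffs

variable {u v t}

theorem abs_eval_le (hu : |u| ≤ 1) (hv : |v| ≤ 1) (ht : |t| ≤ 1) (p : TriPoly) :
    |eval u v t p| ≤ p.size :=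
  abs_evalList_le (abs_evalList_le (abs_evalList_le
    (fun n => by rw [Nat.cast_natAbs, Int.cast_abs]) ht) hv) hu _

/-- The first variable. -/
def X : TriPoly := ⟨[[], [[1]]]⟩

/-- The second variable. -/
def Y : TriPoly := ⟨[[[], [1]]]⟩

/-- The third variable. -/
def Z : TriPoly := ⟨[[[0, 1]]]⟩

@[simp] theorem eval_X : eval u v t X = u := by simp [eval, X, eval₃]

@[simp] theorem eval_Y : eval u v t Y = v := by simp [eval, Y, eval₃]

@[simp] theorem eval_Z : eval u v t Z = t := by simp [eval, Z, eval₃]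

end TriPoly

/-! ### The certificate -/

/-- Weights multiplying the zonal kernel of degree 0. -/
def weights0 : List (List ℤ) :=
  [[1581483, 7084227, -3161426, -8525705, 6865218, -2346769, -19281334], [0, 5815361, -3939216,
  -10507661, -5099552, -4140219, 19076026], [0, 0, -9945334, -13886880, 6711761, 34298490,
  18778419]]

/-- Weights multiplying the zonal kernel of degree 1. -/
def weights1 : List (List ℤ) :=
  [[3152948, 9325927, 7368901, -22588059, -31645716, -196138], [0, 10343620, -7612248, -11396623,
  21850119, 5183964], [0, 0, 10165780, -3829261, -8377082, -29223945], [0, 0, 0, 2045410, 25109837,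
  25624959]]

/-- Weights multiplying the zonal kernel of degree 2. -/
def weights2 : List (List ℤ) :=
  [[3948173, 8101289, 3809822, -20438112, -23380118], [0, 6412377, 3684757, -5396649, -270003], [0,
  0, -15274395, -10539352, -13817178]]

/-- Weights multiplying the zonal kernel of degree 3. -/
def weights3 : List (List ℤ) :=
  [[-4299613, -12963179, 4914444, 14802823]]

/-- Weights multiplying the zonal kernel of degree 4. -/
def weights4 : List (List ℤ) :=
  [[2447817, 9624374, -2135947]]

/-- Polynomials in the elementary symmetric functions whose squares enter with weight one. -/
def symmetricSquares : List (List (List (List ℤ))) :=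
  [[[[7919692, -4498059, -1572450775], [204910741, -367219390], [1020268558], [1090656014]],
  [[33938181, -764097668], [-141880912, 251425263], [-399586064]], [[-63980168, -835093816],
  [-237662802], [-1558287744]], [[16225262, -565148986], [935691520]], [[11362002], [887486544]],
  [[-224356163]], [[-152627234]]], [[[0, 111519204, -850340446], [38562967, 54696599], [162921703],
  [33513186]], [[-5526200, -265179305], [-102428073, -38110393], [-36691757]], [[-15916785,
  -379899177], [-57456744], [-186393496]], [[52468686, -358973200], [357189504]], [[24893502],
  [347079224]], [[-110293175]], [[-87047019]]], [[[0, 0, -1436659044], [-22899348, 127605648],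
  [-159021513], [-423589656]], [[-7139134, -511724625], [-66944380, -27005412], [-18834246]],
  [[-8136305, 506786957], [178275729], [308692876]], [[32352951, 369550063], [-106238437]],
  [[-6488518], [-161395889]], [[14893463]], [[19144052]]]]

/-- Polynomials whose squares are multiplied by `(1 + u) (1 - 2 u)`. -/
def intervalSquares : List (List (List (List ℤ))) :=
  [[[[34059902, 520192437, 1656191023], [92218720, 81329248, 1391105754], [-159158291, -191198459],
  [-186398545, 47001090], [-57718488], [-35282647]], [[236546978, 1005554255, 1520901532],
  [181043918, 854159066], [-552571200, 995838087], [-478586700], [-231253408]], [[487528180,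
  1089437564], [-28783009, 881276276], [-501529302], [-345408413]], [[236113692, 632011428],
  [-11223229], [-111078900]], [[-248924178], [134867034]], [[-179729788]]], [[[0, 180579804,
  641132037], [-47236927, -211858505, 837099806], [61334012, -401809531], [148085514, 199165115],
  [-53876499], [-146089738]], [[100696918, 590956567, -158763446], [-242247889, 497303254],
  [-116943580, -14718292], [5591422], [-44641418]], [[72837589, 1071934994], [-483057112,
  389368407], [-60926073], [37803016]], [[-122424587, 520141372], [-42997653], [138019302]],
  [[-19220597], [285082993]], [[102435278]]], [[[0, 0, 249329886], [23238810, -104064961,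
  333506948], [-49762816, -351114135], [-31373058, -452546641], [127620717], [122201353]],
  [[-49203721, -789746892, 135535668], [51421701, -1534618658], [251389720, -103293895],
  [329035059], [18889214]], [[15497413, -1066512244], [67562767, -1500365772], [139406267],
  [314873718]], [[-133508787, -268584984], [-100899644], [-122204472]], [[-266127547],
  [-147432940]], [[-14174993]]], [[[0, 0, 0], [53909469, 234669324, -93211080], [-8457451,
  401435441], [-166649386, 67987258], [-85200711], [32059218]], [[-125204195, -396390533,
  676961177], [75146758, -725519372], [498566660, 341479533], [-5870774], [-345986305]], [[33399836,
  -546008574], [81403022, -453098498], [72522053], [-107995616]], [[340890607, 11390327],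
  [209684380], [-457391257]], [[235778640], [248346690]], [[62686301]]], [[[0, 0, 0], [0, 6481531,
  95709806], [4176279, -45137924], [-3450540, -73017817], [6608457], [12350018]], [[-2606361,
  -19152126, -120851255], [3199363, -188835189], [65301793, 71470875], [13683310], [-59135458]],
  [[41694063, 318386057], [38961926, -187341793], [-128404236], [-25415311]], [[33095013,
  337032497], [79117128], [-173003779]], [[51016347], [64401332]], [[83742517]]]]

/-- Polynomials in the elementary symmetric functions whose squares are multiplied by the Gram
determinant. -/
def gramSquares : List (List (List (List ℤ))) :=
  [[[[4496108, -95973889], [162323275], [768916976]], [[39307737, -423833479], [-116774798]],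
  [[-75795666], [-118674444]], [[-18022740]], [[7415812]]]]

section Certificate

variable {R : Type*} [Zero R] [Add R] [Mul R] [IntCast R]

/-- The kernel `∑ w(u) w(v)` over the weights `w` in a list. -/
def weightKernel (ws : List (List ℤ)) (u v : R) : R :=
  (ws.map fun w => eval₁ w u * eval₁ w v).sum

/-- The inner product of the projections to the hyperplane orthogonal to the base point, in terms
of inner products of unit vectors. -/
def projInner (u v t : R) : R :=
  t + ((-1 : ℤ) : R) * (u * v)

/-- The product of the squared norms of the projections to the hyperplane orthogonal to the base
point. -/
def projNormSq (u v : R) : R :=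
  (((1 : ℤ) : R) + ((-1 : ℤ) : R) * (u * u)) * (((1 : ℤ) : R) + ((-1 : ℤ) : R) * (v * v))

/-- Eight times the homogenized Legendre polynomial of degree two. -/
def zonal₂ (s a : R) : R :=
  ((12 : ℤ) : R) * (s * s) + ((-4 : ℤ) : R) * a

/-- Eight times the homogenized Legendre polynomial of degree three. -/
def zonal₃ (s a : R) : R :=
  s * (((20 : ℤ) : R) * (s * s) + ((-12 : ℤ) : R) * a)

/-- Eight times the homogenized Legendre polynomial of degree four. -/
def zonal₄ (s a : R) : R :=
  ((35 : ℤ) : R) * (s * s * (s * s)) + ((-30 : ℤ) : R) * (s * s * a) + ((3 : ℤ) : R) * (a * a)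

/-- The positive semidefinite three-point kernel of the certificate. -/
def kernel (u v t : R) : R :=
  ((8 : ℤ) : R) * weightKernel weights0 u v +
  ((8 : ℤ) : R) * projInner u v t * weightKernel weights1 u v +
  zonal₂ (projInner u v t) (projNormSq u v) * weightKernel weights2 u v +
  zonal₃ (projInner u v t) (projNormSq u v) * weightKernel weights3 u v +
  zonal₄ (projInner u v t) (projNormSq u v) * weightKernel weights4 u v

/-- The kernel with the contributions of degenerate triples among 25 points distributed over the
triples of distinct points. -/
def tripleKernel (u v t : R) : R :=
  ((552 : ℤ) : R) * kernel u v t +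
  ((24 : ℤ) : R) * (kernel ((1 : ℤ) : R) u u + kernel u ((1 : ℤ) : R) u +
    kernel u u ((1 : ℤ) : R)) +
  kernel ((1 : ℤ) : R) ((1 : ℤ) : R) ((1 : ℤ) : R)

/-- The sum of the squares of some polynomials at a point. -/
def sumSq (ps : List (List (List (List ℤ)))) (x y z : R) : R :=
  (ps.map fun p => eval₃ p x y z * eval₃ p x y z).sum

/-- The Gram determinant of three unit vectors in terms of their inner products. -/
def gramDet (u v t : R) : R :=
  ((1 : ℤ) : R) + ((2 : ℤ) : R) * (u * v * t) + ((-1 : ℤ) : R) * (u * u + v * v + t * t)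

/-- The weighted sum of squares of the certificate. -/
def slack (u v t : R) : R :=
  sumSq symmetricSquares (u + v + t) (u * v + u * t + v * t) (u * v * t) +
  (((1 : ℤ) : R) + u) * (((1 : ℤ) : R) + ((-2 : ℤ) : R) * u) *
    sumSq intervalSquares u (v + t) (v * t) +
  gramDet u v t * sumSq gramSquares (u + v + t) (u * v + u * t + v * t) (u * v * t)

/-- The polynomial whose cyclic symmetrization is negative. -/
def total (u v t : R) : R :=
  tripleKernel u v t + slack u v t

end Certificate

/-- The cyclic symmetrization of `total`, shifted by a constant close to its negated constant
coefficient. -/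
def shiftedCyclicTotal : TriPoly :=
  let p : TriPoly := total .X .Y .Z
  p + eval₃ p.coeffs .Y .Z .X + eval₃ p.coeffs .Z .X .Y + ((126000000000000 : ℤ) : TriPoly)

theorem size_shiftedCyclicTotal : shiftedCyclicTotal.size < 126000000000000 := by
  decide +kernel

theorem eval_total (u v t : ℝ) : (total .X .Y .Z : TriPoly).eval u v t = total u v t := by
  simp [total, tripleKernel, slack, kernel, sumSq, gramDet, weightKernel, projInner, projNormSq,
    zonal₂, zonal₃, zonal₄]

theorem total_cyclic_neg {u v t : ℝ} (hu : |u| ≤ 1) (hv : |v| ≤ 1) (ht : |t| ≤ 1) :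
    total u v t + total v t u + total t u v < 0 := by
  have hs : (shiftedCyclicTotal.size : ℝ) < 126000000000000 := by
    exact_mod_cast size_shiftedCyclicTotal
  have h := ((le_abs_self _).trans (TriPoly.abs_eval_le hu hv ht shiftedCyclicTotal)).trans_lt hs
  have e (x y z : ℝ) :
      eval₃ (total .X .Y .Z : TriPoly).coeffs x y z = total x y z := eval_total x y z
  simp only [shiftedCyclicTotal, TriPoly.eval_add, TriPoly.eval_intCast, TriPoly.eval_eval₃,
    TriPoly.eval_X, TriPoly.eval_Y, TriPoly.eval_Z, e, eval_total] at h
  push_cast at h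
  linarith

/-! ### Positive semidefinite kernels on a finite type -/

section Kernels

variable {ι : Type*}

/-- The matrix of inner products of vectors given by their coordinates. -/
def gram (a b c d : ι → ℝ) (x y : ι) : ℝ :=
  a x * a y + b x * b y + c x * c y + d x * d y

theorem gram_comm (a b c d : ι → ℝ) (x y : ι) : gram a b c d x y = gram a b c d y x := by
  simp only [gram]
  ring

variable [Fintype ι]

/-- Positive semidefiniteness of a real kernel, as a quadratic form. -/
def PosKernel (K : ι → ι → ℝ) : Prop :=
  ∀ c : ι → ℝ, 0 ≤ ∑ x, ∑ y, c x * c y * K x y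

namespace PosKernel

theorem rankOne {a : ℝ} (ha : 0 ≤ a) (h : ι → ℝ) : PosKernel fun x y => a * (h x * h y) := by
  intro c
  have e : ∑ x, ∑ y, c x * c y * (a * (h x * h y)) = a * ((∑ x, c x * h x) * ∑ y, c y * h y) := by
    rw [Finset.sum_mul_sum, Finset.mul_sum]
    refine Finset.sum_congr rfl fun x _ => ?_
    rw [Finset.mul_sum]
    exact Finset.sum_congr rfl fun y _ => by ring
  rw [e]
  exact mul_nonneg ha (mul_self_nonneg _)

theorem add {K L : ι → ι → ℝ} (hK : PosKernel K) (hL : PosKernel L) :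
    PosKernel fun x y => K x y + L x y := by
  intro c
  simp only [mul_add, Finset.sum_add_distrib]
  exact add_nonneg (hK c) (hL c)

theorem congr {K L : ι → ι → ℝ} (hK : PosKernel K) (h : ∀ x y, L x y = K x y) : PosKernel L := by
  rwa [show L = K from funext₂ h]

theorem mul_weight {K : ι → ι → ℝ} (hK : PosKernel K) (w : ι → ℝ) :
    PosKernel fun x y => K x y * (w x * w y) := by
  intro c
  refine (hK fun x => c x * w x).trans_eq ?_
  exact Finset.sum_congr rfl fun x _ => Finset.sum_congr rfl fun y _ => by ring

theorem mul_weightKernel {K : ι → ι → ℝ} (hK : PosKernel K) (ws : List (List ℤ)) (u : ι → ℝ) :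
    PosKernel fun x y => K x y * weightKernel ws (u x) (u y) := by
  induction ws with
  | nil => intro c; simp [weightKernel]
  | cons w ws ih =>
    refine ((hK.mul_weight fun x => eval₁ w (u x)).add ih).congr fun x y => ?_
    simp only [weightKernel, List.map_cons, List.sum_cons, mul_add]

variable (p q r : ι → ℝ)

theorem zonal₁ : PosKernel fun x y => 8 * (p x * p y + q x * q y + r x * r y) := by
  refine ((rankOne (a := 8) (by norm_num) p).add ((rankOne (a := 8) (by norm_num) q).add
    (rankOne (a := 8) (by norm_num) r))).congr fun x y => ?_
  ring

theorem zonal₂ : PosKernel fun x y => ThreePointBound.zonal₂ (p x * p y + q x * q y + r x * r y)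
    ((p x ^ 2 + q x ^ 2 + r x ^ 2) * (p y ^ 2 + q y ^ 2 + r y ^ 2)) := by
  have h₁ (f g : ι → ℝ) := rankOne (a := 24) (by norm_num) fun x => f x * g x
  have h₂ (f g : ι → ℝ) := rankOne (a := 4) (by norm_num) fun x => f x ^ 2 - g x ^ 2
  refine ((((h₁ p q).add (h₁ q r)).add (h₁ r p)).add
    (((h₂ p q).add (h₂ q r)).add (h₂ r p))).congr fun x y => ?_
  simp only [ThreePointBound.zonal₂]
  push_cast
  ring

theorem zonal₃ : PosKernel fun x y => ThreePointBound.zonal₃ (p x * p y + q x * q y + r x * r y)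
    ((p x ^ 2 + q x ^ 2 + r x ^ 2) * (p y ^ 2 + q y ^ 2 + r y ^ 2)) := by
  have h₁ := rankOne (a := 120) (by norm_num) fun x => p x * q x * r x
  have h₂ (f g h : ι → ℝ) := rankOne (a := 30) (by norm_num) fun x => f x * (g x ^ 2 - h x ^ 2)
  have h₃ (f g h : ι → ℝ) := rankOne (a := 2) (by norm_num)
    fun x => f x * (2 * f x ^ 2 - 3 * g x ^ 2 - 3 * h x ^ 2)
  refine ((h₁.add (((h₂ p q r).add (h₂ q r p)).add (h₂ r p q))).add
    (((h₃ p q r).add (h₃ q r p)).add (h₃ r p q))).congr fun x y => ?_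
  simp only [ThreePointBound.zonal₃]
  push_cast
  ring

theorem zonal₄ : PosKernel fun x y => ThreePointBound.zonal₄ (p x * p y + q x * q y + r x * r y)
    ((p x ^ 2 + q x ^ 2 + r x ^ 2) * (p y ^ 2 + q y ^ 2 + r y ^ 2)) := by
  have h₁ (f g : ι → ℝ) := rankOne (a := 70) (by norm_num)
    fun x => f x * g x * (f x ^ 2 - g x ^ 2)
  have h₂ (f g h : ι → ℝ) := rankOne (a := 10) (by norm_num)
    fun x => f x * g x * (6 * h x ^ 2 - f x ^ 2 - g x ^ 2)
  have h₃ := rankOne (a := 14 / 3) (by norm_num) fun x => p x ^ 4 + q x ^ 4 + r x ^ 4 -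
    3 * (p x ^ 2 * q x ^ 2 + q x ^ 2 * r x ^ 2 + r x ^ 2 * p x ^ 2)
  have h₄ (f g h : ι → ℝ) := rankOne (a := 5 / 3) (by norm_num) fun x =>
    (f x ^ 4 - 6 * f x ^ 2 * g x ^ 2 + g x ^ 4) - (g x ^ 4 - 6 * g x ^ 2 * h x ^ 2 + h x ^ 4)
  refine (((((h₁ p q).add (h₁ q r)).add (h₁ r p)).add
    (((h₂ p q r).add (h₂ q r p)).add (h₂ r p q))).add
    (h₃.add (((h₄ p q r).add (h₄ q r p)).add (h₄ r p q)))).congr fun x y => ?_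
  simp only [ThreePointBound.zonal₄]
  push_cast
  ring

end PosKernel

/-! ### Unit vectors in four-dimensional space -/

variable {a b c d : ι → ℝ}

theorem posKernel_kernel (hu : ∀ x, gram a b c d x x = 1) (e : ι) :
    PosKernel fun x y =>
      kernel (gram a b c d e x) (gram a b c d e y) (gram a b c d x y) := by
  let p (x : ι) := a e * b x - b e * a x - c e * d x + d e * c x
  let q (x : ι) := a e * c x + b e * d x - c e * a x - d e * b x
  let r (x : ι) := a e * d x - b e * c x + c e * b x - d e * a x
  have hs (x y : ι) : projInner (gram a b c d e x) (gram a b c d e y) (gram a b c d x y) =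
      p x * p y + q x * q y + r x * r y := by
    have h : gram a b c d x y = gram a b c d e e * gram a b c d x y := by rw [hu, one_mul]
    rw [projInner, h]
    simp only [gram, p, q, r]
    push_cast
    ring
  have hn (x y : ι) : projNormSq (gram a b c d e x) (gram a b c d e y) =
      (p x ^ 2 + q x ^ 2 + r x ^ 2) * (p y ^ 2 + q y ^ 2 + r y ^ 2) := by
    have h (x : ι) : 1 - gram a b c d e x ^ 2 = p x ^ 2 + q x ^ 2 + r x ^ 2 := by
      have h' := hs x x
      rw [projInner, hu] at h'
      push_cast at h'
      linear_combination h'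
    rw [← h, ← h, projNormSq]
    push_cast
    ring
  have h₀ := (PosKernel.rankOne (a := 8) (by norm_num) fun _ : ι => (1 : ℝ)).mul_weightKernel
    weights0 (gram a b c d e)
  have h₁ := (PosKernel.zonal₁ p q r).mul_weightKernel weights1 (gram a b c d e)
  have h₂ := (PosKernel.zonal₂ p q r).mul_weightKernel weights2 (gram a b c d e)
  have h₃ := (PosKernel.zonal₃ p q r).mul_weightKernel weights3 (gram a b c d e)
  have h₄ := (PosKernel.zonal₄ p q r).mul_weightKernel weights4 (gram a b c d e)
  refine ((((h₀.add h₁).add h₂).add h₃).add h₄).congr fun x y => ?_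
  simp only [kernel, hs, hn]
  push_cast
  ring

theorem sum_kernel_nonneg (hu : ∀ x, gram a b c d x x = 1) :
    0 ≤ ∑ e, ∑ x, ∑ y,
      kernel (gram a b c d e x) (gram a b c d e y) (gram a b c d x y) := by
  refine Finset.sum_nonneg fun e _ => ?_
  have h := posKernel_kernel hu e fun _ => 1
  simpa using h

end Kernels

/-! ### Sums over triples of distinct points -/

section DistinctTriples

variable {ι : Type*} [Fintype ι] [DecidableEq ι]

/-- The sum of a function over all triples of distinct points. -/
def distinctSum (f : ι → ι → ι → ℝ) : ℝ :=
  ∑ e, ∑ x, ∑ y, if e ≠ x ∧ e ≠ y ∧ x ≠ y then f e x y else 0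

theorem distinctSum_eq (f : ι → ι → ι → ℝ) :
    distinctSum f = ∑ e, ∑ x, ∑ y, f e x y -
      (∑ e, ∑ x, (f e e x + f e x e + f e x x)) + 2 * ∑ e, f e e e := by
  have h (e x y : ι) : (if e ≠ x ∧ e ≠ y ∧ x ≠ y then f e x y else 0) =
      f e x y - (if e = x then f e e y else 0) - (if e = y then f e x e else 0) -
        (if x = y then f e x x else 0) +
        2 * if e = x then (if e = y then f e e e else 0) else 0 := by
    split_ifs <;> subst_vars <;> simp_all
    ring
  simp only [distinctSum, h, Finset.sum_add_distrib, Finset.sum_sub_distrib, ← Finset.mul_sum]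
  simp [Finset.sum_ite_eq, Finset.sum_ite_irrel]
  ring

theorem distinctSum_rotate (f : ι → ι → ι → ℝ) :
    distinctSum (fun e x y => f x y e) = distinctSum f := by
  simp only [distinctSum]
  rw [Finset.sum_comm]
  refine Finset.sum_congr rfl fun x _ => ?_
  rw [Finset.sum_comm]
  refine Finset.sum_congr rfl fun y _ => Finset.sum_congr rfl fun e _ => ?_
  refine if_congr ?_ rfl rfl
  simp only [ne_comm (a := e)]
  tauto

theorem distinctSum_add (f g : ι → ι → ι → ℝ) :
    distinctSum (fun e x y => f e x y + g e x y) = distinctSum f + distinctSum g := by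
  simp only [distinctSum, ← Finset.sum_add_distrib]
  refine Finset.sum_congr rfl fun e _ => Finset.sum_congr rfl fun x _ =>
    Finset.sum_congr rfl fun y _ => ?_
  split_ifs <;> simp

theorem distinctSum_nonneg {f : ι → ι → ι → ℝ}
    (h : ∀ e x y, e ≠ x → e ≠ y → x ≠ y → 0 ≤ f e x y) : 0 ≤ distinctSum f := by
  refine Finset.sum_nonneg fun e _ => Finset.sum_nonneg fun x _ => Finset.sum_nonneg fun y _ => ?_
  split_ifs with hd
  · exact h e x y hd.1 hd.2.1 hd.2.2
  · rfl

theorem distinctSum_neg {f : ι → ι → ι → ℝ} (hι : 2 < Fintype.card ι)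
    (h : ∀ e x y, f e x y < 0) : distinctSum f < 0 := by
  obtain ⟨e, x, y, hex, hey, hxy⟩ := Fintype.two_lt_card_iff.mp hι
  have hf (e x y : ι) : (if e ≠ x ∧ e ≠ y ∧ x ≠ y then f e x y else 0) ≤ 0 := by
    split_ifs
    · exact (h e x y).le
    · rfl
  refine Finset.sum_neg' (fun e _ => Finset.sum_nonpos fun x _ => Finset.sum_nonpos fun y _ =>
    hf e x y) ⟨e, Finset.mem_univ e, ?_⟩
  refine Finset.sum_neg' (fun x _ => Finset.sum_nonpos fun y _ =>
    hf e x y) ⟨x, Finset.mem_univ x, ?_⟩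
  refine Finset.sum_neg' (fun y _ => hf e x y) ⟨y, Finset.mem_univ y, ?_⟩
  rw [if_pos ⟨hex, hey, hxy⟩]
  exact h e x y

theorem distinctSum_tripleKernel (hι : Fintype.card ι = 25) (G : ι → ι → ℝ)
    (hG : ∀ x, G x x = 1) (hG' : ∀ x y, G x y = G y x) :
    distinctSum (fun e x y => tripleKernel (G e x) (G e y) (G x y)) =
      552 * ∑ e, ∑ x, ∑ y, kernel (G e x) (G e y) (G x y) := by
  let k₂ (u : ℝ) : ℝ := kernel 1 u u + kernel u 1 u + kernel u u 1
  let k₃ : ℝ := kernel (1 : ℝ) 1 1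
  have h (u v t : ℝ) : tripleKernel u v t = 552 * kernel u v t + 24 * k₂ u + k₃ := by
    simp only [tripleKernel, k₂, k₃]
    push_cast
    rfl
  have h₂ (e x : ι) : tripleKernel (G e e) (G e x) (G e x) + tripleKernel (G e x) (G e e) (G x e) +
      tripleKernel (G e x) (G e x) (G x x) = 600 * k₂ (G e x) + 75 * k₃ := by
    simp only [h, hG, hG' x e, k₂, k₃]
    ring
  have h₃ (e : ι) : tripleKernel (G e e) (G e e) (G e e) = 625 * k₃ := by
    simp only [h, hG, k₂, k₃]
    ring
  rw [distinctSum_eq]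
  simp only [h₂, h₃]
  simp only [h, Finset.sum_add_distrib, ← Finset.mul_sum, Finset.sum_const, Finset.card_univ, hι,
    nsmul_eq_mul]
  push_cast
  ring

end DistinctTriples

theorem sumSq_nonneg (ps : List (List (List (List ℤ)))) (x y z : ℝ) : 0 ≤ sumSq ps x y z := by
  refine List.sum_nonneg fun s hs => ?_
  obtain ⟨p, -, rfl⟩ := List.mem_map.mp hs
  exact mul_self_nonneg _

theorem slack_nonneg {u v t : ℝ} (hu : |u| ≤ 1) (hu' : u ≤ 1 / 2) (hg : 0 ≤ gramDet u v t) :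
    0 ≤ slack u v t := by
  have h := neg_le_of_abs_le hu
  refine add_nonneg (add_nonneg (sumSq_nonneg _ _ _ _) (mul_nonneg (mul_nonneg ?_ ?_)
    (sumSq_nonneg _ _ _ _))) (mul_nonneg hg (sumSq_nonneg _ _ _ _))
  all_goals
    push_cast
    linarith

section Gram

variable {ι : Type*} {a b c d : ι → ℝ}

theorem gramDet_nonneg (hu : ∀ x, gram a b c d x x = 1) (x y z : ι) :
    0 ≤ gramDet (gram a b c d x y) (gram a b c d x z) (gram a b c d y z) := by
  let m (f g h : ι → ℝ) : ℝ := f x * (g y * h z - g z * h y) - f y * (g x * h z - g z * h x) +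
    f z * (g x * h y - g y * h x)
  have h : gramDet (gram a b c d x y) (gram a b c d x z) (gram a b c d y z) =
      gram a b c d x x * gram a b c d y y * gram a b c d z z +
      2 * (gram a b c d x y * gram a b c d x z * gram a b c d y z) -
      (gram a b c d x y ^ 2 * gram a b c d z z + gram a b c d x z ^ 2 * gram a b c d y y +
        gram a b c d y z ^ 2 * gram a b c d x x) := by
    simp only [gramDet, hu]
    push_cast
    ring
  have h' : gramDet (gram a b c d x y) (gram a b c d x z) (gram a b c d y z) =
      m a b c ^ 2 + m a b d ^ 2 + m a c d ^ 2 + m b c d ^ 2 := by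
    rw [h]
    simp only [gram, m]
    ring
  rw [h']
  positivity

theorem abs_gram_le (hu : ∀ x, gram a b c d x x = 1) (x y : ι) : |gram a b c d x y| ≤ 1 := by
  have h₁ := hu x
  have h₂ := hu y
  simp only [gram] at h₁ h₂ ⊢
  rw [abs_le]
  constructor
  · nlinarith [sq_nonneg (a x + a y), sq_nonneg (b x + b y), sq_nonneg (c x + c y),
      sq_nonneg (d x + d y)]
  · nlinarith [sq_nonneg (a x - a y), sq_nonneg (b x - b y), sq_nonneg (c x - c y),
      sq_nonneg (d x - d y)]

/-- There are no 25 unit vectors in four-dimensional space at angles at least `π / 3`. -/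
theorem card_ne_of_gram_le [Fintype ι] (hu : ∀ x, gram a b c d x x = 1)
    (hs : ∀ x y, x ≠ y → gram a b c d x y ≤ 1 / 2) : Fintype.card ι ≠ 25 := by
  classical
  intro hι
  have hG := gram_comm a b c d
  have hk := distinctSum_tripleKernel hι (gram a b c d) hu hG
  have hk' := sum_kernel_nonneg hu
  let f (e x y : ι) := total (gram a b c d e x) (gram a b c d e y) (gram a b c d x y)
  have hf : 0 ≤ distinctSum f := by
    have h := distinctSum_add
      (fun e x y => tripleKernel (gram a b c d e x) (gram a b c d e y) (gram a b c d x y))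
      (fun e x y => slack (gram a b c d e x) (gram a b c d e y) (gram a b c d x y))
    have h' := distinctSum_nonneg
      (f := fun e x y => slack (gram a b c d e x) (gram a b c d e y) (gram a b c d x y))
      fun e x y hex _ _ => slack_nonneg (abs_gram_le hu e x) (hs e x hex) (gramDet_nonneg hu e x y)
    change 0 ≤ distinctSum fun e x y => _ + _
    linarith
  have h₁ := distinctSum_rotate f
  have h₂ := distinctSum_rotate fun e x y => f x y e
  have h₃ := distinctSum_add (fun e x y => f x y e) (fun e x y => f y e x)
  have h₄ := distinctSum_add f (fun e x y => f x y e + f y e x)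
  have h₅ : distinctSum (fun e x y => f e x y + (f x y e + f y e x)) < 0 := by
    refine distinctSum_neg (by omega) fun e x y => ?_
    have h := total_cyclic_neg (abs_gram_le hu e x) (abs_gram_le hu e y) (abs_gram_le hu x y)
    simp only [f, hG x e, hG y e, hG y x]
    linarith
  linarith

end Gram

end ThreePointBound

end

theorem card_le_twentyfour_of_quaternion_separation
    (S : Set (Quaternion ℝ)) (hfin : S.Finite)
    (h : ∀ z ∈ S, ∀ w ∈ S, z ≠ w → 1 + ‖z‖ ^ 2 ≤ ‖z - w‖ ^ 2) :
    S.ncard ≤ 24 := by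
  by_contra! hS
  rw [Set.ncard_eq_toFinset_card S hfin] at hS
  obtain ⟨T, hTS, hT⟩ := Finset.exists_subset_card_eq (n := 25) (s := hfin.toFinset) hS
  have hTS' (z : T) : (z : Quaternion ℝ) ∈ S := hfin.mem_toFinset.mp (hTS z.2)
  have hn (z : Quaternion ℝ) :
      ‖z‖ ^ 2 = z.re ^ 2 + z.imI ^ 2 + z.imJ ^ 2 + z.imK ^ 2 := by
    rw [sq, ← Quaternion.normSq_eq_norm_mul_self, Quaternion.normSq_def']
  have h0 (z : T) : 0 < ‖(z : Quaternion ℝ)‖ := by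
    rw [norm_pos_iff]
    intro hz
    obtain ⟨w, hw, hwz⟩ := Finset.exists_mem_ne (by omega : 1 < T.card) (z : Quaternion ℝ)
    have hw' := h w (hTS' ⟨w, hw⟩) z (hTS' z) hwz
    rw [hz, sub_zero] at hw'
    linarith
  have hip (z w : T) (hzw : z ≠ w) : 2 * ((z : Quaternion ℝ).re * (w : Quaternion ℝ).re +
      (z : Quaternion ℝ).imI * (w : Quaternion ℝ).imI +
      (z : Quaternion ℝ).imJ * (w : Quaternion ℝ).imJ +
      (z : Quaternion ℝ).imK * (w : Quaternion ℝ).imK) ≤ ‖(w : Quaternion ℝ)‖ ^ 2 - 1 := by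
    have hd := h z (hTS' z) w (hTS' w) (Subtype.coe_ne_coe.mpr hzw)
    simp only [hn, Quaternion.re_sub, Quaternion.imI_sub, Quaternion.imJ_sub,
      Quaternion.imK_sub] at hd ⊢
    linarith
  let f (g : Quaternion ℝ → ℝ) (z : T) : ℝ := g z / ‖(z : Quaternion ℝ)‖
  have hg (z w : T) : ThreePointBound.gram (f (·.re)) (f (·.imI)) (f (·.imJ)) (f (·.imK)) z w =
      (z.1.re * w.1.re + z.1.imI * w.1.imI + z.1.imJ * w.1.imJ + z.1.imK * w.1.imK) /
        (‖z.1‖ * ‖w.1‖) := by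
    simp only [ThreePointBound.gram, f]
    ring
  refine ThreePointBound.card_ne_of_gram_le (a := f (·.re)) (b := f (·.imI)) (c := f (·.imJ))
    (d := f (·.imK)) (fun z => ?_) (fun z w hzw => ?_)
    ((Fintype.card_coe T).trans hT)
  · have hz := (h0 z).ne'
    rw [hg, div_eq_one_iff_eq (mul_ne_zero hz hz), ← sq ‖z.1‖, hn]
    ring
  · rw [hg, div_le_iff₀ (mul_pos (h0 z) (h0 w))]
    have h₁ := hip z w hzw
    have h₂ := hip w z hzw.symm
    rcases le_total ‖z.1‖ ‖w.1‖ with hle | hle <;> nlinarith [h0 z, h0 w]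
end

section
/- Let S be a finite set of quaternions that is equilateral, i.e., there exists d > 0 such that for any two distinct x, y ∈ S one has dist x y = d. Then S has at most 5 elements. -/
/-- Points of a Euclidean space at pairwise equal positive distances are affinely independent. -/
theorem affineIndependent_of_pairwise_dist_eq {ι V P : Type*} [NormedAddCommGroup V]
    [InnerProductSpace ℝ V] [MetricSpace P] [NormedAddTorsor V P] {p : ι → P} {d : ℝ}
    (hd : 0 < d) (hp : Pairwise fun i j => dist (p i) (p j) = d) :
    AffineIndependent ℝ p := by
  classical
  intro s w hw hs
  have hdist (i j : ι) : w i * w j * (dist (p i) (p j) * dist (p i) (p j)) =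
      w i * w j * (d * d) - if i = j then w i * w j * (d * d) else 0 := by
    by_cases hij : i = j
    · simp [hij]
    · simp [hij, hp hij]
  have key := EuclideanGeometry.inner_weightedVSub p hw p hw
  have hrow (i : ι) : ∑ j ∈ s, w i * w j * (d * d) = 0 := by
    rw [← Finset.sum_mul, ← Finset.mul_sum, hw, mul_zero, zero_mul]
  have hsum : (∑ i ∈ s, w i * w i) * (d * d) = 0 := by
    simp only [hs, inner_zero_left, hdist, Finset.sum_sub_distrib, hrow, Finset.sum_ite_eq,
      Finset.sum_ite_mem, Finset.inter_self, zero_sub, Finset.sum_neg_distrib] at key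
    rw [Finset.sum_mul]
    linarith
  have hsq := (mul_eq_zero.mp hsum).resolve_right (mul_pos hd hd).ne'
  intro i hi
  exact mul_self_eq_zero.mp
    ((Finset.sum_eq_zero_iff_of_nonneg fun j _ => mul_self_nonneg (w j)).mp hsq i hi)

theorem equilateral_set_quaternion_card_le_five
    (S : Set (Quaternion ℝ)) (hfin : S.Finite)
    (h : ∃ d : ℝ, 0 < d ∧ ∀ x ∈ S, ∀ y ∈ S, x ≠ y → dist x y = d) :
    S.ncard ≤ 5 := by
  obtain ⟨d, hd, hS⟩ := h
  have : Fintype S := hfin.fintype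
  have hind : AffineIndependent ℝ ((↑) : S → Quaternion ℝ) :=
    affineIndependent_of_pairwise_dist_eq hd fun x y hxy =>
      hS x x.2 y y.2 (Subtype.coe_injective.ne hxy)
  have hcard := hind.card_le_finrank_succ
  have hrank := Submodule.finrank_le
    (vectorSpan ℝ (Set.range ((↑) : S → Quaternion ℝ)))
  rw [Quaternion.finrank_eq_four] at hrank
  rw [← Nat.card_coe_set_eq, Nat.card_eq_fintype_card]
  lia
end
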